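/- arXiv:2602.01145 — 2 statements merged into one kernel-verified Lean document; each statement's English description precedes it below -/
import Mathlib

section
/- Under the setting of the context (θ-scheme configurations with parameters N_n, M_n → ∞ satisfying the CFL condition θ N_n T [v]_Lip R² < L M_n, initial positions at the ℓ_n-quantile points of ρ̄, 0 < R_i^{(n),m} ≤ R, and discrete densities ρ_n), assume in addition that N_n/M_n → 0. Then there exists a function ρ which is an entropy solution of the Cauchy problem ∂_t ρ + ∂_x(ρ v(ρ)) = 0, ρ(·,0) = ρ̄, on ℝ × [0,T], such that the whole sequence (ρ_n) converges to ρ strongly in L¹(ℝ × [0,T]); here an entropy solution is a compactly supported ρ ∈ L∞(ℝ × [0,T]) with 0 ≤ ρ ≤ R a.e. satisfying, for every k ∈ [0,R] and every nonnegative continuously differentiable φ with compact support in ℝ × [0,T), ∫_0^T ∫_ℝ ( |ρ − k| ∂_t φ + sgn(ρ − k)( f(ρ) − f(k) ) ∂_x φ ) dx dt + ∫_ℝ |ρ̄(x) − k| φ(x,0) dx ≥ 0, with f(ρ) = ρ v(ρ). -/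
open MeasureTheory Filter

/-- Discrete density `R_i^m = ℓ/(x_{i+1}^m - x_i^m)` for `i < N`, with the
convention `R_N^m = 0`. -/
noncomputable def Rd (N : ℕ) (l : ℝ) (x : ℕ → ℕ → ℝ) (i m : ℕ) : ℝ :=
  if i < N then l / (x (i + 1) m - x i m) else 0

/-- A particle configuration for the θ-scheme with parameters `N, M, ℓ, τ`. -/
def IsScheme (N M : ℕ) (l τ θ : ℝ) (v : ℝ → ℝ) (x : ℕ → ℕ → ℝ) : Prop :=
  (∀ m ≤ M, ∀ i < N, x i m < x (i + 1) m) ∧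
  (∀ m < M, x N (m + 1) = x N m + τ * v 0) ∧
  (∀ m < M, ∀ i < N,
    x i (m + 1) = x i m + τ * (θ * v (Rd N l x i m) + (1 - θ) * v (Rd N l x i (m + 1))))

/-- The fully discrete density
`ρ_N^M(y,t) = Σ_m Σ_i R_i^m 1_{[x_i^m, x_{i+1}^m)}(y) 1_{[t^m, t^{m+1})}(t)`. -/
noncomputable def discDens (N M : ℕ) (l τ : ℝ) (x : ℕ → ℕ → ℝ) (y t : ℝ) : ℝ :=
  ∑ m ∈ Finset.range M, ∑ i ∈ Finset.range N,
    Rd N l x i m * Set.indicator (Set.Ico (x i m) (x (i + 1) m)) (fun _ => (1 : ℝ)) y *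
      Set.indicator (Set.Ico ((m : ℝ) * τ) (((m : ℝ) + 1) * τ)) (fun _ => (1 : ℝ)) t

/-! ### Basic objects -/

/-- density of the `i`-th cell of a configuration. -/
noncomputable def rr (N : ℕ) (l : ℝ) (X : ℕ → ℝ) (i : ℕ) : ℝ :=
  if i < N then l / (X (i + 1) - X i) else 0

/-- Time-continuous approximate follow-the-leader trajectories. -/
structure Traj (v : ℝ → ℝ) (R T C A B ω l : ℝ) (N : ℕ) (x a : ℕ → ℝ → ℝ) : Prop where
  hl : 0 < l
  hN : 0 < N
  cont : ∀ i, Continuous (x i)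
  der : ∀ i ≤ N, ∀ t ∈ Set.Ico 0 T, HasDerivWithinAt (x i) (a i t) (Set.Ici t) t
  mono : ∀ t ∈ Set.Icc 0 T, ∀ i < N, x i t < x (i + 1) t
  bd : ∀ t ∈ Set.Icc 0 T, ∀ i < N, rr N l (fun j => x j t) i ≤ R
  tv : ∀ t ∈ Set.Icc 0 T,
    ∑ i ∈ Finset.range N, |rr N l (fun j => x j t) (i + 1) - rr N l (fun j => x j t) i| ≤ C
  box : ∀ t ∈ Set.Icc 0 T, ∀ i ≤ N, x i t ∈ Set.Ioo A B
  err : ∀ t ∈ Set.Ico 0 T,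
    ∑ i ∈ Finset.range (N + 1), |a i t - v (rr N l (fun j => x j t) i)| ≤ ω

lemma Traj.err_le {v : ℝ → ℝ} {R T C A B ω l : ℝ} {N : ℕ} {x a : ℕ → ℝ → ℝ}
    (h : Traj v R T C A B ω l N x a) {t : ℝ} (ht : t ∈ Set.Ico 0 T) {i : ℕ} (hi : i ≤ N) :
    |a i t - v (rr N l (fun j => x j t) i)| ≤ ω := by
  refine le_trans ?_ (h.err t ht)
  exact Finset.single_le_sum (f := fun i => |a i t - v (rr N l (fun j => x j t) i)|)
    (fun _ _ => abs_nonneg _) (Finset.mem_range.2 (by omega))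

/-! ### A maximum principle for finite families -/

lemma max_principle {ι : Type*} [Finite ι] (f f' : ι → ℝ → ℝ) (m0 κ T : ℝ)
    (hc : ∀ α, ContinuousOn (f α) (Set.Icc 0 T))
    (hd : ∀ α, ∀ t ∈ Set.Ico 0 T, HasDerivWithinAt (f α) (f' α t) (Set.Ici t) t)
    (h0 : ∀ α, f α 0 ≤ m0)
    (hk : ∀ t ∈ Set.Ico 0 T, (∀ β, f β t ≤ m0 + κ * t) → ∀ α, f α t = m0 + κ * t → f' α t < κ) :
    ∀ t ∈ Set.Icc 0 T, ∀ α, f α t ≤ m0 + κ * t := by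
  have key : Set.Icc 0 T ⊆ {t | ∀ α, f α t ≤ m0 + κ * t} := by
    rcases lt_or_ge T 0 with hT | hT
    · simp [hT]
    refine IsClosed.Icc_subset_of_forall_mem_nhdsWithin ?_ ?_ ?_
    · have : {t | ∀ α, f α t ≤ m0 + κ * t} ∩ Set.Icc 0 T
          = Set.Icc 0 T ∩ ⋂ α, (Set.Icc 0 T ∩ {t | f α t ≤ m0 + κ * t}) := by
        ext t; simp only [Set.mem_inter_iff, Set.mem_ofPred_eq, Set.mem_iInter]
        exact ⟨fun h => ⟨h.2, fun i => ⟨h.2, h.1 i⟩⟩, fun h => ⟨fun i => (h.2 i).2, h.1⟩⟩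
      rw [this]
      refine isClosed_Icc.inter (isClosed_iInter fun α => ?_)
      exact isClosed_Icc.isClosed_le (hc α) (by fun_prop)
    · intro α; simpa using h0 α
    · rintro t ⟨ht, htI⟩
      simp only [Set.mem_ofPred_eq] at ht
      have : ∀ α, ∀ᶠ s in nhdsWithin t (Set.Ioi t), f α s ≤ m0 + κ * s := by
        intro α
        have hdg : HasDerivWithinAt (fun s => f α s - (m0 + κ * s)) (f' α t - κ) (Set.Ioi t) t := by
          have h1 := (hd α t htI).Ioi_of_Ici
          have h2 : HasDerivWithinAt (fun s : ℝ => m0 + κ * s) κ (Set.Ioi t) t := by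
            simpa using (((hasDerivAt_id t).const_mul κ).const_add m0).hasDerivWithinAt
          exact h1.sub h2
        rcases (ht α).lt_or_eq with hlt | heq
        · have hcw : ContinuousWithinAt (fun s => f α s - (m0 + κ * s)) (Set.Ioi t) t :=
            hdg.continuousWithinAt
          have := hcw.eventually (gt_mem_nhds (show f α t - (m0 + κ * t) < 0 by linarith))
          filter_upwards [this] with s hs
          linarith
        · have hlt := hk t htI ht α heq
          have := (hasDerivWithinAt_iff_tendsto_slope' (by simp)).1 hdg
          have := this.eventually (gt_mem_nhds (show f' α t - κ < 0 by linarith))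
          filter_upwards [this, self_mem_nhdsWithin] with s hs hst
          have hst' : 0 < s - t := sub_pos.2 hst
          rw [slope_def_field, div_lt_iff₀ hst'] at hs
          linarith
      exact eventually_all.2 this
  intro t ht α
  exact key ht α

/-! ### Comparison of cumulative masses -/

lemma hj_psi_upper {d D ε : ℝ} (hε : 0 < ε) (hD : 0 ≤ D) :
    (max (d + D) 0)^2/(2*ε) - (max d 0)^2/(2*ε) ≤ max d 0/ε * D + D^2/(2*ε) := by
  have h1 : max (d + D) 0 ≤ max d 0 + D := by
    apply max_le
    · linarith [le_max_left d 0]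
    · linarith [le_max_right d 0]
  have h0 : 0 ≤ max (d + D) 0 := le_max_right _ _
  have h2 : (max (d+D) 0)^2 ≤ (max d 0 + D)^2 := by gcongr
  have h3 : (max (d + D) 0)^2/(2*ε) ≤ (max d 0 + D)^2/(2*ε) := by gcongr
  have h4 : (max d 0 + D)^2/(2*ε) = (max d 0)^2/(2*ε) + max d 0/ε * D + D^2/(2*ε) := by
    field_simp; ring
  linarith

/-- slope bound on the leading side. -/
lemma hj_right {d D ε l : ℝ} (hε : 0 < ε) (hD : 0 < D) (hl : 0 < l)
    (h : l ≤ (max (d + D) 0)^2/(2*ε) - (max d 0)^2/(2*ε)) :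
    l / D ≤ max d 0/ε + Real.sqrt (l/ε) := by
  have hp : 0 ≤ max d 0 / ε := by positivity
  set s := Real.sqrt (l/ε) with hs
  have hs0 : 0 < s := Real.sqrt_pos.2 (by positivity)
  have hss : s^2 = l/ε := Real.sq_sqrt (by positivity)
  have hl' : l = s^2 * ε := by rw [hss]; field_simp
  have h1 := h.trans (hj_psi_upper hε hD.le)
  rw [div_le_iff₀ hD]
  rcases le_total (s*ε) D with hDs | hDs
  · nlinarith [mul_nonneg hp hD.le]
  · have : D^2/(2*ε) ≤ s * D := by
      rw [div_le_iff₀ (by positivity)]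
      nlinarith [mul_pos hs0 hD]
    nlinarith

/-- slope bound on the trailing side. -/
lemma hj_left {d D ε l : ℝ} (hε : 0 < ε) (hD : 0 < D) (hl : 0 < l)
    (h : (max d 0)^2/(2*ε) - (max (d - D) 0)^2/(2*ε) ≤ l) :
    max d 0/ε ≤ l / D + Real.sqrt (2*l/ε) := by
  have hlD : 0 < l / D := by positivity
  set s := Real.sqrt (2*l/ε) with hs
  have hs0 : 0 < s := Real.sqrt_pos.2 (by positivity)
  have hss : s^2 = 2*l/ε := Real.sq_sqrt (by positivity)
  have hl' : 2*l = s^2 * ε := by rw [hss]; field_simp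
  rcases le_total d 0 with hd | hd
  · rw [max_eq_right hd]; simp; positivity
  rw [max_eq_left hd] at h ⊢
  rw [← sub_div, div_le_iff₀ (by positivity)] at h
  rcases le_total d D with hdD | hdD
  · rw [max_eq_right (by linarith)] at h
    have : d ≤ s * ε := by
      apply le_of_sq_le_sq _ (by positivity)
      nlinarith
    have : d / ε ≤ s := by rw [div_le_iff₀ hε]; exact this
    linarith
  · rw [max_eq_left (by linarith)] at h
    have hDs : D ≤ s * ε := by
      apply le_of_sq_le_sq _ (by positivity)
      nlinarith
    rw [div_le_iff₀ hε]
    have h2 : d ≤ l * ε / D + D / 2 := by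
      have : d - D/2 ≤ l * ε / D := by
        rw [le_div_iff₀ hD]; nlinarith
      linarith
    have : (l / D + s) * ε = l * ε / D + s * ε := by ring
    nlinarith [mul_pos hs0 hε]

theorem hj_compare {v : ℝ → ℝ} {Lv R T L ε C A B ω l C' A' B' ω' l' κ : ℝ} {N N' : ℕ}
    {x a y b : ℕ → ℝ → ℝ}
    (hva : Antitone v) (hvl : ∀ p q, |v p - v q| ≤ Lv * |p - q|) (hLv : 0 ≤ Lv) (hR : 0 < R)
    (hε : 0 < ε)
    (hx : Traj v R T C A B ω l N x a) (hy : Traj v R T C' A' B' ω' l' N' y b)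
    (hlN : l * N = L) (hlN' : l' * N' = L)
    (hinit : ∀ i ≤ N, ∀ j ≤ N', l * i - l' * j ≤ R * max (x i 0 - y j 0) 0)
    (hκ : (R + Real.sqrt (2*l'/ε)) * (Lv * (Real.sqrt (l/ε) + Real.sqrt (2*l'/ε)) + ω + ω') < κ) :
    ∀ t ∈ Set.Icc 0 T, ∀ i ≤ N, ∀ j ≤ N',
      l * i - l' * j - (max (x i t - y j t) 0)^2/(2*ε) ≤ R^2*ε/2 + κ * t := by
  have hl := hx.hl
  have hl' := hy.hl
  set e1 := Real.sqrt (l/ε)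
  set e2 := Real.sqrt (2*l'/ε)
  have he1 : 0 ≤ e1 := Real.sqrt_nonneg _
  have he2 : 0 ≤ e2 := Real.sqrt_nonneg _
  rcases lt_or_ge T 0 with hT0 | hT0
  · intro t ht; exact absurd (ht.1.trans ht.2) (not_le.2 hT0)
  have hψ : ∀ d : ℝ, HasDerivAt (fun d : ℝ => (max d 0)^2/(2*ε)) (max d 0/ε) d := by
    intro d
    have : HasDerivAt (fun d : ℝ => (max d 0)^2) (2 * max d 0) d := by
      rcases lt_trichotomy d 0 with hd | hd | hd
      · rw [max_eq_right hd.le, mul_zero]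
        refine (hasDerivAt_const d (0:ℝ)).congr_of_eventuallyEq ?_
        filter_upwards [gt_mem_nhds hd] with z hz
        rw [max_eq_right hz.le]; simp
      · subst hd
        simp only [max_self, mul_zero]
        rw [hasDerivAt_iff_isLittleO]
        simp only [max_self, sub_zero, smul_zero]
        have h1 : (fun z : ℝ => (max z 0)^2 - 0^2) =O[nhds 0] (fun z : ℝ => z^2) := by
          refine Asymptotics.IsBigO.of_bound 1 (Eventually.of_forall fun z => ?_)
          simp only [Real.norm_eq_abs, one_mul]
          rcases le_total z 0 with hz | hz
          · rw [max_eq_right hz]; simp [sq_nonneg]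
          · rw [max_eq_left hz]; simp
        refine h1.trans_isLittleO ?_
        simpa using (Asymptotics.isLittleO_pow_id (𝕜 := ℝ) (n := 2) (by norm_num))
      · rw [max_eq_left hd.le]
        have := (hasDerivAt_pow 2 d)
        simp only [Nat.cast_ofNat, Nat.add_one_sub_one, pow_one] at this
        refine this.congr_of_eventuallyEq ?_
        filter_upwards [lt_mem_nhds hd] with z hz
        rw [max_eq_left hz.le]
    have h2 : max d 0 / ε = 2 * max d 0 / (2*ε) := by
      rw [mul_div_mul_left _ _ (two_ne_zero)]
    rw [h2]
    exact this.div_const (2*ε)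
  have main := max_principle (ι := Fin (N+1) × Fin (N'+1))
    (fun α t => l * (α.1:ℕ) - l' * (α.2:ℕ) - (max (x α.1 t - y α.2 t) 0)^2/(2*ε))
    (fun α t => - (max (x α.1 t - y α.2 t) 0 / ε * (a α.1 t - b α.2 t)))
    (R^2*ε/2) κ T ?_ ?_ ?_ ?_
  · intro t ht i hi j hj
    exact main t ht (⟨i, by omega⟩, ⟨j, by omega⟩)
  · intro α
    have h1 := hx.cont α.1
    have h2 := hy.cont α.2
    apply Continuous.continuousOn
    fun_prop
  · rintro ⟨i, j⟩ t ht
    have h1 := hx.der i (by omega) t ht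
    have h2 := hy.der j (by omega) t ht
    have h3 := (hψ (x i t - y j t)).comp_hasDerivWithinAt t (h1.sub h2)
    simpa using h3.const_sub (l * (i:ℕ) - l' * (j:ℕ) : ℝ)
  · rintro ⟨i, j⟩
    have h1 := hinit i (by omega) j (by omega)
    simp only
    set D := max (x i 0 - y j 0) 0
    have : R * D - D^2/(2*ε) ≤ R^2*ε/2 := by
      have : R^2*ε/2 - (R * D - D^2/(2*ε)) = (R*ε - D)^2/(2*ε) := by field_simp; ring
      have h2 : 0 ≤ (R*ε - D)^2/(2*ε) := by positivity
      linarith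
    linarith
  · rintro t ht hall ⟨i, j⟩ heq
    have htI : t ∈ Set.Icc 0 T := ⟨ht.1, ht.2.le⟩
    simp only at heq ⊢
    have hω := hx.err_le ht (i := i) (by omega)
    have hω' := hy.err_le ht (i := j) (by omega)
    have hκ0 : 0 ≤ κ := by
      refine le_trans ?_ hκ.le
      have := (abs_nonneg _).trans hω
      have := (abs_nonneg _).trans hω'
      positivity
    have hpos : 0 < R^2*ε/2 + κ*t := by
      have := mul_nonneg hκ0 ht.1
      positivity
    set d := x i t - y j t with hd
    have hj : (j:ℕ) < N' := by
      by_contra hcon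
      have hjN : (j:ℕ) = N' := by omega
      have hi : ((i:ℕ):ℝ) ≤ N := by exact_mod_cast (by omega : (i:ℕ) ≤ N)
      have : l * ((i:ℕ):ℝ) ≤ L := by rw [← hlN]; gcongr
      rw [hjN, hlN'] at heq
      have : 0 ≤ (max d 0)^2/(2*ε) := by positivity
      linarith
    set p := max d 0 / ε with hp
    have hp0 : 0 ≤ p := by positivity
    -- the trailing side
    have hS : p ≤ rr N' l' (fun k => y k t) j + e2 := by
      have h1 := hall (i, ⟨j+1, by omega⟩)
      simp only [Nat.cast_add, Nat.cast_one] at h1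
      rw [← heq] at h1
      have hD := hy.mono t htI j hj
      have h2 := hj_left (d := d) (D := y (j+1) t - y j t) (l := l') hε (by linarith) hl' (by
        have : d - (y (j+1) t - y j t) = x i t - y (j+1) t := by rw [hd]; ring
        rw [this]; linarith)
      simpa [rr, hj] using h2
    have hSR := hy.bd t htI j hj
    have hRp : rr N l (fun k => x k t) i ≤ p + e1 := by
      by_cases hi : (i:ℕ) < N
      · have h1 := hall (⟨i+1, by omega⟩, j)
        simp only [Nat.cast_add, Nat.cast_one] at h1
        rw [← heq] at h1
        have hD := hx.mono t htI i hi
        have h2 := hj_right (d := d) (D := x (i+1) t - x i t) (l := l) hε (by linarith) hl (by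
          have : d + (x (i+1) t - x i t) = x (i+1) t - y j t := by rw [hd]; ring
          rw [this]; linarith)
        simpa [rr, hi] using h2
      · simp only [rr, hi, if_false]; positivity
    have hv1 : v p - Lv * e1 ≤ v (rr N l (fun k => x k t) i) := by
      have h1 := hva hRp
      have h2 := (abs_le.1 (hvl p (p+e1))).2
      have h3 : |p - (p+e1)| = e1 := by rw [show p - (p+e1) = -e1 by ring, abs_neg, abs_of_nonneg he1]
      rw [h3] at h2
      linarith
    have hv2 : v (rr N' l' (fun k => y k t) j) ≤ v p + Lv * e2 := by
      have h1 := hva (show p - e2 ≤ rr N' l' (fun k => y k t) j by linarith)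
      have h2 := (abs_le.1 (hvl (p - e2) p)).2
      have h3 : |p - e2 - p| = e2 := by rw [show p - e2 - p = -e2 by ring, abs_neg, abs_of_nonneg he2]
      rw [h3] at h2
      linarith
    have hω1 := (abs_le.1 hω).1
    have hω2 := (abs_le.1 hω').2
    have hab : -(a i t - b j t) ≤ Lv * (e1 + e2) + ω + ω' := by linarith
    have hE : 0 ≤ Lv * (e1 + e2) + ω + ω' := by
      have := (abs_nonneg _).trans hω
      have := (abs_nonneg _).trans hω'
      positivity
    calc -(p * (a i t - b j t)) = p * (-(a i t - b j t)) := by ring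
      _ ≤ p * (Lv * (e1 + e2) + ω + ω') := by gcongr
      _ ≤ (R + e2) * (Lv * (e1 + e2) + ω + ω') := by gcongr; linarith
      _ < κ := hκ

/-! ### Configurations and their densities -/

/-- A particle configuration at a fixed time. -/
structure Cfg (R C A B l : ℝ) (N : ℕ) (X : ℕ → ℝ) : Prop where
  hl : 0 < l
  hN : 0 < N
  mono : ∀ i < N, X i < X (i + 1)
  bd : ∀ i < N, rr N l X i ≤ R
  tv : ∑ i ∈ Finset.range N, |rr N l X (i + 1) - rr N l X i| ≤ C
  box : ∀ i ≤ N, X i ∈ Set.Ioo A B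

lemma Traj.cfg {v : ℝ → ℝ} {R T C A B ω l : ℝ} {N : ℕ} {x a : ℕ → ℝ → ℝ}
    (h : Traj v R T C A B ω l N x a) {t : ℝ} (ht : t ∈ Set.Icc 0 T) :
    Cfg R C A B l N (fun j => x j t) :=
  ⟨h.hl, h.hN, h.mono t ht, h.bd t ht, h.tv t ht, h.box t ht⟩

/-- piecewise constant density of a configuration. -/
noncomputable def dens (N : ℕ) (l : ℝ) (X : ℕ → ℝ) (y : ℝ) : ℝ :=
  ∑ i ∈ Finset.range N,
    rr N l X i * Set.indicator (Set.Ico (X i) (X (i + 1))) (fun _ => (1 : ℝ)) y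

/-- Heaviside function. -/
noncomputable def hv (c y : ℝ) : ℝ := if c ≤ y then 1 else 0

lemma hv_mono (c : ℝ) : Monotone (hv c) := by
  intro x y hxy
  unfold hv
  split_ifs with h1 h2
  · exact le_rfl
  · exact absurd (h1.trans hxy) h2
  · norm_num
  · exact le_rfl

lemma hv_nonneg (c y : ℝ) : 0 ≤ hv c y := by unfold hv; split_ifs <;> norm_num
lemma hv_le (c y : ℝ) : hv c y ≤ 1 := by unfold hv; split_ifs <;> norm_num

lemma ind_eq_hv {c d : ℝ} (h : c ≤ d) (y : ℝ) :
    Set.indicator (Set.Ico c d) (fun _ => (1 : ℝ)) y = hv c y - hv d y := by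
  unfold hv
  by_cases h1 : c ≤ y
  · by_cases h2 : d ≤ y
    · simp [Set.indicator, h1, h2]
    · simp [Set.indicator, h1, h2, not_le.1 h2]
  · have : ¬ d ≤ y := fun h2 => h1 (h.trans h2)
    simp [Set.indicator, h1, this]

section
variable {R C A B l : ℝ} {N : ℕ} {X : ℕ → ℝ}

lemma dens_measurable (N : ℕ) (l : ℝ) (X : ℕ → ℝ) : Measurable (dens N l X) := by
  unfold dens
  refine Finset.measurable_sum _ fun i _ => ?_
  exact (measurable_const.indicator measurableSet_Ico).const_mul _

lemma dens_integrable (N : ℕ) (l : ℝ) (X : ℕ → ℝ) : Integrable (dens N l X) := by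
  unfold dens
  refine integrable_finsetSum _ fun i _ => ?_
  refine Integrable.const_mul ?_ _
  exact (integrable_indicator_iff measurableSet_Ico).2 (integrableOn_const (by simp))

lemma Cfg.le (h : Cfg R C A B l N X) {i j : ℕ} (hij : i ≤ j) (hj : j ≤ N) : X i ≤ X j := by
  induction j, hij using Nat.le_induction with
  | base => exact le_rfl
  | succ k hk ih => exact (ih (by omega)).trans (h.mono k (by omega)).le

lemma Cfg.rr_pos (h : Cfg R C A B l N X) {i : ℕ} (hi : i < N) : 0 < rr N l X i := by
  simp only [rr, hi, if_true]
  exact div_pos h.hl (sub_pos.2 (h.mono i hi))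

lemma Cfg.rr_nonneg (h : Cfg R C A B l N X) (i : ℕ) : 0 ≤ rr N l X i := by
  by_cases hi : i < N
  · exact (h.rr_pos hi).le
  · simp [rr, hi]

lemma rr_last : rr N l X N = 0 := by simp [rr]

lemma Cfg.dens_eq (h : Cfg R C A B l N X) {i : ℕ} (hi : i < N) {y : ℝ}
    (hy : y ∈ Set.Ico (X i) (X (i + 1))) : dens N l X y = rr N l X i := by
  unfold dens
  rw [Finset.sum_eq_single i]
  · simp [hy]
  · intro j hj hji
    have hjN := Finset.mem_range.1 hj
    rw [Set.indicator_of_notMem, mul_zero]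
    rintro ⟨h1, h2⟩
    rcases lt_or_gt_of_ne hji with hlt | hgt
    · have := h.le (show j + 1 ≤ i by omega) (by omega)
      linarith [hy.1]
    · have := h.le (show i + 1 ≤ j by omega) (by omega)
      linarith [hy.2]
  · intro hn; exact absurd (Finset.mem_range.2 hi) hn

lemma Cfg.cell (h : Cfg R C A B l N X) {y : ℝ} (h0 : X 0 ≤ y) (h1 : y < X N) :
    ∃ i < N, y ∈ Set.Ico (X i) (X (i + 1)) := by
  have hex : ∃ i, y < X i := ⟨N, h1⟩
  classical
  have hk := Nat.find_spec hex
  have hkN : Nat.find hex ≤ N := Nat.find_min' hex h1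
  have hk0 : Nat.find hex ≠ 0 := by
    intro h'; rw [h'] at hk; linarith
  obtain ⟨k, hk'⟩ := Nat.exists_eq_succ_of_ne_zero hk0
  refine ⟨k, by omega, ?_, ?_⟩
  · exact not_lt.1 (Nat.find_min hex (by omega : k < Nat.find hex))
  · rw [hk'] at hk; exact hk

lemma Cfg.dens_zero (h : Cfg R C A B l N X) {y : ℝ} (hy : y < X 0 ∨ X N ≤ y) :
    dens N l X y = 0 := by
  unfold dens
  refine Finset.sum_eq_zero fun i hi => ?_
  have hiN := Finset.mem_range.1 hi
  rw [Set.indicator_of_notMem, mul_zero]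
  rintro ⟨h1, h2⟩
  rcases hy with hy | hy
  · have := h.le (Nat.zero_le i) hiN.le; linarith
  · have := h.le (show i + 1 ≤ N by omega) le_rfl; linarith

lemma Cfg.dens_mem (h : Cfg R C A B l N X) (hR : 0 ≤ R) (y : ℝ) :
    dens N l X y ∈ Set.Icc 0 R := by
  by_cases h0 : X 0 ≤ y
  · by_cases h1 : y < X N
    · obtain ⟨i, hi, hy⟩ := h.cell h0 h1
      rw [h.dens_eq hi hy]
      exact ⟨h.rr_nonneg i, h.bd i hi⟩
    · rw [h.dens_zero (Or.inr (not_lt.1 h1))]; exact ⟨le_rfl, hR⟩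
  · rw [h.dens_zero (Or.inl (not_le.1 h0))]; exact ⟨le_rfl, hR⟩

lemma Cfg.dens_out (h : Cfg R C A B l N X) {y : ℝ} (hy : y ∉ Set.Ioo A B) :
    dens N l X y = 0 := by
  apply h.dens_zero
  by_contra hcon
  push Not at hcon
  exact hy ⟨(h.box 0 (Nat.zero_le _)).1.trans_le hcon.1, hcon.2.trans (h.box N le_rfl).2⟩

lemma Cfg.rr_mul (h : Cfg R C A B l N X) {i : ℕ} (hi : i < N) :
    rr N l X i * (X (i + 1) - X i) = l := by
  have := sub_pos.2 (h.mono i hi)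
  simp only [rr, hi, if_true]
  field_simp

/-- integrals of composed densities over a cell. -/
lemma Cfg.integral_cell (h : Cfg R C A B l N X) {i : ℕ} (hi : i < N) (G : ℝ → ℝ → ℝ) :
    ∫ y in X i..X (i + 1), G (dens N l X y) y = ∫ y in X i..X (i + 1), G (rr N l X i) y := by
  rw [intervalIntegral.integral_of_le (h.mono i hi).le, intervalIntegral.integral_of_le (h.mono i hi).le,
    ← integral_Ico_eq_integral_Ioc, ← integral_Ico_eq_integral_Ioc]
  refine setIntegral_congr_fun measurableSet_Ico fun y hy => ?_
  simp only [h.dens_eq hi hy]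

lemma Cfg.mass (h : Cfg R C A B l N X) {i : ℕ} (hi : i ≤ N) :
    ∫ y in A..X i, dens N l X y = l * i := by
  have hintg : ∀ a b, IntervalIntegrable (dens N l X) volume a b :=
    fun a b => (dens_integrable N l X).intervalIntegrable
  induction i with
  | zero =>
    simp only [Nat.cast_zero, mul_zero]
    have hA := (h.box 0 hi).1.le
    rw [intervalIntegral.integral_of_le hA, ← integral_Ico_eq_integral_Ioc]
    rw [setIntegral_eq_zero_of_forall_eq_zero]
    intro y hy
    exact h.dens_zero (Or.inl hy.2)
  | succ k ih =>
    rw [← intervalIntegral.integral_add_adjacent_intervals (hintg A (X k)) (hintg _ _), ih (by omega)]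
    rw [h.integral_cell (by omega) (fun r _ => r), intervalIntegral.integral_const, smul_eq_mul,
      mul_comm (X (k+1) - X k), h.rr_mul (by omega)]
    push_cast; ring

/-- the variation function of a configuration. -/
noncomputable def wvar (N : ℕ) (l : ℝ) (X : ℕ → ℝ) (y : ℝ) : ℝ :=
  |rr N l X 0| * hv (X 0) y +
    ∑ i ∈ Finset.range N, |rr N l X (i + 1) - rr N l X i| * hv (X (i + 1)) y

lemma abel_aux (r h : ℕ → ℝ) (n : ℕ) :
    ∑ i ∈ Finset.range n, r i * (h i - h (i + 1)) =
      r 0 * h 0 - r n * h n + ∑ i ∈ Finset.range n, (r (i + 1) - r i) * h (i + 1) := by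
  induction n with
  | zero => simp
  | succ n ih => rw [Finset.sum_range_succ, Finset.sum_range_succ, ih]; ring

lemma Cfg.dens_abel (h : Cfg R C A B l N X) (y : ℝ) :
    dens N l X y = rr N l X 0 * hv (X 0) y +
    ∑ i ∈ Finset.range N, (rr N l X (i + 1) - rr N l X i) * hv (X (i + 1)) y := by
  have h1 : dens N l X y = ∑ i ∈ Finset.range N, rr N l X i * (hv (X i) y - hv (X (i+1)) y) := by
    unfold dens
    refine Finset.sum_congr rfl fun i hi => ?_
    rw [ind_eq_hv (h.mono i (Finset.mem_range.1 hi)).le]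
  rw [h1, abel_aux (fun i => rr N l X i) (fun i => hv (X i) y), rr_last]
  ring

lemma Cfg.dens_var (h : Cfg R C A B l N X) {x y : ℝ} (hxy : x ≤ y) :
    |dens N l X x - dens N l X y| ≤ wvar N l X y - wvar N l X x := by
  rw [h.dens_abel, h.dens_abel]
  have e1 : (rr N l X 0 * hv (X 0) x +
      ∑ i ∈ Finset.range N, (rr N l X (i + 1) - rr N l X i) * hv (X (i + 1)) x) -
      (rr N l X 0 * hv (X 0) y +
      ∑ i ∈ Finset.range N, (rr N l X (i + 1) - rr N l X i) * hv (X (i + 1)) y)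
      = rr N l X 0 * (hv (X 0) x - hv (X 0) y) + ∑ i ∈ Finset.range N,
        (rr N l X (i + 1) - rr N l X i) * (hv (X (i + 1)) x - hv (X (i+1)) y) := by
    simp only [mul_sub, Finset.sum_sub_distrib]; ring
  have e2 : wvar N l X y - wvar N l X x = |rr N l X 0| * (hv (X 0) y - hv (X 0) x) +
      ∑ i ∈ Finset.range N,
        |rr N l X (i + 1) - rr N l X i| * (hv (X (i + 1)) y - hv (X (i+1)) x) := by
    unfold wvar
    simp only [mul_sub, Finset.sum_sub_distrib]; ring
  have e3 : ∀ c, |hv c x - hv c y| = hv c y - hv c x := fun c => by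
    rw [abs_sub_comm, abs_of_nonneg (sub_nonneg.2 (hv_mono c hxy))]
  rw [e1, e2]
  refine (abs_add_le _ _).trans (add_le_add ?_ ((Finset.abs_sum_le_sum_abs _ _).trans ?_))
  · rw [abs_mul, e3]
  · refine Finset.sum_le_sum fun i _ => ?_
    rw [abs_mul, e3]

lemma Cfg.rr_zero_le (h : Cfg R C A B l N X) : |rr N l X 0| ≤ C := by
  have h1 := Finset.sum_range_sub (fun i => rr N l X i) N
  rw [rr_last, zero_sub] at h1
  rw [← abs_neg, ← h1]
  exact (Finset.abs_sum_le_sum_abs _ _).trans h.tv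

lemma Cfg.wvar_mem (h : Cfg R C A B l N X) (y : ℝ) : wvar N l X y ∈ Set.Icc 0 (2 * C) := by
  unfold wvar
  have hs : ∑ i ∈ Finset.range N, |rr N l X (i + 1) - rr N l X i| * hv (X (i + 1)) y ≤
      ∑ i ∈ Finset.range N, |rr N l X (i + 1) - rr N l X i| :=
    Finset.sum_le_sum fun i _ => mul_le_of_le_one_right (abs_nonneg _) (hv_le _ _)
  have h0 : |rr N l X 0| * hv (X 0) y ≤ |rr N l X 0| :=
    mul_le_of_le_one_right (abs_nonneg _) (hv_le _ _)
  constructor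
  · exact add_nonneg (mul_nonneg (abs_nonneg _) (hv_nonneg _ _))
      (Finset.sum_nonneg fun i _ => mul_nonneg (abs_nonneg _) (hv_nonneg _ _))
  · linarith [h.tv, h.rr_zero_le]

end

/-! ### Interpolation between mass distance and variation -/

lemma interp_lemma {g W : ℝ → ℝ} {K A B η : ℝ} {P : ℕ} (hP : 0 < P) (hAB : A < B)
    (hg : Integrable g) (hW : ∀ x y, x ≤ y → |g x - g y| ≤ W y - W x)
    (hK : ∀ x, W x ∈ Set.Icc 0 K)
    (hη : ∀ a b, A ≤ a → a ≤ b → b ≤ B → |∫ y in a..b, g y| ≤ η) :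
    ∫ y in A..B, |g y| ≤ P * η + (B - A) / P * K := by
  have hP' : (0:ℝ) < P := by exact_mod_cast hP
  set δ := (B - A) / P with hδ
  have hδ0 : 0 < δ := div_pos (by linarith) hP'
  set c : ℕ → ℝ := fun k => A + k * δ with hc
  have hc0 : c 0 = A := by simp [hc]
  have hcP : c P = B := by simp only [hc, hδ]; field_simp; ring
  have hcs : ∀ k, c (k+1) = c k + δ := by intro k; simp only [hc]; push_cast; ring
  have hintg : ∀ a b, IntervalIntegrable (fun y => |g y|) volume a b :=
    fun a b => hg.abs.intervalIntegrable
  have hcell : ∀ k < P, ∫ y in c k..c (k+1), |g y| ≤ η + δ * (W (c (k+1)) - W (c k)) := by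
    intro k hk
    have hck : c k ≤ c (k+1) := by rw [hcs]; linarith
    have hA : A ≤ c k := by simp only [hc]; nlinarith [(Nat.cast_nonneg k : (0:ℝ) ≤ k)]
    have hB : c (k+1) ≤ B := by
      rw [← hcP]; simp only [hc]
      have : ((k+1 : ℕ):ℝ) ≤ P := by exact_mod_cast hk
      nlinarith
    have hm := hη _ _ hA hck hB
    have hosc : ∀ x ∈ Set.Icc (c k) (c (k+1)), ∀ y ∈ Set.Icc (c k) (c (k+1)),
        |g x - g y| ≤ W (c (k+1)) - W (c k) := by
      have hWm : ∀ x y, x ≤ y → W x ≤ W y := fun x y hxy => by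
        have := (abs_nonneg _).trans (hW x y hxy); linarith
      intro x hx y hy
      rcases le_total x y with hxy | hxy
      · refine (hW x y hxy).trans ?_
        linarith [hWm _ _ hx.1, hWm _ _ hy.2]
      · rw [abs_sub_comm]
        refine (hW y x hxy).trans ?_
        linarith [hWm _ _ hy.1, hWm _ _ hx.2]
    have hpt : ∀ x ∈ Set.Icc (c k) (c (k+1)), |g x| ≤ η / δ + (W (c (k+1)) - W (c k)) := by
      intro x hx
      have h1 : ∫ y in c k..c (k+1), (g x - g y) = δ * g x - ∫ y in c k..c (k+1), g y := by
        rw [intervalIntegral.integral_sub (by simp) hg.intervalIntegrable,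
          intervalIntegral.integral_const, smul_eq_mul, hcs]; ring
      have h2 : |∫ y in c k..c (k+1), (g x - g y)| ≤ (W (c (k+1)) - W (c k)) * |c (k+1) - c k| := by
        have := intervalIntegral.norm_integral_le_of_norm_le_const (a := c k) (b := c (k+1))
          (f := fun y => g x - g y) (C := W (c (k+1)) - W (c k)) (by
            intro y hy
            rw [Set.uIoc_of_le hck] at hy
            exact hosc x hx y ⟨hy.1.le, hy.2⟩)
        simpa using this
      rw [h1, hcs, show c k + δ - c k = δ by ring, abs_of_pos hδ0, ← hcs] at h2
      have h3 : |δ * g x| ≤ η + (W (c (k+1)) - W (c k)) * δ := by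
        have := abs_sub_abs_le_abs_sub (δ * g x) (∫ y in c k..c (k+1), g y)
        linarith
      rw [abs_mul, abs_of_pos hδ0] at h3
      have : η / δ + (W (c (k+1)) - W (c k)) = (η + (W (c (k+1)) - W (c k)) * δ)/δ := by field_simp
      rw [this, le_div_iff₀ hδ0]; linarith
    have := intervalIntegral.integral_mono_on hck (hintg _ _) (by simp) hpt
    refine this.trans (le_of_eq ?_)
    rw [intervalIntegral.integral_const, smul_eq_mul, hcs]
    field_simp; ring
  have hsum : ∑ k ∈ Finset.range P, ∫ y in c k..c (k+1), |g y| = ∫ y in c 0..c P, |g y| :=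
    intervalIntegral.sum_integral_adjacent_intervals (fun k _ => hintg _ _)
  rw [hc0, hcP] at hsum
  rw [← hsum]
  calc ∑ k ∈ Finset.range P, ∫ y in c k..c (k+1), |g y|
      ≤ ∑ k ∈ Finset.range P, (η + δ * (W (c (k+1)) - W (c k))) :=
        Finset.sum_le_sum fun k hk => hcell k (Finset.mem_range.1 hk)
    _ = P * η + δ * (W (c P) - W (c 0)) := by
        rw [Finset.sum_add_distrib, ← Finset.mul_sum, Finset.sum_range_sub (fun k => W (c k))]; simp
    _ ≤ P * η + δ * K := by
        have h1 := (hK (c P)).2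
        have h2 := (hK (c 0)).1
        gcongr; linarith

lemma l1_close {g₁ g₂ W₁ W₂ : ℝ → ℝ} {K₁ K₂ A B η : ℝ} {P : ℕ} (hP : 0 < P) (hAB : A < B)
    (hg₁ : Integrable g₁) (hg₂ : Integrable g₂)
    (hW₁ : ∀ x y, x ≤ y → |g₁ x - g₁ y| ≤ W₁ y - W₁ x)
    (hW₂ : ∀ x y, x ≤ y → |g₂ x - g₂ y| ≤ W₂ y - W₂ x)
    (hK₁ : ∀ x, W₁ x ∈ Set.Icc 0 K₁) (hK₂ : ∀ x, W₂ x ∈ Set.Icc 0 K₂)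
    (hs₁ : ∀ y, y ∉ Set.Ioo A B → g₁ y = 0) (hs₂ : ∀ y, y ∉ Set.Ioo A B → g₂ y = 0)
    (hη : ∀ b ∈ Set.Icc A B, |(∫ y in A..b, g₁ y) - ∫ y in A..b, g₂ y| ≤ η) :
    ∫ y, |g₁ y - g₂ y| ≤ P * (2 * η) + (B - A) / P * (K₁ + K₂) := by
  have h1 : ∫ y, |g₁ y - g₂ y| = ∫ y in A..B, |g₁ y - g₂ y| := by
    symm
    apply intervalIntegral.integral_eq_integral_of_support_subset
    intro y hy
    by_contra hcon
    have : y ∉ Set.Ioo A B := fun h => hcon ⟨h.1, h.2.le⟩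
    rw [Function.mem_support] at hy
    apply hy
    simp [hs₁ y this, hs₂ y this]
  rw [h1]
  refine interp_lemma (g := fun y => g₁ y - g₂ y) (W := fun y => W₁ y + W₂ y) hP hAB (hg₁.sub hg₂)
    ?_ ?_ ?_
  · intro x y hxy
    have e : g₁ x - g₂ x - (g₁ y - g₂ y) = (g₁ x - g₁ y) - (g₂ x - g₂ y) := by ring
    rw [e]
    refine (abs_sub _ _).trans ?_
    linarith [hW₁ x y hxy, hW₂ x y hxy]
  · intro x
    exact ⟨add_nonneg (hK₁ x).1 (hK₂ x).1, add_le_add (hK₁ x).2 (hK₂ x).2⟩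
  · intro a b ha hab hb
    have i₁ : ∀ a b, IntervalIntegrable g₁ volume a b := fun _ _ => hg₁.intervalIntegrable
    have i₂ : ∀ a b, IntervalIntegrable g₂ volume a b := fun _ _ => hg₂.intervalIntegrable
    have e : ∫ y in a..b, (g₁ y - g₂ y) = ((∫ y in A..b, g₁ y) - ∫ y in A..b, g₂ y) -
        ((∫ y in A..a, g₁ y) - ∫ y in A..a, g₂ y) := by
      rw [intervalIntegral.integral_sub (i₁ _ _) (i₂ _ _),
        ← intervalIntegral.integral_interval_sub_left (i₁ A b) (i₁ A a),
        ← intervalIntegral.integral_interval_sub_left (i₂ A b) (i₂ A a)]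
      ring
    rw [e]
    refine (abs_sub _ _).trans ?_
    have := hη a ⟨ha, hab.trans hb⟩
    have := hη b ⟨ha.trans hab, hb⟩
    linarith

/-! ### Mass functions -/

/-- `F` is a cumulative mass function compatible with the configuration `X`. -/
structure MassFn (A B L l : ℝ) (N : ℕ) (X : ℕ → ℝ) (F : ℝ → ℝ) : Prop where
  mono : MonotoneOn F (Set.Icc A B)
  low : 0 ≤ F A
  high : F B ≤ L
  val : ∀ i ≤ N, F (X i) = l * i

lemma mass_cmp {A B L l l' R C R' C' η : ℝ} {N N' : ℕ} {X Y : ℕ → ℝ} {F G : ℝ → ℝ}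
    (hX : Cfg R C A B l N X) (hY : Cfg R' C' A B l' N' Y)
    (hF : MassFn A B L l N X F) (hG : MassFn A B L l' N' Y G) (hη0 : 0 ≤ η)
    (hlN : l * N = L) (hlN' : l' * N' = L)
    (hη : ∀ i ≤ N, ∀ j ≤ N', X i ≤ Y j → l * i ≤ l' * j + η) :
    ∀ b ∈ Set.Icc A B, F b ≤ G b + (η + l + l') := by
  intro b hb
  have hl := hX.hl
  have hl' := hY.hl
  have hAB : A ≤ B := hb.1.trans hb.2
  have hXI : ∀ i ≤ N, X i ∈ Set.Icc A B := fun i hi => Set.Ioo_subset_Icc_self (hX.box i hi)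
  have hYI : ∀ i ≤ N', Y i ∈ Set.Icc A B := fun i hi => Set.Ioo_subset_Icc_self (hY.box i hi)
  have hFL : F b ≤ L := (hF.mono hb ⟨hAB, le_rfl⟩ hb.2).trans hF.high
  have hG0 : 0 ≤ G b := hG.low.trans (hG.mono ⟨le_rfl, hAB⟩ hb hb.1)
  rcases lt_or_ge b (X 0) with h0 | h0
  · have h1 := hF.mono hb (hXI 0 (by omega)) h0.le
    rw [hF.val 0 (by omega)] at h1
    simp at h1; linarith
  have hA : ∃ i ≤ N, X i ≤ b ∧ F b ≤ l * i + l := by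
    rcases lt_or_ge b (X N) with h1 | h1
    · obtain ⟨i, hi, hbi⟩ := hX.cell h0 h1
      refine ⟨i, hi.le, hbi.1, ?_⟩
      have := hF.mono hb (hXI (i+1) hi) hbi.2.le
      rw [hF.val (i+1) hi] at this
      push_cast at this; linarith
    · exact ⟨N, le_rfl, h1, by linarith⟩
  have hB : L ≤ G b ∨ ∃ j ≤ N', b ≤ Y j ∧ l' * j - l' ≤ G b := by
    rcases lt_or_ge b (Y N') with h1 | h1
    · right
      rcases lt_or_ge b (Y 0) with h2 | h2
      · exact ⟨0, by omega, h2.le, by simp; linarith⟩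
      · obtain ⟨j, hj, hbj⟩ := hY.cell h2 h1
        refine ⟨j+1, hj, hbj.2.le, ?_⟩
        have := hG.mono (hYI j hj.le) hb hbj.1
        rw [hG.val j hj.le] at this
        push_cast; linarith
    · left
      have := hG.mono (hYI N' le_rfl) hb h1
      rw [hG.val N' le_rfl, hlN'] at this
      exact this
  rcases hB with hB | ⟨j, hj, hbj, hjG⟩
  · linarith
  · obtain ⟨i, hi, hib, hiF⟩ := hA
    have := hη i hi j hj (hib.trans hbj)
    linarith

lemma Cfg.massFn {R C A B l L : ℝ} {N : ℕ} {X : ℕ → ℝ} (h : Cfg R C A B l N X) (hR : 0 ≤ R)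
    (hlN : l * N = L) : MassFn A B L l N X (fun b => ∫ y in A..b, dens N l X y) := by
  have hintg : ∀ a b, IntervalIntegrable (dens N l X) volume a b :=
    fun a b => (dens_integrable N l X).intervalIntegrable
  refine ⟨?_, by simp, ?_, fun i hi => h.mass hi⟩
  · intro a _ b _ hab
    have := intervalIntegral.integral_add_adjacent_intervals (hintg A a) (hintg a b)
    simp only
    rw [← this]
    have := intervalIntegral.integral_nonneg (μ := volume) hab
      (fun y _ => (h.dens_mem hR y).1)
    linarith
  · have := intervalIntegral.integral_add_adjacent_intervals (hintg A (X N)) (hintg (X N) B)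
    rw [← this, h.mass le_rfl, hlN]
    have hz : ∫ y in X N..B, dens N l X y = 0 := by
      rw [intervalIntegral.integral_of_le (h.box N le_rfl).2.le]
      rw [setIntegral_eq_zero_of_forall_eq_zero]
      intro y hy
      exact h.dens_zero (Or.inr hy.1.le)
    linarith

/-! ### Total variation estimate for the scheme -/

lemma tvd_aux (N : ℕ) (α β d d' : ℕ → ℝ) (hα : ∀ i ≤ N, 0 ≤ α i ∧ α i ≤ 1)
    (hβ : ∀ i ≤ N, 0 ≤ β i) (hαN : α N = 0) (hβN : β N = 0)
    (h : ∀ i < N, d' i - d i = (α (i+1) * d (i+1) + β (i+1) * d' (i+1)) -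
      (α i * d i + β i * d' i)) :
    ∑ i ∈ Finset.range N, |d' i| ≤ ∑ i ∈ Finset.range N, |d i| := by
  set s : ℕ → ℝ := fun i => α i * |d i| + β i * |d' i| with hs
  have key : ∀ i < N, |d' i| ≤ |d i| + (s (i+1) - s i) := by
    intro i hi
    have h1 := h i hi
    obtain ⟨ha0, ha1⟩ := hα i hi.le
    have hb0 := hβ i hi.le
    obtain ⟨ha0', _⟩ := hα (i+1) hi
    have hb0' := hβ (i+1) hi
    have e : (1 + β i) * d' i = (1 - α i) * d i + (α (i+1) * d (i+1) + β (i+1) * d' (i+1)) := by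
      linarith
    have h2 : |(1 + β i) * d' i| ≤ |(1 - α i) * d i| + (|α (i+1) * d (i+1)| + |β (i+1) * d' (i+1)|) := by
      rw [e]
      exact (abs_add_le _ _).trans (add_le_add le_rfl (abs_add_le _ _))
    rw [abs_mul, abs_mul, abs_mul, abs_mul, abs_of_nonneg ha0', abs_of_nonneg hb0',
      abs_of_nonneg (by linarith : 0 ≤ 1 + β i), abs_of_nonneg (by linarith : 0 ≤ 1 - α i)] at h2
    simp only [hs]
    linarith
  have h1 : ∑ i ∈ Finset.range N, |d' i| ≤ ∑ i ∈ Finset.range N, (|d i| + (s (i+1) - s i)) :=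
    Finset.sum_le_sum fun i hi => key i (Finset.mem_range.1 hi)
  rw [Finset.sum_add_distrib, Finset.sum_range_sub] at h1
  have hsN : s N = 0 := by simp [hs, hαN, hβN]
  have hs0 : 0 ≤ s 0 := add_nonneg (mul_nonneg (hα 0 (by omega)).1 (abs_nonneg _))
    (mul_nonneg (hβ 0 (by omega)) (abs_nonneg _))
  linarith

lemma slope_exists {v : ℝ → ℝ} {Lv : ℝ} (hva : Antitone v)
    (hvl : ∀ p q, |v p - v q| ≤ Lv * |p - q|) (hLv : 0 ≤ Lv) (p q : ℝ) :
    ∃ c, 0 ≤ c ∧ c ≤ Lv ∧ v p - v q = -(c * (p - q)) := by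
  rcases eq_or_ne p q with h | h
  · exact ⟨0, le_rfl, hLv, by simp [h]⟩
  have hne : p - q ≠ 0 := sub_ne_zero.2 h
  refine ⟨|v p - v q| / |p - q|, by positivity, ?_, ?_⟩
  · rw [div_le_iff₀ (abs_pos.2 hne)]; exact hvl p q
  · rcases lt_or_gt_of_ne h with h' | h'
    · have := hva h'.le
      rw [abs_of_nonneg (by linarith), abs_of_neg (by linarith)]
      field_simp
    · have := hva h'.le
      rw [abs_of_nonpos (by linarith), abs_of_pos (by linarith)]
      field_simp

section
variable {v : ℝ → ℝ} {Lv R τ θ l : ℝ} {N M : ℕ} {x : ℕ → ℕ → ℝ}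

lemma Rd_eq_rr (N : ℕ) (l : ℝ) (x : ℕ → ℕ → ℝ) (i m : ℕ) :
    Rd N l x i m = rr N l (fun j => x j m) i := rfl

lemma scheme_coef (hva : Antitone v) (hvl : ∀ p q, |v p - v q| ≤ Lv * |p - q|) (hLv : 0 ≤ Lv)
    (hR : 0 < R) (hτ : 0 < τ) (hl : 0 < l) (hθ : θ ∈ Set.Icc (0:ℝ) 1)
    (hs : IsScheme N M l τ θ v x)
    (hb : ∀ m ≤ M, ∀ i < N, 0 < Rd N l x i m ∧ Rd N l x i m ≤ R) {m : ℕ} (hm : m < M) :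
    ∀ i, ∃ α β : ℝ, 0 ≤ α ∧ α ≤ θ * (Lv * R^2 * τ / l) ∧ 0 ≤ β ∧ β ≤ (1-θ) * (Lv * R^2 * τ / l) ∧
      (N ≤ i → α = 0 ∧ β = 0) ∧
      Rd N l x i (m+1) - Rd N l x i m = α * (Rd N l x (i+1) m - Rd N l x i m) +
        β * (Rd N l x (i+1) (m+1) - Rd N l x i (m+1)) := by
  intro i
  have hθ1 : 0 ≤ 1 - θ := by linarith [hθ.2]
  have hθ0 := hθ.1
  by_cases hi : i < N
  swap
  · refine ⟨0, 0, le_rfl, by positivity, le_rfl, by positivity, fun _ => ⟨rfl, rfl⟩, ?_⟩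
    simp [Rd, hi]
  obtain ⟨hmono, hlast, hstep⟩ := hs
  obtain ⟨c, hc0, hc1, hc⟩ := slope_exists hva hvl hLv (Rd N l x (i+1) m) (Rd N l x i m)
  obtain ⟨c', hc0', hc1', hc'⟩ :=
    slope_exists hva hvl hLv (Rd N l x (i+1) (m+1)) (Rd N l x i (m+1))
  obtain ⟨hr0, hrR⟩ := hb m hm.le i hi
  obtain ⟨hr0', hrR'⟩ := hb (m+1) hm i hi
  set r := Rd N l x i m with hr
  set r' := Rd N l x i (m+1) with hr'
  have hD := sub_pos.2 (hmono m hm.le i hi)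
  have hD' := sub_pos.2 (hmono (m+1) hm i hi)
  have e1 : r * (x (i+1) m - x i m) = l := by
    rw [hr]; simp only [Rd, hi, if_true]; field_simp
  have e2 : r' * (x (i+1) (m+1) - x i (m+1)) = l := by
    rw [hr']; simp only [Rd, hi, if_true]; field_simp
  -- velocity of the next particle
  have hnext : x (i+1) (m+1) = x (i+1) m +
      τ * (θ * v (Rd N l x (i+1) m) + (1-θ) * v (Rd N l x (i+1) (m+1))) := by
    by_cases hi1 : i + 1 < N
    · exact hstep m hm (i+1) hi1
    · have : i + 1 = N := by omega
      rw [this, hlast m hm]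
      simp only [Rd, lt_irrefl, if_false]
      ring
  have hcur := hstep m hm i hi
  have hdiff : (x (i+1) (m+1) - x i (m+1)) - (x (i+1) m - x i m) =
      -(τ * (θ * (c * (Rd N l x (i+1) m - r)) +
        (1-θ) * (c' * (Rd N l x (i+1) (m+1) - r')))) := by
    rw [hnext, hcur]
    have h1 : v (Rd N l x (i+1) m) = v r - c * (Rd N l x (i+1) m - r) := by linarith
    have h2 : v (Rd N l x (i+1) (m+1)) = v r' - c' * (Rd N l x (i+1) (m+1) - r') := by linarith
    rw [h1, h2]; ring
  have hrr : r * r' ≤ R^2 := by nlinarith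
  refine ⟨r * r' * τ / l * θ * c, r * r' * τ / l * (1-θ) * c', by positivity, ?_, by positivity,
    ?_, fun h => absurd hi (not_lt.2 h), ?_⟩
  · have : r * r' * τ / l * θ * c = θ * (c * (r * r') * τ / l) := by ring
    rw [this]; gcongr
  · have : r * r' * τ / l * (1-θ) * c' = (1-θ) * (c' * (r * r') * τ / l) := by ring
    rw [this]; gcongr
  · have h3 : (r' - r) * l = -(r * r') * ((x (i+1) (m+1) - x i (m+1)) - (x (i+1) m - x i m)) := by
      have : (r' - r) * l = r' * (r * (x (i+1) m - x i m)) - r * (r' * (x (i+1) (m+1) - x i (m+1))) := by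
        rw [e1, e2]; ring
      rw [this]; ring
    rw [hdiff] at h3
    have h4 : r' - r = (r * r') * (τ * (θ * (c * (Rd N l x (i+1) m - r)) +
        (1-θ) * (c' * (Rd N l x (i+1) (m+1) - r')))) / l := by
      rw [eq_div_iff hl.ne', h3]; ring
    rw [h4]; ring

lemma scheme_tv (hva : Antitone v) (hvl : ∀ p q, |v p - v q| ≤ Lv * |p - q|) (hLv : 0 ≤ Lv)
    (hR : 0 < R) (hτ : 0 < τ) (hl : 0 < l) (hθ : θ ∈ Set.Icc (0:ℝ) 1)
    (hs : IsScheme N M l τ θ v x)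
    (hb : ∀ m ≤ M, ∀ i < N, 0 < Rd N l x i m ∧ Rd N l x i m ≤ R)
    (hCFL : θ * (Lv * R^2 * τ / l) ≤ 1) {K : ℝ}
    (hK : ∑ i ∈ Finset.range N, |Rd N l x (i+1) 0 - Rd N l x i 0| ≤ K) :
    ∀ m ≤ M, ∑ i ∈ Finset.range N, |Rd N l x (i+1) m - Rd N l x i m| ≤ K := by
  intro m hm
  induction m with
  | zero => exact hK
  | succ m ih =>
    refine le_trans ?_ (ih (by omega))
    choose α β h1 h2 h3 h4 h5 h6 using
      scheme_coef hva hvl hLv hR hτ hl hθ hs hb (m := m) (by omega)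
    refine tvd_aux N α β (fun i => Rd N l x (i+1) m - Rd N l x i m)
      (fun i => Rd N l x (i+1) (m+1) - Rd N l x i (m+1)) (fun i _ => ⟨h1 i, (h2 i).trans hCFL⟩)
      (fun i _ => h3 i) (h5 N le_rfl).1 (h5 N le_rfl).2 ?_
    intro i _
    have := h6 i
    have := h6 (i+1)
    linarith

lemma scheme_dt (hva : Antitone v) (hvl : ∀ p q, |v p - v q| ≤ Lv * |p - q|) (hLv : 0 ≤ Lv)
    (hR : 0 < R) (hτ : 0 < τ) (hl : 0 < l) (hθ : θ ∈ Set.Icc (0:ℝ) 1)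
    (hs : IsScheme N M l τ θ v x)
    (hb : ∀ m ≤ M, ∀ i < N, 0 < Rd N l x i m ∧ Rd N l x i m ≤ R)
    (hCFL : θ * (Lv * R^2 * τ / l) ≤ 1) {K : ℝ}
    (hK : ∑ i ∈ Finset.range N, |Rd N l x (i+1) 0 - Rd N l x i 0| ≤ K) {m : ℕ} (hm : m < M) :
    ∑ i ∈ Finset.range N, |Rd N l x i (m+1) - Rd N l x i m| ≤ Lv * R^2 * τ / l * K := by
  have htv := scheme_tv hva hvl hLv hR hτ hl hθ hs hb hCFL hK
  have hμ : 0 ≤ Lv * R^2 * τ / l := by positivity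
  set μ := Lv * R^2 * τ / l
  have hθ1 : 0 ≤ 1 - θ := by linarith [hθ.2]
  have hθ0 := hθ.1
  calc ∑ i ∈ Finset.range N, |Rd N l x i (m+1) - Rd N l x i m|
      ≤ ∑ i ∈ Finset.range N, (θ * μ * |Rd N l x (i+1) m - Rd N l x i m| +
        (1-θ) * μ * |Rd N l x (i+1) (m+1) - Rd N l x i (m+1)|) := by
        refine Finset.sum_le_sum fun i _ => ?_
        obtain ⟨α, β, h1, h2, h3, h4, h5, h6⟩ := scheme_coef hva hvl hLv hR hτ hl hθ hs hb hm i
        rw [h6]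
        refine (abs_add_le _ _).trans ?_
        rw [abs_mul, abs_mul, abs_of_nonneg h1, abs_of_nonneg h3]
        gcongr
    _ = θ * μ * ∑ i ∈ Finset.range N, |Rd N l x (i+1) m - Rd N l x i m| +
        (1-θ) * μ * ∑ i ∈ Finset.range N, |Rd N l x (i+1) (m+1) - Rd N l x i (m+1)| := by
        rw [Finset.sum_add_distrib, Finset.mul_sum, Finset.mul_sum]
    _ ≤ θ * μ * K + (1-θ) * μ * K := by
        gcongr
        · exact htv m hm.le
        · exact htv (m+1) hm
    _ = μ * K := by ring

end

/-! ### Time interpolation -/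

/-- piecewise affine time interpolation of the discrete trajectories. -/
noncomputable def xi (M : ℕ) (τ : ℝ) (x : ℕ → ℕ → ℝ) (i : ℕ) (t : ℝ) : ℝ :=
  x i 0 + ∑ m ∈ Finset.range M, (x i (m+1) - x i m) * max 0 (min 1 (t / τ - m))

/-- velocity of the interpolated trajectories. -/
noncomputable def vel (τ : ℝ) (x : ℕ → ℕ → ℝ) (i : ℕ) (t : ℝ) : ℝ :=
  (x i (⌊t / τ⌋₊ + 1) - x i ⌊t / τ⌋₊) / τ

lemma xi_cont (M : ℕ) (τ : ℝ) (x : ℕ → ℕ → ℝ) (i : ℕ) : Continuous (xi M τ x i) := by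
  unfold xi; fun_prop

lemma xi_eq {M : ℕ} {τ : ℝ} {x : ℕ → ℕ → ℝ} {i m : ℕ} (hm : m < M) {t : ℝ}
    (h1 : (m:ℝ) ≤ t / τ) (h2 : t / τ ≤ m + 1) :
    xi M τ x i t = x i m + (t / τ - m) * (x i (m+1) - x i m) := by
  have hM : M = m + (1 + (M - m - 1)) := by omega
  unfold xi
  rw [hM, Finset.sum_range_add, Finset.sum_range_add]
  have e1 : ∑ k ∈ Finset.range m, (x i (k+1) - x i k) * max 0 (min 1 (t / τ - k)) = x i m - x i 0 := by
    rw [← Finset.sum_range_sub (fun k => x i k)]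
    refine Finset.sum_congr rfl fun k hk => ?_
    have : ((k:ℝ) + 1) ≤ m := by exact_mod_cast Finset.mem_range.1 hk
    rw [min_eq_left (by linarith), max_eq_right (by norm_num), mul_one]
  have e3 : ∑ k ∈ Finset.range (M - m - 1), (x i (m + (1 + k) + 1) - x i (m + (1 + k))) *
      max 0 (min 1 (t / τ - ((m + (1 + k) : ℕ) : ℝ))) = 0 := by
    refine Finset.sum_eq_zero fun k _ => ?_
    have : (0:ℝ) ≤ k := Nat.cast_nonneg k
    rw [max_eq_left, mul_zero]
    push_cast
    exact (min_le_right _ _).trans (by linarith)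
  rw [e1, e3]
  simp only [Finset.range_one, Finset.sum_singleton, add_zero]
  rw [min_eq_right (by linarith), max_eq_right (by linarith)]
  ring

lemma xi_zero (M : ℕ) (τ : ℝ) (x : ℕ → ℕ → ℝ) (i : ℕ) : xi M τ x i 0 = x i 0 := by
  unfold xi
  rw [add_eq_left]
  refine Finset.sum_eq_zero fun k _ => ?_
  have : (0:ℝ) ≤ k := Nat.cast_nonneg k
  rw [max_eq_left, mul_zero]
  exact (min_le_right _ _).trans (by simp)

lemma xi_node {M : ℕ} {τ : ℝ} (hτ : 0 < τ) {x : ℕ → ℕ → ℝ} {i m : ℕ} (hm : m < M) :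
    xi M τ x i (m * τ) = x i m := by
  have : (m:ℝ) * τ / τ = m := by field_simp
  rw [xi_eq hm (by rw [this]) (by rw [this]; linarith), this]; ring

lemma floor_lt {M : ℕ} {τ t : ℝ} (hτ : 0 < τ) (ht : t ∈ Set.Ico 0 (M * τ)) :
    ⌊t / τ⌋₊ < M ∧ (⌊t / τ⌋₊ : ℝ) ≤ t / τ ∧ t / τ < ⌊t / τ⌋₊ + 1 := by
  have h0 : 0 ≤ t / τ := div_nonneg ht.1 hτ.le
  refine ⟨?_, Nat.floor_le h0, Nat.lt_floor_add_one _⟩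
  rw [Nat.floor_lt h0, div_lt_iff₀ hτ]; exact ht.2

lemma exists_step {M : ℕ} (hM : 0 < M) {τ t : ℝ} (hτ : 0 < τ) (ht : t ∈ Set.Icc 0 (M * τ)) :
    ∃ m < M, (m:ℝ) ≤ t / τ ∧ t / τ ≤ m + 1 := by
  rcases ht.2.lt_or_eq with h | h
  · obtain ⟨h1, h2, h3⟩ := floor_lt hτ ⟨ht.1, h⟩
    exact ⟨_, h1, h2, h3.le⟩
  · refine ⟨M - 1, by omega, ?_, ?_⟩
    all_goals
      rw [h, mul_div_assoc, div_self hτ.ne', mul_one, Nat.cast_sub hM]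
      simp

lemma xi_der {M : ℕ} {τ t : ℝ} (hτ : 0 < τ) (ht : t ∈ Set.Ico 0 (M * τ)) (x : ℕ → ℕ → ℝ) (i : ℕ) :
    HasDerivWithinAt (xi M τ x i) (vel τ x i t) (Set.Ici t) t := by
  obtain ⟨h1, h2, h3⟩ := floor_lt hτ ht
  unfold vel
  set m := ⌊t / τ⌋₊
  have hd : HasDerivAt (fun s => x i m + (s / τ - m) * (x i (m+1) - x i m))
      ((x i (m+1) - x i m) / τ) t := by
    have := ((((hasDerivAt_id t).div_const τ).sub_const (m:ℝ)).mul_const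
      (x i (m+1) - x i m)).const_add (x i m)
    have e : (x i (m+1) - x i m) / τ = 1 / τ * (x i (m+1) - x i m) := by ring
    rw [e]
    exact this
  refine hd.hasDerivWithinAt.congr_of_eventuallyEq ?_ (xi_eq h1 h2 h3.le)
  have : Set.Iio ((m + 1) * τ) ∈ nhds t := by
    apply Iio_mem_nhds
    rwa [div_lt_iff₀ hτ] at h3
  filter_upwards [mem_nhdsWithin_of_mem_nhds this, self_mem_nhdsWithin] with s hs hs'
  refine xi_eq h1 (h2.trans ?_) ?_
  · have : t ≤ s := hs'
    gcongr
  · rw [div_le_iff₀ hτ]; exact le_of_lt hs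

lemma harm_aux {l D D' s : ℝ} (hl : 0 < l) (hD : 0 < D) (hD' : 0 < D') (hs0 : 0 ≤ s) (hs1 : s ≤ 1) :
    l / (D + s * (D' - D)) ∈ Set.uIcc (l / D) (l / D') := by
  rw [Set.mem_uIcc]
  rcases le_total D D' with h | h
  · right
    have hp : 0 < D + s * (D' - D) := by nlinarith
    constructor
    · gcongr; nlinarith
    · gcongr; nlinarith
  · left
    have hp : D' ≤ D + s * (D' - D) := by nlinarith
    constructor
    · have : 0 < D + s * (D' - D) := by linarith
      gcongr; nlinarith
    · gcongr

theorem traj_of_scheme {v : ℝ → ℝ} {Lv R τ θ l T K V A B Mμ : ℝ} {N M : ℕ} {x : ℕ → ℕ → ℝ}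
    (hva : Antitone v) (hvl : ∀ p q, |v p - v q| ≤ Lv * |p - q|) (hLv : 0 ≤ Lv)
    (hV : ∀ p, |v p| ≤ V)
    (hR : 0 < R) (hτ : 0 < τ) (hl : 0 < l) (hN : 0 < N) (hM : 0 < M) (hT : M * τ = T)
    (hθ : θ ∈ Set.Icc (0:ℝ) 1)
    (hs : IsScheme N M l τ θ v x)
    (hb : ∀ m ≤ M, ∀ i < N, 0 < Rd N l x i m ∧ Rd N l x i m ≤ R)
    (hCFL : θ * (Lv * R^2 * τ / l) ≤ 1)
    (hK : ∑ i ∈ Finset.range N, |Rd N l x (i+1) 0 - Rd N l x i 0| ≤ K)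
    (hMμ : Lv * R^2 * τ / l ≤ Mμ)
    (hbox : ∀ i ≤ N, x i 0 ∈ Set.Icc A B) :
    Traj v R T (K * (1 + 2 * Mμ)) (A - V * T - 1) (B + V * T + 1) (Lv * (Lv * R^2 * τ / l * K)) l N
      (xi M τ x) (vel τ x) := by
  have htv := scheme_tv hva hvl hLv hR hτ hl hθ hs hb hCFL hK
  have hdt := fun m (hm : m < M) => scheme_dt hva hvl hLv hR hτ hl hθ hs hb hCFL hK (m := m) hm
  obtain ⟨hmono, hlast, hstep⟩ := hs
  have hK0 : 0 ≤ K := (Finset.sum_nonneg fun _ _ => abs_nonneg _).trans hK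
  have hμ : 0 ≤ Lv * R^2 * τ / l := by positivity
  set μ := Lv * R^2 * τ / l
  have hV0 : 0 ≤ V := (abs_nonneg _).trans (hV 0)
  have hθ1 : 0 ≤ 1 - θ := by linarith [hθ.2]
  have hθ0 := hθ.1
  -- velocities
  have hvelo : ∀ m < M, ∀ i ≤ N, x i (m+1) - x i m =
      τ * (θ * v (Rd N l x i m) + (1-θ) * v (Rd N l x i (m+1))) := by
    intro m hm i hi
    rcases hi.lt_or_eq with h | h
    · rw [hstep m hm i h]; ring
    · rw [h, hlast m hm]; simp only [Rd, lt_irrefl, if_false]; ring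
  have hcomb : ∀ p q, |θ * v p + (1-θ) * v q| ≤ V := by
    intro p q
    refine (abs_add_le _ _).trans ?_
    rw [abs_mul, abs_mul, abs_of_nonneg hθ0, abs_of_nonneg hθ1]
    nlinarith [hV p, hV q]
  have hinc : ∀ m < M, ∀ i ≤ N, |x i (m+1) - x i m| ≤ τ * V := by
    intro m hm i hi
    rw [hvelo m hm i hi, abs_mul, abs_of_pos hτ]
    exact mul_le_mul_of_nonneg_left (hcomb _ _) hτ.le
  have hpos : ∀ m ≤ M, ∀ i ≤ N, |x i m - x i 0| ≤ m * (τ * V) := by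
    intro m hm i hi
    induction m with
    | zero => simp
    | succ m ih =>
      have h1 := ih (by omega)
      have h2 := hinc m (by omega) i hi
      have e : x i (m+1) - x i 0 = (x i (m+1) - x i m) + (x i m - x i 0) := by ring
      rw [e]
      refine (abs_add_le _ _).trans ?_
      push_cast; linarith
  have hposT : ∀ m ≤ M, ∀ i ≤ N, |x i m - x i 0| ≤ V * T := by
    intro m hm i hi
    refine (hpos m hm i hi).trans ?_
    have : (m:ℝ) ≤ M := by exact_mod_cast hm
    rw [← hT]
    calc (m:ℝ) * (τ * V) ≤ M * (τ * V) := by gcongr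
      _ = V * (M * τ) := by ring
  -- description at intermediate times
  have hdesc : ∀ m < M, ∀ t, (m:ℝ) ≤ t / τ → t / τ ≤ m + 1 → ∀ i,
      rr N l (fun j => xi M τ x j t) i ∈ Set.uIcc (Rd N l x i m) (Rd N l x i (m+1)) := by
    intro m hm t h1 h2 i
    by_cases hi : i < N
    · simp only [rr, Rd, hi, if_true]
      rw [xi_eq hm h1 h2, xi_eq hm h1 h2]
      have := harm_aux hl (sub_pos.2 (hmono m hm.le i hi)) (sub_pos.2 (hmono (m+1) hm i hi))
        (s := t / τ - m) (by linarith) (by linarith)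
      convert this using 2
      ring
    · simp [rr, Rd, hi]
  have hd1 : ∀ m < M, ∀ t, (m:ℝ) ≤ t / τ → t / τ ≤ m + 1 → ∀ i,
      |rr N l (fun j => xi M τ x j t) i - Rd N l x i m| ≤ |Rd N l x i (m+1) - Rd N l x i m| :=
    fun m hm t h1 h2 i => Set.abs_sub_left_of_mem_uIcc (hdesc m hm t h1 h2 i)
  have hd2 : ∀ m < M, ∀ t, (m:ℝ) ≤ t / τ → t / τ ≤ m + 1 → ∀ i,
      |rr N l (fun j => xi M τ x j t) i - Rd N l x i (m+1)| ≤ |Rd N l x i (m+1) - Rd N l x i m| :=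
    fun m hm t h1 h2 i => by
      have := Set.abs_sub_right_of_mem_uIcc (hdesc m hm t h1 h2 i)
      rwa [abs_sub_comm] at this
  refine ⟨hl, hN, fun i => xi_cont M τ x i, ?_, ?_, ?_, ?_, ?_, ?_⟩
  · intro i _ t ht
    rw [← hT] at ht
    exact xi_der hτ ht x i
  · intro t ht i hi
    rw [← hT] at ht
    obtain ⟨m, hm, h1, h2⟩ := exists_step hM hτ ht
    rw [xi_eq hm h1 h2, xi_eq hm h1 h2]
    have h3 := hmono m hm.le i hi
    have h4 := hmono (m+1) hm i hi
    have hs0 : 0 ≤ t / τ - m := by linarith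
    have hs1 : 0 ≤ 1 - (t / τ - m) := by linarith
    have h5 := mul_nonneg hs1 (sub_pos.2 h3).le
    have h6 := mul_nonneg hs0 (sub_pos.2 h4).le
    rcases le_total (t / τ - m) (1/2) with hh | hh
    · have := mul_pos (show (0:ℝ) < 1 - (t / τ - m) by linarith) (sub_pos.2 h3)
      linarith
    · have := mul_pos (show (0:ℝ) < (t / τ - m) by linarith) (sub_pos.2 h4)
      linarith
  · intro t ht i hi
    rw [← hT] at ht
    obtain ⟨m, hm, h1, h2⟩ := exists_step hM hτ ht
    have := hdesc m hm t h1 h2 i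
    rw [Set.mem_uIcc] at this
    have h3 := (hb m hm.le i hi).2
    have h4 := (hb (m+1) hm i hi).2
    rcases this with h | h <;> linarith [h.2]
  · intro t ht
    rw [← hT] at ht
    obtain ⟨m, hm, h1, h2⟩ := exists_step hM hτ ht
    have h3 := hd1 m hm t h1 h2
    set q := rr N l (fun j => xi M τ x j t) with hq
    set E : ℕ → ℝ := fun i => |Rd N l x i (m+1) - Rd N l x i m| with hE
    have hEN : E N = 0 := by simp [hE, Rd]
    have hsE : ∑ i ∈ Finset.range N, E i ≤ μ * K := hdt m hm
    have hsE' : ∑ i ∈ Finset.range N, E (i+1) ≤ μ * K := by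
      have h5 := Finset.sum_range_succ E N
      have h6 := Finset.sum_range_succ' E N
      have h7 : 0 ≤ E 0 := abs_nonneg _
      linarith
    calc ∑ i ∈ Finset.range N, |q (i+1) - q i|
        ≤ ∑ i ∈ Finset.range N, (|Rd N l x (i+1) m - Rd N l x i m| + E (i+1) + E i) := by
          refine Finset.sum_le_sum fun i _ => ?_
          have e : q (i+1) - q i = (Rd N l x (i+1) m - Rd N l x i m) + (q (i+1) - Rd N l x (i+1) m)
            - (q i - Rd N l x i m) := by ring
          rw [e]
          refine (abs_sub _ _).trans ?_
          refine add_le_add ((abs_add_le _ _).trans (add_le_add le_rfl (h3 _))) (h3 _)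
      _ ≤ K + μ * K + μ * K := by
          rw [Finset.sum_add_distrib, Finset.sum_add_distrib]
          linarith [htv m hm.le]
      _ ≤ K * (1 + 2 * Mμ) := by nlinarith
  · intro t ht i hi
    rw [← hT] at ht
    obtain ⟨m, hm, h1, h2⟩ := exists_step hM hτ ht
    rw [xi_eq hm h1 h2]
    have h3 := abs_le.1 (hposT m hm.le i hi)
    have h4 := abs_le.1 (hposT (m+1) hm i hi)
    have h5 := hbox i hi
    have hs0 : 0 ≤ t / τ - m := by linarith
    have hs1 : t / τ - m ≤ 1 := by linarith
    have e : x i m + (t / τ - m) * (x i (m+1) - x i m) = (1 - (t/τ - m)) * x i m +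
      (t / τ - m) * x i (m+1) := by ring
    rw [e]
    set s := t / τ - m
    have h6 : A - V * T ≤ x i m := by linarith [h5.1]
    have h7 : x i m ≤ B + V * T := by linarith [h5.2]
    have h8 : A - V * T ≤ x i (m+1) := by linarith [h5.1]
    have h9 : x i (m+1) ≤ B + V * T := by linarith [h5.2]
    constructor <;> nlinarith
  · intro t ht
    rw [← hT] at ht
    obtain ⟨hm, h1, h2⟩ := floor_lt hτ ht
    set m := ⌊t / τ⌋₊ with hmdef
    have key : ∀ i ≤ N, |vel τ x i t - v (rr N l (fun j => xi M τ x j t) i)| ≤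
        Lv * |Rd N l x i (m+1) - Rd N l x i m| := by
      intro i hi
      have e1 : vel τ x i t = θ * v (Rd N l x i m) + (1-θ) * v (Rd N l x i (m+1)) := by
        unfold vel
        rw [← hmdef, hvelo m hm i hi]
        field_simp
      rw [e1]
      set q := rr N l (fun j => xi M τ x j t) i with hq
      have h3 := (hvl (Rd N l x i m) q).trans (mul_le_mul_of_nonneg_left
        ((abs_sub_comm _ _).le.trans (hd1 m hm t h1 h2.le i)) hLv)
      have h4 := (hvl (Rd N l x i (m+1)) q).trans (mul_le_mul_of_nonneg_left
        ((abs_sub_comm _ _).le.trans (hd2 m hm t h1 h2.le i)) hLv)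
      have e2 : θ * v (Rd N l x i m) + (1-θ) * v (Rd N l x i (m+1)) - v q =
        θ * (v (Rd N l x i m) - v q) + (1-θ) * (v (Rd N l x i (m+1)) - v q) := by ring
      rw [e2]
      refine (abs_add_le _ _).trans ?_
      rw [abs_mul, abs_mul, abs_of_nonneg hθ0, abs_of_nonneg hθ1]
      nlinarith
    calc ∑ i ∈ Finset.range (N+1), |vel τ x i t - v (rr N l (fun j => xi M τ x j t) i)|
        ≤ ∑ i ∈ Finset.range (N+1), Lv * |Rd N l x i (m+1) - Rd N l x i m| :=
          Finset.sum_le_sum fun i hi => key i (by have := Finset.mem_range.1 hi; omega)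
      _ = Lv * ∑ i ∈ Finset.range N, |Rd N l x i (m+1) - Rd N l x i m| := by
          rw [← Finset.mul_sum, Finset.sum_range_succ]; simp [Rd]
      _ ≤ Lv * (μ * K) := mul_le_mul_of_nonneg_left (hdt m hm) hLv

section
variable {f : ℝ → ℝ}

noncomputable def wf (f : ℝ → ℝ) (y : ℝ) : ℝ := (eVariationOn f (Set.Iic y)).toReal

noncomputable def totv (f : ℝ → ℝ) : ℝ := (eVariationOn f Set.univ).toReal

lemma wf_fin (hBV : BoundedVariationOn f Set.univ) (y : ℝ) : eVariationOn f (Set.Iic y) ≠ ⊤ :=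
  ne_top_of_le_ne_top hBV (eVariationOn.mono f (Set.subset_univ _))

lemma wf_mem (hBV : BoundedVariationOn f Set.univ) (y : ℝ) : wf f y ∈ Set.Icc 0 (totv f) :=
  ⟨ENNReal.toReal_nonneg, ENNReal.toReal_mono hBV (eVariationOn.mono f (Set.subset_univ _))⟩

lemma wf_var (hBV : BoundedVariationOn f Set.univ) (x y : ℝ) (hxy : x ≤ y) :
    |f x - f y| ≤ wf f y - wf f x := by
  have h1 : eVariationOn f (Set.Iic x) + eVariationOn f (Set.Icc x y) ≤
      eVariationOn f (Set.Iic x ∪ Set.Icc x y) :=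
    eVariationOn.add_le_union f fun a ha b hb => le_trans ha hb.1
  rw [Set.Iic_union_Icc_eq_Iic hxy] at h1
  have h2 : edist (f x) (f y) ≤ eVariationOn f (Set.Icc x y) :=
    eVariationOn.edist_le f ⟨le_rfl, hxy⟩ ⟨hxy, le_rfl⟩
  have h3 : eVariationOn f (Set.Iic x) + edist (f x) (f y) ≤ eVariationOn f (Set.Iic y) :=
    (add_le_add le_rfl h2).trans h1
  have h4 := ENNReal.toReal_mono (wf_fin hBV y) h3
  rw [ENNReal.toReal_add (wf_fin hBV x) (edist_ne_top _ _)] at h4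
  rw [← Real.dist_eq, dist_edist]
  unfold wf; linarith

lemma bv_measurable (hBV : BoundedVariationOn f Set.univ) : Measurable f := by
  have hl : LocallyBoundedVariationOn f Set.univ := hBV.locallyBoundedVariationOn
  obtain ⟨p, q, hp, hq, h⟩ := hl.exists_monotoneOn_sub_monotoneOn
  rw [h]
  exact (monotoneOn_univ.1 hp).measurable.sub (monotoneOn_univ.1 hq).measurable

lemma bv_integrable {R : ℝ} (hBV : BoundedVariationOn f Set.univ) (hs : HasCompactSupport f)
    (hb : ∀ᵐ z ∂(volume : Measure ℝ), f z ∈ Set.Icc 0 R) : Integrable f := by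
  rw [← integrableOn_iff_integrable_of_support_subset (subset_tsupport f)]
  refine Measure.integrableOn_of_bounded (M := R) (hs.isCompact.measure_lt_top.ne)
    (bv_measurable hBV).aestronglyMeasurable ?_
  refine ae_restrict_of_ae ?_
  filter_upwards [hb] with z hz
  rw [Real.norm_eq_abs, abs_of_nonneg hz.1]; exact hz.2

lemma out_zero (hs : HasCompactSupport f) {y : ℝ}
    (hy : y ∉ Set.Icc (sInf (tsupport f)) (sSup (tsupport f))) : f y = 0 := by
  apply image_eq_zero_of_notMem_tsupport
  intro h
  exact hy ⟨csInf_le hs.isCompact.bddBelow h, le_csSup hs.isCompact.bddAbove h⟩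

end

structure InitData (f : ℝ → ℝ) (R L A0 B0 : ℝ) : Prop where
  bv : BoundedVariationOn f Set.univ
  int : Integrable f
  bd : ∀ᵐ z ∂(volume : Measure ℝ), f z ∈ Set.Icc 0 R
  out : ∀ y, y ∉ Set.Icc A0 B0 → f y = 0
  tot : ∫ z, f z = L

namespace InitData
variable {f : ℝ → ℝ} {R L A0 B0 A B : ℝ} 

lemma ii (h : InitData f R L A0 B0) (a b : ℝ) : IntervalIntegrable f volume a b :=
  h.int.intervalIntegrable

lemma diff (h : InitData f R L A0 B0) (A a b : ℝ) :
    (∫ y in A..b, f y) - (∫ y in A..a, f y) = ∫ y in a..b, f y := by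
  have := intervalIntegral.integral_add_adjacent_intervals (h.ii A a) (h.ii a b)
  linarith

lemma nonneg (h : InitData f R L A0 B0) {a b : ℝ} (hab : a ≤ b) : 0 ≤ ∫ y in a..b, f y := by
  apply intervalIntegral.integral_nonneg_of_ae hab
  filter_upwards [h.bd] with y hy using hy.1

lemma lip (h : InitData f R L A0 B0) {a b : ℝ} (hab : a ≤ b) : ∫ y in a..b, f y ≤ R * (b - a) := by
  have h1 : ∫ y in a..b, f y ≤ ∫ y in a..b, R := by
    apply intervalIntegral.integral_mono_ae hab (h.ii a b) (by simp)
    filter_upwards [h.bd] with y hy using hy.2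
  simpa [mul_comm] using h1

lemma total (h : InitData f R L A0 B0) {A B : ℝ} (hA : A < A0) (hB : B0 ≤ B) :
    ∫ y in A..B, f y = L := by
  rw [← h.tot]
  apply intervalIntegral.integral_eq_integral_of_support_subset
  intro y hy
  by_contra hc
  apply hy
  apply h.out
  intro h'
  exact hc ⟨hA.trans_le h'.1, h'.2.trans hB⟩

lemma left (h : InitData f R L A0 B0) {A : ℝ} (hA : A ≤ A0) : ∫ y in A..A0, f y = 0 := by
  rw [intervalIntegral.integral_of_le hA, ← integral_Ico_eq_integral_Ioc]
  apply setIntegral_eq_zero_of_forall_eq_zero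
  intro y hy
  exact h.out y fun h' => absurd h'.1 (not_le.2 hy.2)

lemma mass {l : ℝ} {N : ℕ} {X : ℕ → ℝ} (h : InitData f R L A0 B0) (hAB0 : A0 ≤ B0) (hl : 0 < l)
    (hlN : l * N = L) (h0 : X 0 = A0)
    (hX : ∀ i < N, IsLeast {z : ℝ | X i ≤ z ∧ l ≤ ∫ s in (X i)..z, f s} (X (i+1)))
    {A : ℝ} (hA : A < A0) :
    ∀ i ≤ N, X i ∈ Set.Icc A0 B0 ∧ ∫ s in A..X i, f s = l * i := by
  intro i hi
  induction i with
  | zero => rw [h0]; exact ⟨⟨le_rfl, hAB0⟩, by simpa using h.left hA.le⟩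
  | succ i ih =>
    obtain ⟨⟨h1, h2⟩, h3⟩ := ih (by omega)
    obtain ⟨⟨h4, h5⟩, h6⟩ := hX i (by omega)
    have hB : X (i+1) ≤ B0 := by
      apply h6
      refine ⟨h2, ?_⟩
      rw [← h.diff A, h.total hA le_rfl, h3, ← hlN]
      have : ((i:ℝ) + 1) ≤ N := by exact_mod_cast hi
      nlinarith
    refine ⟨⟨h1.trans h4, hB⟩, ?_⟩
    have hcont : Continuous fun z => ∫ s in X i..z, f s :=
      intervalIntegral.continuous_primitive h.ii _
    have heq : ∫ s in X i..X (i+1), f s = l := by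
      refine le_antisymm ?_ h5
      by_contra hc
      push Not at hc
      have hlt : X i < X (i+1) := by
        rcases h4.lt_or_eq with h' | h'
        · exact h'
        · rw [← h'] at h5; simp at h5; linarith
      have hev : ∀ᶠ z in nhdsWithin (X (i+1)) (Set.Iio (X (i+1))), l < ∫ s in X i..z, f s :=
        (hcont.tendsto (X (i+1))).mono_left nhdsWithin_le_nhds |>.eventually (lt_mem_nhds hc)
      have hev2 : ∀ᶠ z in nhdsWithin (X (i+1)) (Set.Iio (X (i+1))), X i < z :=
        mem_nhdsWithin_of_mem_nhds (lt_mem_nhds hlt)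
      obtain ⟨z, hz1, hz2, hz3⟩ := (hev.and (hev2.and self_mem_nhdsWithin)).exists
      have := h6 ⟨hz2.le, hz1.le⟩
      exact absurd hz3 (not_lt.2 this)
    have := h.diff A (X i) (X (i+1))
    push_cast
    linarith

lemma tv {l : ℝ} {N : ℕ} {X : ℕ → ℝ} (h : InitData f R L A0 B0) (hAB0 : A0 ≤ B0) (hl : 0 < l)
    (hlN : l * N = L) (h0 : X 0 = A0) (hN : 0 < N)
    (hX : ∀ i < N, IsLeast {z : ℝ | X i ≤ z ∧ l ≤ ∫ s in (X i)..z, f s} (X (i+1)))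
    (hm : ∀ i < N, X i < X (i+1)) (hbd : ∀ i < N, 0 < rr N l X i ∧ rr N l X i ≤ R) :
    ∑ i ∈ Finset.range N, |rr N l X (i+1) - rr N l X i| ≤ totv f + R := by
  have hmass := h.mass hAB0 hl hlN h0 hX (A := A0 - 1) (by linarith)
  obtain ⟨n, rfl⟩ : ∃ n, N = n + 1 := ⟨N - 1, by omega⟩
  rw [Finset.sum_range_succ]
  have hlast : |rr (n+1) l X (n+1) - rr (n+1) l X n| ≤ R := by
    have := hbd n (by omega)
    have e : rr (n+1) l X (n+1) = 0 := by simp [rr]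
    rw [e, zero_sub, abs_neg, abs_of_pos this.1]; exact this.2
  have hintg : ∀ i < n+1, Integrable fun s => f (X i + (X (i+1) - X i) * s) := fun i hi =>
    (h.int.comp_add_left (X i)).comp_mul_left' (sub_pos.2 (hm i hi)).ne'
  have hrep : ∀ i < n+1, rr (n+1) l X i = ∫ s in (0:ℝ)..1, f (X i + (X (i+1) - X i) * s) := by
    intro i hi
    have hne := (sub_pos.2 (hm i hi)).ne'
    rw [intervalIntegral.integral_comp_add_mul f hne]
    have e : ∫ s in X i..X (i+1), f s = l := by
      rw [← h.diff (A0 - 1), (hmass _ (by omega : i + 1 ≤ n+1)).2, (hmass _ (by omega : i ≤ n+1)).2]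
      push_cast; ring
    simp only [mul_zero, add_zero, mul_one, add_sub_cancel, e, rr, hi, if_true, smul_eq_mul]
    field_simp
  have hsum : ∑ i ∈ Finset.range n, |rr (n+1) l X (i+1) - rr (n+1) l X i| ≤ totv f := by
    calc ∑ i ∈ Finset.range n, |rr (n+1) l X (i+1) - rr (n+1) l X i|
        ≤ ∑ i ∈ Finset.range n, ∫ s in (0:ℝ)..1,
          |f (X (i+1) + (X (i+1+1) - X (i+1)) * s) - f (X i + (X (i+1) - X i) * s)| := by
          refine Finset.sum_le_sum fun i hi => ?_
          have hi := Finset.mem_range.1 hi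
          rw [hrep i (by omega), hrep (i+1) (by omega), ← intervalIntegral.integral_sub
            (hintg (i+1) (by omega)).intervalIntegrable (hintg i (by omega)).intervalIntegrable]
          exact intervalIntegral.abs_integral_le_integral_abs zero_le_one
      _ = ∫ s in (0:ℝ)..1, ∑ i ∈ Finset.range n,
          |f (X (i+1) + (X (i+1+1) - X (i+1)) * s) - f (X i + (X (i+1) - X i) * s)| := by
          rw [intervalIntegral.integral_finsetSum]
          intro i hi
          have hi := Finset.mem_range.1 hi
          exact ((hintg (i+1) (by omega)).sub (hintg i (by omega))).abs.intervalIntegrable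
      _ ≤ ∫ s in (0:ℝ)..1, totv f := by
          apply intervalIntegral.integral_mono_on zero_le_one
          · refine Integrable.intervalIntegrable (integrable_finsetSum _ fun i hi => ?_)
            have hi := Finset.mem_range.1 hi
            exact ((hintg (i+1) (by omega)).sub (hintg i (by omega))).abs
          · simp
          · intro s hs
            have key : ∀ i ∈ Finset.range n,
                |f (X (i+1) + (X (i+1+1) - X (i+1)) * s) - f (X i + (X (i+1) - X i) * s)| ≤
                wf f (X (i+1) + (X (i+1+1) - X (i+1)) * s) - wf f (X i + (X (i+1) - X i) * s) := by
              intro i hi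
              have hi := Finset.mem_range.1 hi
              rw [abs_sub_comm]
              apply wf_var h.bv
              have h1 := sub_pos.2 (hm i (by omega))
              have h2 := sub_pos.2 (hm (i+1) (by omega))
              have h3 := mul_nonneg h2.le hs.1
              have h4 := mul_le_mul_of_nonneg_left hs.2 h1.le
              linarith
            refine (Finset.sum_le_sum key).trans ?_
            rw [Finset.sum_range_sub (fun i => wf f (X i + (X (i+1) - X i) * s))]
            have h1 := wf_mem h.bv (X n + (X (n+1) - X n) * s)
            have h2 := wf_mem h.bv (X 0 + (X (0+1) - X 0) * s)
            linarith [h1.2, h2.1]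
      _ = totv f := by simp
  linarith

lemma massFn {l : ℝ} {N : ℕ} {X : ℕ → ℝ} (h : InitData f R L A0 B0) (hAB0 : A0 ≤ B0) (hl : 0 < l)
    (hlN : l * N = L) (h0 : X 0 = A0)
    (hX : ∀ i < N, IsLeast {z : ℝ | X i ≤ z ∧ l ≤ ∫ s in (X i)..z, f s} (X (i+1)))
    {A B : ℝ} (hA : A < A0) (hB : B0 ≤ B) : MassFn A B L l N X (fun b => ∫ y in A..b, f y) := by
  refine ⟨?_, by simp, (h.total hA hB).le, fun i hi => (h.mass hAB0 hl hlN h0 hX hA i hi).2⟩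
  intro a _ b _ hab
  have := h.diff A a b
  have := h.nonneg hab
  simp only
  linarith

lemma cmp {l l' : ℝ} {N N' : ℕ} {X Y : ℕ → ℝ} (h : InitData f R L A0 B0) (hAB0 : A0 ≤ B0)
    (hR : 0 ≤ R) (hl : 0 < l) (hl' : 0 < l')
    (hlN : l * N = L) (h0 : X 0 = A0) (hlN' : l' * N' = L) (h0' : Y 0 = A0)
    (hX : ∀ i < N, IsLeast {z : ℝ | X i ≤ z ∧ l ≤ ∫ s in (X i)..z, f s} (X (i+1)))
    (hY : ∀ i < N', IsLeast {z : ℝ | Y i ≤ z ∧ l' ≤ ∫ s in (Y i)..z, f s} (Y (i+1))) :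
    ∀ i ≤ N, ∀ j ≤ N', l * i - l' * j ≤ R * max (X i - Y j) 0 := by
  intro i hi j hj
  rw [← (h.mass hAB0 hl hlN h0 hX (A := A0 - 1) (by linarith) i hi).2,
    ← (h.mass hAB0 hl' hlN' h0' hY (A := A0 - 1) (by linarith) j hj).2, h.diff]
  rcases le_total (Y j) (X i) with h' | h'
  · exact (h.lip h').trans (mul_le_mul_of_nonneg_left (le_max_left _ _) hR)
  · have h1 := h.nonneg h'
    rw [intervalIntegral.integral_symm]
    have : 0 ≤ R * max (X i - Y j) 0 := mul_nonneg hR (le_max_right _ _)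
    linarith

lemma close {C l : ℝ} {N : ℕ} {X : ℕ → ℝ} (h : InitData f R L A0 B0) (hAB0 : A0 ≤ B0) (hR : 0 ≤ R)
    (hc : Cfg R C A B l N X)
    (hlN : l * N = L) (h0 : X 0 = A0)
    (hX : ∀ i < N, IsLeast {z : ℝ | X i ≤ z ∧ l ≤ ∫ s in (X i)..z, f s} (X (i+1)))
    (hA : A < A0) (hB : B0 < B) {P : ℕ} (hP : 0 < P) :
    ∫ y, |dens N l X y - f y| ≤ P * (2 * (2 * l)) + (B - A) / P * (2 * C + totv f) := by
  have hm : ∀ i ≤ N, ∀ j ≤ N, X i ≤ X j → l * i ≤ l * j + 0 := by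
    intro i hi j hj hij
    have : i ≤ j := by
      by_contra hcon
      push Not at hcon
      have h1 := (hc.mono j (by omega)).trans_le (hc.le (show j + 1 ≤ i by omega) hi)
      linarith
    have : (i:ℝ) ≤ j := by exact_mod_cast this
    have := hc.hl
    nlinarith
  have hM1 := hc.massFn hR hlN
  have hM2 := h.massFn hAB0 hc.hl hlN h0 hX hA hB.le
  have c1 := mass_cmp hc hc hM1 hM2 le_rfl hlN hlN hm
  have c2 := mass_cmp hc hc hM2 hM1 le_rfl hlN hlN hm
  refine l1_close hP (by linarith) (dens_integrable N l X) h.int (fun x y hxy => hc.dens_var hxy)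
    (wf_var h.bv) hc.wvar_mem (wf_mem h.bv) (fun y hy => hc.dens_out hy) ?_ ?_
  · intro y hy
    exact h.out y fun h' => hy ⟨hA.trans_le h'.1, h'.2.trans_lt hB⟩
  · intro b hb
    have := c1 b hb
    have := c2 b hb
    rw [abs_le]
    constructor <;> linarith

end InitData

/-- Test functions with the quantitative information used below. -/
structure Test (φ : ℝ → ℝ → ℝ) (T a b Φ K : ℝ) : Prop where
  smooth : ContDiff ℝ 1 (Function.uncurry φ)
  nonneg : ∀ y t, 0 ≤ φ y t
  fin : ∀ y t, T ≤ t → φ y t = 0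
  supp : ∀ y t, y ∉ Set.Ioo a b → φ y t = 0
  bound : ∀ y t, φ y t ≤ Φ
  lip : ∀ y z s t, |φ y s - φ z t| ≤ K * (|y - z| + |s - t|)
  K0 : 0 ≤ K
  ab : a < b

noncomputable def pt (φ : ℝ → ℝ → ℝ) (y t : ℝ) : ℝ := deriv (fun s => φ y s) t
noncomputable def px (φ : ℝ → ℝ → ℝ) (y t : ℝ) : ℝ := deriv (fun z => φ z t) y

lemma test_exists {φ : ℝ → ℝ → ℝ} {T : ℝ} (h1 : ContDiff ℝ 1 (Function.uncurry φ))
    (h2 : HasCompactSupport (Function.uncurry φ)) (h3 : ∀ y : ℝ, ∀ t : ℝ, T ≤ t → φ y t = 0)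
    (h4 : ∀ y t : ℝ, 0 ≤ φ y t) : ∃ a b Φ K, Test φ T a b Φ K := by
  obtain ⟨K, hK⟩ := h1.lipschitzWith_of_hasCompactSupport h2 one_ne_zero
  obtain ⟨Φ, hΦ⟩ := h2.exists_bound_of_continuous h1.continuous
  obtain ⟨r, hr⟩ := h2.isCompact.isBounded.subset_closedBall 0
  refine ⟨-(|r|+1), |r|+1, Φ, K, h1, h4, h3, ?_, ?_, ?_, K.2, by
    have := abs_nonneg r; linarith⟩
  · intro y t hy
    have : (y,t) ∉ tsupport (Function.uncurry φ) := by
      intro hc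
      apply hy
      have h5 := hr hc
      rw [mem_closedBall_zero_iff, Prod.norm_mk] at h5
      have h6 : |y| ≤ r := (le_max_left _ _).trans h5
      have h7 : |y| < |r| + 1 := by linarith [le_abs_self r]
      exact abs_lt.1 h7
    exact image_eq_zero_of_notMem_tsupport (f := Function.uncurry φ) this
  · intro y t
    exact (le_abs_self _).trans (hΦ (y,t))
  · intro y z s t
    have h5 := hK.dist_le_mul (y,s) (z,t)
    rw [Real.dist_eq] at h5
    refine h5.trans (mul_le_mul_of_nonneg_left ?_ K.2)
    rw [Prod.dist_eq, Real.dist_eq, Real.dist_eq]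
    exact max_le_add_of_nonneg (abs_nonneg _) (abs_nonneg _)

namespace Test
variable {φ : ℝ → ℝ → ℝ} {T a b Φ K : ℝ}

lemma widen (h : Test φ T a b Φ K) {a' b' : ℝ} (ha : a' ≤ a) (hb : b ≤ b') :
    Test φ T a' b' Φ K :=
  ⟨h.smooth, h.nonneg, h.fin, fun y t hy => h.supp y t fun h' =>
    hy ⟨ha.trans_lt h'.1, h'.2.trans_le hb⟩, h.bound, h.lip, h.K0, by linarith [h.ab]⟩

lemma cont (h : Test φ T a b Φ K) : Continuous (Function.uncurry φ) := h.smooth.continuous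

lemma cont' (h : Test φ T a b Φ K) : Continuous (Function.uncurry fun t y => φ y t) :=
  h.cont.comp continuous_swap

lemma cont1 (h : Test φ T a b Φ K) (t : ℝ) : Continuous fun y => φ y t :=
  h.cont.comp (by fun_prop : Continuous fun y : ℝ => (y, t))

lemma hasT (h : Test φ T a b Φ K) (y t : ℝ) :
    HasDerivAt (fun s => φ y s) (fderiv ℝ (Function.uncurry φ) (y,t) (0,1)) t := by
  have h1 : HasFDerivAt (Function.uncurry φ) (fderiv ℝ (Function.uncurry φ) (y,t)) (y,t) :=
    (h.smooth.differentiable one_ne_zero _).hasFDerivAt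
  exact h1.comp_hasDerivAt t ((hasDerivAt_const t y).prodMk (hasDerivAt_id t))

lemma hasX (h : Test φ T a b Φ K) (y t : ℝ) :
    HasDerivAt (fun z => φ z t) (fderiv ℝ (Function.uncurry φ) (y,t) (1,0)) y := by
  have h1 : HasFDerivAt (Function.uncurry φ) (fderiv ℝ (Function.uncurry φ) (y,t)) (y,t) :=
    (h.smooth.differentiable one_ne_zero _).hasFDerivAt
  have h2 : HasDerivAt (fun z : ℝ => (z, t)) ((1:ℝ), (0:ℝ)) y :=
    (hasDerivAt_id y).prodMk (hasDerivAt_const y t)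
  exact h1.comp_hasDerivAt y h2

lemma pt_has (h : Test φ T a b Φ K) (y t : ℝ) : HasDerivAt (fun s => φ y s) (pt φ y t) t :=
  (h.hasT y t).differentiableAt.hasDerivAt

lemma px_has (h : Test φ T a b Φ K) (y t : ℝ) : HasDerivAt (fun z => φ z t) (px φ y t) y :=
  (h.hasX y t).differentiableAt.hasDerivAt

lemma pt_cont (h : Test φ T a b Φ K) : Continuous (Function.uncurry (pt φ)) := by
  have : Function.uncurry (pt φ) = fun p => fderiv ℝ (Function.uncurry φ) p (0,1) := by
    ext ⟨y,t⟩; exact (h.hasT y t).deriv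
  rw [this]
  exact (h.smooth.continuous_fderiv one_ne_zero).clm_apply continuous_const

lemma px_cont (h : Test φ T a b Φ K) : Continuous (Function.uncurry (px φ)) := by
  have : Function.uncurry (px φ) = fun p => fderiv ℝ (Function.uncurry φ) p (1,0) := by
    ext ⟨y,t⟩; exact (h.hasX y t).deriv
  rw [this]
  exact (h.smooth.continuous_fderiv one_ne_zero).clm_apply continuous_const

lemma pt_cont1 (h : Test φ T a b Φ K) (t : ℝ) : Continuous fun y => pt φ y t :=
  h.pt_cont.comp (by fun_prop : Continuous fun y : ℝ => (y, t))

lemma px_cont1 (h : Test φ T a b Φ K) (t : ℝ) : Continuous fun y => px φ y t :=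
  h.px_cont.comp (by fun_prop : Continuous fun y : ℝ => (y, t))

lemma pt_bd (h : Test φ T a b Φ K) (y t : ℝ) : |pt φ y t| ≤ K := by
  have : LipschitzWith ⟨K, h.K0⟩ (fun s => φ y s) := by
    apply LipschitzWith.of_dist_le_mul
    intro s s'
    rw [Real.dist_eq, Real.dist_eq]
    have := h.lip y y s s'
    simp only [sub_self, abs_zero, zero_add] at this
    exact this
  exact norm_deriv_le_of_lipschitz this

lemma px_bd (h : Test φ T a b Φ K) (y t : ℝ) : |px φ y t| ≤ K := by
  have : LipschitzWith ⟨K, h.K0⟩ (fun z => φ z t) := by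
    apply LipschitzWith.of_dist_le_mul
    intro s s'
    rw [Real.dist_eq, Real.dist_eq]
    have := h.lip s s' t t
    simp only [sub_self, abs_zero, add_zero] at this
    exact this
  exact norm_deriv_le_of_lipschitz this

lemma pt_supp (h : Test φ T a b Φ K) {y : ℝ} (t : ℝ) (hy : y ∉ Set.Icc a b) : pt φ y t = 0 := by
  have : (fun s => φ y s) = fun _ => 0 := by
    ext s; exact h.supp y s fun h' => hy ⟨h'.1.le, h'.2.le⟩
  rw [pt, this, deriv_const]

lemma px_supp (h : Test φ T a b Φ K) {y : ℝ} (t : ℝ) (hy : y ∉ Set.Icc a b) : px φ y t = 0 := by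
  have : (fun z => φ z t) =ᶠ[nhds y] fun _ => 0 := by
    filter_upwards [isClosed_Icc.isOpen_compl.mem_nhds hy] with z hz
    exact h.supp z t fun h' => hz ⟨h'.1.le, h'.2.le⟩
  rw [px, this.deriv_eq, deriv_const]

lemma int0 (h : Test φ T a b Φ K) (t : ℝ) : Integrable fun y => φ y t :=
  (h.cont1 t).integrable_of_hasCompactSupport
    (HasCompactSupport.of_support_subset_isCompact (isCompact_Icc (a := a) (b := b)) fun y hy => by
      by_contra hc; exact hy (h.supp y t fun h' => hc ⟨h'.1.le, h'.2.le⟩))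

lemma pt_int (h : Test φ T a b Φ K) (t : ℝ) : Integrable fun y => pt φ y t :=
  (h.pt_cont1 t).integrable_of_hasCompactSupport
    (HasCompactSupport.of_support_subset_isCompact (isCompact_Icc (a := a) (b := b)) fun y hy => by
      by_contra hc; exact hy (h.pt_supp t hc))

lemma px_int (h : Test φ T a b Φ K) (t : ℝ) : Integrable fun y => px φ y t :=
  (h.px_cont1 t).integrable_of_hasCompactSupport
    (HasCompactSupport.of_support_subset_isCompact (isCompact_Icc (a := a) (b := b)) fun y hy => by
      by_contra hc; exact hy (h.px_supp t hc))

lemma leib0 (h : Test φ T a b Φ K) {x : ℝ → ℝ} {u t : ℝ}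
    (hx : HasDerivWithinAt x u (Set.Ici t) t) :
    HasDerivWithinAt (fun s => ∫ y in x t..x s, φ y s) (φ (x t) t * u) (Set.Ici t) t := by
  have hrem : HasDerivWithinAt (fun s => ∫ y in x t..x s, (φ y s - φ (x t) t)) 0 (Set.Ici t) t := by
    rw [hasDerivWithinAt_iff_isLittleO]
    simp only [intervalIntegral.integral_same, sub_zero, smul_zero]
    have hO : (fun s => x s - x t) =O[nhdsWithin t (Set.Ici t)] fun s => s - t :=
      hx.hasFDerivWithinAt.isBigO_sub
    have ho : (fun s => K * (|x s - x t| + |s - t|)) =o[nhdsWithin t (Set.Ici t)]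
        fun _ => (1:ℝ) := by
      rw [Asymptotics.isLittleO_one_iff]
      have h1 : Tendsto x (nhdsWithin t (Set.Ici t)) (nhds (x t)) := hx.continuousWithinAt
      have h2 : Tendsto (fun s : ℝ => s) (nhdsWithin t (Set.Ici t)) (nhds t) :=
        tendsto_id.mono_left nhdsWithin_le_nhds
      have h3 := (((h1.sub_const (x t)).abs).add ((h2.sub_const t).abs)).const_mul K
      simpa using h3
    have := ho.mul_isBigO hO
    simp only [one_mul] at this
    refine Asymptotics.IsBigO.trans_isLittleO (Asymptotics.IsBigO.of_bound 1 ?_) this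
    refine Eventually.of_forall fun s => ?_
    rw [one_mul, norm_mul, Real.norm_of_nonneg (mul_nonneg h.K0 (by positivity)), Real.norm_eq_abs (x s - x t)]
    apply intervalIntegral.norm_integral_le_of_norm_le_const
    intro y hy
    refine (h.lip _ _ _ _).trans (mul_le_mul_of_nonneg_left (add_le_add ?_ le_rfl) h.K0)
    exact Set.abs_sub_left_of_mem_uIcc (Set.uIoc_subset_uIcc hy)
  have hmain : HasDerivWithinAt (fun s => φ (x t) t * (x s - x t)) (φ (x t) t * u) (Set.Ici t) t :=
    (hx.sub_const _).const_mul _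
  have := hrem.add hmain
  rw [zero_add] at this
  refine this.congr_of_eventuallyEq (Eventually.of_forall fun s => ?_) ?_
  · simp only [Pi.add_apply]
    rw [intervalIntegral.integral_sub ((h.cont1 s).intervalIntegrable _ _) (by simp)]
    simp; ring
  · simp

lemma leib (h : Test φ T a b Φ K) {x : ℝ → ℝ} {u t : ℝ} (c : ℝ)
    (hx : HasDerivWithinAt x u (Set.Ici t) t) :
    HasDerivWithinAt (fun s => ∫ y in c..x s, φ y s)
      ((∫ y in c..x t, pt φ y t) + φ (x t) t * u) (Set.Ici t) t := by
  have h1 : HasDerivAt (fun s => ∫ y in c..x t, φ y s) (∫ y in c..x t, pt φ y t) t := by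
    refine (intervalIntegral.hasDerivAt_integral_of_dominated_loc_of_deriv_le (s := Set.univ)
      (bound := fun _ => K) (F := fun s y => φ y s) (F' := fun s y => pt φ y s)
      univ_mem ?_ ?_ ?_ ?_ ?_ ?_).2
    · exact Eventually.of_forall fun s => (h.cont1 s).aestronglyMeasurable
    · exact (h.cont1 t).intervalIntegrable _ _
    · exact (h.pt_cont1 t).aestronglyMeasurable
    · exact ae_of_all _ fun y _ s _ => h.pt_bd y s
    · simp
    · exact ae_of_all _ fun y _ s _ => h.pt_has y s
  refine (h1.hasDerivWithinAt.add (h.leib0 hx)).congr_of_eventuallyEq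
    (Eventually.of_forall fun s => ?_) ?_
  · exact (intervalIntegral.integral_add_adjacent_intervals ((h.cont1 s).intervalIntegrable _ _)
      ((h.cont1 s).intervalIntegrable _ _)).symm
  · simp

end Test

lemma abs_right {f : ℝ → ℝ} {u t : ℝ} (hf : HasDerivWithinAt f u (Set.Ici t) t) :
    ∃ σ : ℝ, (σ = 1 ∨ σ = -1) ∧ σ * f t = |f t| ∧
      HasDerivWithinAt (fun s => |f s|) (σ * u) (Set.Ici t) t := by
  rcases lt_trichotomy (f t) 0 with h | h | h
  · refine ⟨-1, Or.inr rfl, by rw [abs_of_neg h]; ring, ?_⟩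
    rw [neg_one_mul]
    refine hf.neg.congr_of_eventuallyEq ?_ (abs_of_neg h)
    filter_upwards [hf.continuousWithinAt.eventually (gt_mem_nhds h)] with s hs
    exact abs_of_neg hs
  · have key : HasDerivWithinAt (fun s => |f s|) |u| (Set.Ici t) t := by
      rw [hasDerivWithinAt_iff_isLittleO] at hf ⊢
      refine Asymptotics.IsBigO.trans_isLittleO (Asymptotics.IsBigO.of_bound 1 ?_) hf
      filter_upwards [self_mem_nhdsWithin] with s hs
      have hs : 0 ≤ s - t := sub_nonneg.2 hs
      simp only [h, abs_zero, sub_zero, smul_eq_mul, one_mul, Real.norm_eq_abs]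
      have := abs_abs_sub_abs_le_abs_sub (f s) ((s - t) * u)
      rwa [abs_mul, abs_of_nonneg hs] at this
    rcases le_total 0 u with hu | hu
    · exact ⟨1, Or.inl rfl, by simp [h], by rw [one_mul]; rwa [abs_of_nonneg hu] at key⟩
    · exact ⟨-1, Or.inr rfl, by simp [h], by rw [neg_one_mul]; rwa [abs_of_nonpos hu] at key⟩
  · refine ⟨1, Or.inl rfl, by rw [abs_of_pos h]; ring, ?_⟩
    rw [one_mul]
    refine hf.congr_of_eventuallyEq ?_ (abs_of_pos h)
    filter_upwards [hf.continuousWithinAt.eventually (lt_mem_nhds h)] with s hs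
    exact abs_of_pos hs

/-- The entropy flux, in a form which is manifestly continuous. -/
noncomputable def Qf (v : ℝ → ℝ) (k r : ℝ) : ℝ := |r - k| * v r - k * |v r - v k|

lemma Qf_sigma {v : ℝ → ℝ} (hva : Antitone v) {k r σ : ℝ} (hσ : σ = 1 ∨ σ = -1)
    (h : σ * (r - k) = |r - k|) :
    σ * (v r - v k) = -|v r - v k| ∧ Qf v k r = σ * (r * v r - k * v k) := by
  have h1 : σ * (v r - v k) = -|v r - v k| := by
    rcases lt_trichotomy r k with h' | h' | h'
    · rw [abs_of_neg (by linarith)] at h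
      have : σ = -1 := by
        rcases hσ with h'' | h''
        · rw [h''] at h; linarith
        · exact h''
      rw [this, abs_of_nonneg (sub_nonneg.2 (hva h'.le))]; ring
    · simp [h']
    · rw [abs_of_pos (by linarith)] at h
      have : σ = 1 := by
        rcases hσ with h'' | h''
        · exact h''
        · rw [h''] at h; linarith
      rw [this, abs_of_nonpos (sub_nonpos.2 (hva h'.le))]; ring
  refine ⟨h1, ?_⟩
  unfold Qf
  rw [← h]
  have : |v r - v k| = -(σ * (v r - v k)) := by linarith
  rw [this]; ring

lemma Qf_sign {v : ℝ → ℝ} (hva : Antitone v) (k r : ℝ) :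
    Real.sign (r - k) * (r * v r - k * v k) = Qf v k r := by
  rcases lt_trichotomy r k with h | h | h
  · rw [Real.sign_of_neg (by linarith)]
    exact (Qf_sigma hva (Or.inr rfl) (by rw [abs_of_neg (by linarith)]; ring)).2.symm
  · simp [Qf, h]
  · rw [Real.sign_of_pos (by linarith)]
    exact (Qf_sigma hva (Or.inl rfl) (by rw [abs_of_pos (by linarith)]; ring)).2.symm

lemma Qf_zero {v : ℝ → ℝ} (hva : Antitone v) {k : ℝ} (hk : 0 ≤ k) : Qf v k 0 = k * v k := by
  have := hva hk
  unfold Qf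
  rw [zero_sub, abs_neg, abs_of_nonneg hk, abs_of_nonneg (by linarith)]; ring

/-- Pointwise estimate of one summand. `m` is the mean of the test function on the cell. -/
lemma cell_ineq {σ r k va vb vk ea eb fa fb m Φ K l : ℝ} (hσ : σ = 1 ∨ σ = -1)
    (hk : 0 ≤ k) (hr : 0 ≤ r) (hs : σ * (r - k) = |r - k|)
    (hw : σ * (va - vk) = -|va - vk|) (hfa : 0 ≤ fa) (hfb : 0 ≤ fb) (hfaΦ : fa ≤ Φ) (hfbΦ : fb ≤ Φ)
    (hK1 : r * |fb - m| ≤ K * l) (hK2 : r * |fb - fa| ≤ K * l) :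
    σ * (-(r * m * ((vb + eb) - (va + ea)))) + (|r - k| - k) * (fb * (vb + eb) - fa * (va + ea))
      - (σ * (r * va - k * vk) - k * vk) * (fb - fa) ≤
    K * l * (|vb - va| + |eb| + 2 * |ea|) + 2 * k * Φ * (|eb| + |ea|)
      + (k * fb * (|vb - vk| - (vb - vk)) - k * fa * (|va - vk| - (va - vk))) := by
  have hσa : |σ| = 1 := by rcases hσ with h | h <;> simp [h]
  have e : σ * (-(r * m * ((vb + eb) - (va + ea)))) + (|r - k| - k) * (fb * (vb + eb) - fa * (va + ea))
      - (σ * (r * va - k * vk) - k * vk) * (fb - fa) =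
      σ * (r * (fb - m) * ((vb - va) + eb - ea)) + σ * (r * (fb - fa) * ea)
      - k * (σ + 1) * (fb * eb) + k * (σ + 1) * (fa * ea)
      - k * fb * (σ * (vb - vk) + (vb - vk)) + k * fa * (σ * (va - vk) + (va - vk)) := by
    rw [← hs]; ring
  rw [e, hw]
  have t1 : σ * (r * (fb - m) * ((vb - va) + eb - ea)) ≤ K * l * (|vb - va| + |eb| + |ea|) := by
    refine (le_abs_self _).trans ?_
    rw [abs_mul, hσa, one_mul, abs_mul, abs_mul, abs_of_nonneg hr]
    refine mul_le_mul hK1 ?_ (abs_nonneg _) (le_trans (by positivity) hK1)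
    exact (abs_sub _ _).trans (add_le_add (abs_add_le _ _) le_rfl)
  have t2 : σ * (r * (fb - fa) * ea) ≤ K * l * |ea| := by
    refine (le_abs_self _).trans ?_
    rw [abs_mul, hσa, one_mul, abs_mul, abs_mul, abs_of_nonneg hr]
    exact mul_le_mul_of_nonneg_right hK2 (abs_nonneg _)
  have hΦ : 0 ≤ Φ := hfa.trans hfaΦ
  have aux : ∀ s f e : ℝ, |s| ≤ 2 → 0 ≤ f → f ≤ Φ → k * s * (f * e) ≤ 2 * k * Φ * |e| := by
    intro s f e hs hf hfΦ
    refine (le_abs_self _).trans ?_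
    rw [abs_mul, abs_mul, abs_mul, abs_of_nonneg hk, abs_of_nonneg hf]
    calc k * |s| * (f * |e|) ≤ k * 2 * (Φ * |e|) := by gcongr
      _ = _ := by ring
  have h2 : |σ + 1| ≤ 2 := by rcases hσ with h | h <;> norm_num [h]
  have t3 := aux (-(σ + 1)) fb eb (by rwa [abs_neg]) hfb hfbΦ
  have t4 := aux (σ + 1) fa ea h2 hfa hfaΦ
  have t5 : -(k * fb * (σ * (vb - vk))) ≤ k * fb * |vb - vk| := by
    have h3 : -(σ * (vb - vk)) ≤ |vb - vk| := by
      have := neg_le_abs (σ * (vb - vk))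
      rwa [abs_mul, hσa, one_mul] at this
    have := mul_le_mul_of_nonneg_left h3 (mul_nonneg hk hfb)
    linarith
  linarith

lemma Cfg.comp_eq {R C A B l : ℝ} {N : ℕ} {X : ℕ → ℝ} (h : Cfg R C A B l N X)
    (H : ℝ → ℝ → ℝ) (y : ℝ) :
    H (dens N l X y) y = H 0 y + ∑ i ∈ Finset.range N, Set.indicator (Set.Ico (X i) (X (i+1)))
      (fun z => H (rr N l X i) z - H 0 z) y := by
  by_cases hy : y < X 0 ∨ X N ≤ y
  · rw [h.dens_zero hy, Finset.sum_eq_zero, add_zero]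
    intro i hi
    have hi := Finset.mem_range.1 hi
    apply Set.indicator_of_notMem
    intro hc
    rcases hy with h' | h'
    · linarith [hc.1, h.le (Nat.zero_le i) hi.le]
    · linarith [hc.2, h.le (show i + 1 ≤ N from hi) le_rfl]
  · push Not at hy
    obtain ⟨i, hi, hc⟩ := h.cell hy.1 hy.2
    rw [h.dens_eq hi hc, Finset.sum_eq_single i, Set.indicator_of_mem hc]
    · ring
    · intro j hj hji
      have hj := Finset.mem_range.1 hj
      apply Set.indicator_of_notMem
      intro hc'
      rcases lt_or_gt_of_ne hji with h' | h'
      · linarith [hc'.2, hc.1, h.le (show j + 1 ≤ i from h') hi.le]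
      · linarith [hc'.1, hc.2, h.le (show i + 1 ≤ j from h') hj.le]
    · intro h'; exact absurd (Finset.mem_range.2 hi) h'

lemma Cfg.comp_integral {R C A B l : ℝ} {N : ℕ} {X : ℕ → ℝ} (h : Cfg R C A B l N X)
    (H : ℝ → ℝ → ℝ) (hH : ∀ c, Integrable (H c)) :
    ∫ y, H (dens N l X y) y = (∫ y, H 0 y) + ∑ i ∈ Finset.range N,
      ∫ y in X i..X (i+1), (H (rr N l X i) y - H 0 y) := by
  simp_rw [h.comp_eq H]
  have hI : ∀ i ∈ Finset.range N, Integrable (Set.indicator (Set.Ico (X i) (X (i+1)))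
      (fun z => H (rr N l X i) z - H 0 z)) :=
    fun i _ => ((hH _).sub (hH 0)).indicator measurableSet_Ico
  rw [integral_add (hH 0) (integrable_finsetSum _ hI), integral_finsetSum _ hI]
  congr 1
  refine Finset.sum_congr rfl fun i hi => ?_
  rw [integral_indicator measurableSet_Ico, integral_Ico_eq_integral_Ioc,
    intervalIntegral.integral_of_le (h.mono i (Finset.mem_range.1 hi)).le]

section
variable {φ : ℝ → ℝ → ℝ} {T a b Φ K : ℝ} {v : ℝ → ℝ} {R C A B ω l k Lv : ℝ} {N : ℕ} {x u : ℕ → ℝ → ℝ}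

lemma Test.full (h : Test φ T a b Φ K) (t : ℝ) : ∫ y, φ y t = ∫ y in a..b, φ y t := by
  symm
  apply intervalIntegral.integral_eq_integral_of_support_subset
  intro y hy
  by_contra hc
  exact hy (h.supp y t fun h' => hc ⟨h'.1, h'.2.le⟩)

lemma Test.pt_full (h : Test φ T a b Φ K) (t : ℝ) : ∫ y, pt φ y t = ∫ y in a..b, pt φ y t := by
  rw [intervalIntegral.integral_of_le h.ab.le, ← integral_Icc_eq_integral_Ioc]
  symm
  apply setIntegral_eq_integral_of_forall_compl_eq_zero
  intro y hy
  exact h.pt_supp t hy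

lemma Test.px_full (h : Test φ T a b Φ K) (t : ℝ) : ∫ y, px φ y t = 0 := by
  have : ∫ y, px φ y t = ∫ y in a..b, px φ y t := by
    rw [intervalIntegral.integral_of_le h.ab.le, ← integral_Icc_eq_integral_Ioc]
    symm
    apply setIntegral_eq_integral_of_forall_compl_eq_zero
    intro y hy
    exact h.px_supp t hy
  rw [this, intervalIntegral.integral_eq_sub_of_hasDerivAt (fun y _ => h.px_has y t)
    ((h.px_cont1 t).intervalIntegrable _ _), h.supp _ _ (by simp), h.supp _ _ (by simp), sub_zero]

/-- The entropy functional along the trajectory. -/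
noncomputable def Jf (φ : ℝ → ℝ → ℝ) (a b k l : ℝ) (N : ℕ) (x : ℕ → ℝ → ℝ) (t : ℝ) : ℝ :=
  k * (∫ y in a..b, φ y t) + ∑ i ∈ Finset.range N,
    (|rr N l (fun j => x j t) i - k| - k) *
      ((∫ y in a..x (i+1) t, φ y t) - ∫ y in a..x i t, φ y t)

noncomputable def gf (φ : ℝ → ℝ → ℝ) (v : ℝ → ℝ) (a b k l : ℝ) (N : ℕ) (x : ℕ → ℝ → ℝ) (t : ℝ) : ℝ :=
  k * (∫ y in a..b, pt φ y t) + ∑ i ∈ Finset.range N,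
    ((|rr N l (fun j => x j t) i - k| - k) *
      ((∫ y in a..x (i+1) t, pt φ y t) - ∫ y in a..x i t, pt φ y t) +
     (Qf v k (rr N l (fun j => x j t) i) - k * v k) * (φ (x (i+1) t) t - φ (x i t) t))

lemma Jf_eq (hφ : Test φ T a b Φ K) (hx : Traj v R T C A B ω l N x u) (hk : 0 ≤ k) {t : ℝ}
    (ht : t ∈ Set.Icc 0 T) :
    ∫ y, |dens N l (fun j => x j t) y - k| * φ y t = Jf φ a b k l N x t := by
  have hI := hφ.int0 t
  have := (hx.cfg ht).comp_integral (fun c y => |c - k| * φ y t) (fun c => hI.const_mul _)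
  rw [this, Jf]
  simp only [zero_sub, abs_neg, abs_of_nonneg hk]
  rw [integral_const_mul, hφ.full]
  congr 1
  refine Finset.sum_congr rfl fun i _ => ?_
  rw [intervalIntegral.integral_interval_sub_left hI.intervalIntegrable hI.intervalIntegrable,
    ← intervalIntegral.integral_const_mul]
  refine intervalIntegral.integral_congr fun y _ => ?_
  ring

lemma gf_eq (hva : Antitone v) (hφ : Test φ T a b Φ K) (hx : Traj v R T C A B ω l N x u) (hk : 0 ≤ k) {t : ℝ}
    (ht : t ∈ Set.Icc 0 T) :
    ∫ y, (|dens N l (fun j => x j t) y - k| * pt φ y t +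
      Qf v k (dens N l (fun j => x j t) y) * px φ y t) = gf φ v a b k l N x t := by
  have hI := hφ.pt_int t
  have hI' := hφ.px_int t
  have := (hx.cfg ht).comp_integral (fun c y => |c - k| * pt φ y t + Qf v k c * px φ y t)
    (fun c => (hI.const_mul _).add (hI'.const_mul _))
  rw [this, gf]
  simp only [zero_sub, abs_neg, abs_of_nonneg hk, Qf_zero hva hk]
  rw [integral_add (hI.const_mul _) (hI'.const_mul _), integral_const_mul, integral_const_mul,
    hφ.pt_full, hφ.px_full, mul_zero, add_zero]
  congr 1
  refine Finset.sum_congr rfl fun i _ => ?_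
  rw [intervalIntegral.integral_interval_sub_left hI.intervalIntegrable hI.intervalIntegrable,
    ← intervalIntegral.integral_const_mul,
    ← intervalIntegral.integral_eq_sub_of_hasDerivAt (fun y _ => hφ.px_has y t)
      hI'.intervalIntegrable, ← intervalIntegral.integral_const_mul,
      ← intervalIntegral.integral_add (hI.intervalIntegrable.const_mul _) (hI'.intervalIntegrable.const_mul _)]
  refine intervalIntegral.integral_congr fun y _ => ?_
  ring

lemma Jf_contOn (hφ : Test φ T a b Φ K) (hx : Traj v R T C A B ω l N x u) :
    ContinuousOn (Jf φ a b k l N x) (Set.Icc 0 T) := by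
  have hr : ∀ i < N, ContinuousOn (fun t => rr N l (fun j => x j t) i) (Set.Icc 0 T) := by
    intro i hi
    simp only [rr, hi, if_true]
    exact continuousOn_const.div ((hx.cont (i+1)).sub (hx.cont i)).continuousOn
      fun t ht => (sub_pos.2 (hx.mono t ht i hi)).ne'
  have hP : ∀ z : ℝ → ℝ, Continuous z → Continuous fun t => ∫ y in a..z t, φ y t := fun z hz =>
    intervalIntegral.continuous_parametric_intervalIntegral_of_continuous
      (f := fun t y => φ y t) hφ.cont' hz
  unfold Jf
  refine (((hP _ continuous_const).const_mul k).continuousOn).add ?_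
  refine continuousOn_finsetSum _ fun i hi => ?_
  exact (((hr i (Finset.mem_range.1 hi)).sub continuousOn_const).abs.sub continuousOn_const).mul
    ((hP _ (hx.cont _)).sub (hP _ (hx.cont _))).continuousOn

lemma gf_contOn (hvc : Continuous v) (hφ : Test φ T a b Φ K) (hx : Traj v R T C A B ω l N x u) :
    ContinuousOn (gf φ v a b k l N x) (Set.Icc 0 T) := by
  have hr : ∀ i < N, ContinuousOn (fun t => rr N l (fun j => x j t) i) (Set.Icc 0 T) := by
    intro i hi
    simp only [rr, hi, if_true]
    exact continuousOn_const.div ((hx.cont (i+1)).sub (hx.cont i)).continuousOn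
      fun t ht => (sub_pos.2 (hx.mono t ht i hi)).ne'
  have hP : ∀ z : ℝ → ℝ, Continuous z → Continuous fun t => ∫ y in a..z t, pt φ y t := fun z hz =>
    intervalIntegral.continuous_parametric_intervalIntegral_of_continuous
      (f := fun t y => pt φ y t) (hφ.pt_cont.comp continuous_swap) hz
  have hφc : ∀ i, Continuous fun t => φ (x i t) t := fun i =>
    hφ.cont.comp ((hx.cont i).prodMk continuous_id)
  have hQ : Continuous (Qf v k) := by unfold Qf; fun_prop
  unfold gf
  refine (((hP _ continuous_const).const_mul k).continuousOn).add ?_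
  refine continuousOn_finsetSum _ fun i hi => ?_
  refine ContinuousOn.add ?_ ?_
  · exact (((hr i (Finset.mem_range.1 hi)).sub continuousOn_const).abs.sub continuousOn_const).mul
      ((hP _ (hx.cont _)).sub (hP _ (hx.cont _))).continuousOn
  · exact ((hQ.comp_continuousOn (hr i (Finset.mem_range.1 hi))).sub continuousOn_const).mul
      ((hφc _).sub (hφc _)).continuousOn

/-- the error in the entropy inequality -/
noncomputable def entErr (R C ω l Lv Φ K : ℝ) : ℝ := K * l * (Lv * C + 3 * ω) + 4 * R * Φ * ω

lemma Jf_der (hva : Antitone v) (hvl : ∀ p q, |v p - v q| ≤ Lv * |p - q|) (hLv : 0 ≤ Lv)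
    (hφ : Test φ T a b Φ K) (hx : Traj v R T C A B ω l N x u) (hk : k ∈ Set.Icc 0 R) {t : ℝ}
    (ht : t ∈ Set.Ico 0 T) :
    ∃ J', HasDerivWithinAt (Jf φ a b k l N x) J' (Set.Ici t) t ∧
      J' ≤ gf φ v a b k l N x t + entErr R C ω l Lv Φ K := by
  have htI : t ∈ Set.Icc 0 T := Set.Ico_subset_Icc_self ht
  have hc := hx.cfg htI
  set r := rr N l (fun j => x j t) with hr
  have hsig : ∀ i, ∃ σ : ℝ, i < N → ((σ = 1 ∨ σ = -1) ∧ σ * (r i - k) = |r i - k| ∧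
      HasDerivWithinAt (fun s => |rr N l (fun j => x j s) i - k|)
        (σ * (-(r i * (r i / l) * (u (i+1) t - u i t)))) (Set.Ici t) t) := by
    intro i
    by_cases hi : i < N
    · have hd : HasDerivWithinAt (fun s => rr N l (fun j => x j s) i - k)
          (-(r i * (r i / l) * (u (i+1) t - u i t))) (Set.Ici t) t := by
        have hne := (sub_pos.2 (hc.mono i hi)).ne'
        have h1 := ((hasDerivWithinAt_const t (Set.Ici t) l).div
          ((hx.der (i+1) (by omega) t ht).sub (hx.der i hi.le t ht)) hne).sub_const k
        have hl := hx.hl.ne'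
        have e : -(r i * (r i / l) * (u (i+1) t - u i t)) =
          (0 * ((x (i+1) - x i) t) - l * (u (i+1) t - u i t)) / ((x (i+1) - x i) t)^2 := by
          simp only [hr, rr, hi, if_true, Pi.sub_apply]
          field_simp
          ring
        rw [e]
        refine h1.congr_of_eventuallyEq (Eventually.of_forall fun s => ?_) ?_
        · simp [rr, hi]
        · simp [rr, hi]
      obtain ⟨σ, h1, h2, h3⟩ := abs_right hd
      exact ⟨σ, fun _ => ⟨h1, h2, h3⟩⟩
    · exact ⟨0, fun h => absurd h hi⟩
  choose σ hσ using hsig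
  set P : ℕ → ℝ := fun i => ∫ y in a..x i t, φ y t with hP
  set Pt : ℕ → ℝ := fun i => ∫ y in a..x i t, pt φ y t with hPt
  set f : ℕ → ℝ := fun i => φ (x i t) t with hf
  have hPder : ∀ i ≤ N, HasDerivWithinAt (fun s => ∫ y in a..x i s, φ y s)
      (Pt i + f i * u i t) (Set.Ici t) t := fun i hi => hφ.leib a (hx.der i hi t ht)
  have h0 : HasDerivWithinAt (fun s => ∫ y in a..b, φ y s) (∫ y in a..b, pt φ y t) (Set.Ici t) t := by
    have := hφ.leib a (hasDerivWithinAt_const t (Set.Ici t) b)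
    simpa using this
  set D : ℕ → ℝ := fun i => (σ i * (-(r i * (r i / l) * (u (i+1) t - u i t)))) * (P (i+1) - P i) +
    (|r i - k| - k) * ((Pt (i+1) + f (i+1) * u (i+1) t) - (Pt i + f i * u i t)) with hD
  refine ⟨k * (∫ y in a..b, pt φ y t) + ∑ i ∈ Finset.range N, D i, ?_, ?_⟩
  · have hs : HasDerivWithinAt (fun s => ∑ i ∈ Finset.range N,
      (|rr N l (fun j => x j s) i - k| - k) *
      ((∫ y in a..x (i+1) s, φ y s) - ∫ y in a..x i s, φ y s)) (∑ i ∈ Finset.range N, D i)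
        (Set.Ici t) t := by
      refine HasDerivWithinAt.fun_sum fun i hi => ?_
      have hi := Finset.mem_range.1 hi
      exact ((hσ i hi).2.2.sub_const k).mul ((hPder (i+1) hi).sub (hPder i hi.le))
    exact (h0.const_mul k).add hs
  · set w : ℕ → ℝ := fun i => v (r i) - v k with hw
    set e : ℕ → ℝ := fun i => u i t - v (r i) with he
    have hue : ∀ i, u i t = v (r i) + e i := fun i => by simp [he]
    have hl := hx.hl
    have key : ∀ i ∈ Finset.range N, D i ≤
        ((|r i - k| - k) * (Pt (i+1) - Pt i) + (Qf v k (r i) - k * v k) * (f (i+1) - f i)) +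
        (K * l * (Lv * |r (i+1) - r i| + |e (i+1)| + 2 * |e i|) + 2 * k * Φ * (|e (i+1)| + |e i|)
        + (k * f (i+1) * (|w (i+1)| - w (i+1)) - k * f i * (|w i| - w i))) := by
      intro i hi
      have hi := Finset.mem_range.1 hi
      obtain ⟨h1, h2, -⟩ := hσ i hi
      obtain ⟨h3, h4⟩ := Qf_sigma hva h1 h2
      have hr0 : 0 ≤ r i := hc.rr_nonneg i
      have hΔ := sub_pos.2 (hc.mono i hi)
      have hrm : r i * (x (i+1) t - x i t) = l := hc.rr_mul hi
      have hm : r i * |f (i+1) - (r i / l) * (P (i+1) - P i)| ≤ K * l := by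
        have e1 : f (i+1) - (r i / l) * (P (i+1) - P i) =
            (r i / l) * ∫ y in x i t..x (i+1) t, (f (i+1) - φ y t) := by
          rw [intervalIntegral.integral_sub (by simp) ((hφ.cont1 t).intervalIntegrable _ _),
            ← intervalIntegral.integral_interval_sub_left ((hφ.cont1 t).intervalIntegrable a _)
              ((hφ.cont1 t).intervalIntegrable a _)]
          simp only [intervalIntegral.integral_const, smul_eq_mul]
          have e3 : r i / l * ((x (i+1) t - x i t) * f (i+1) - (P (i+1) - P i)) =
              (r i * (x (i+1) t - x i t)) / l * f (i+1) - r i / l * (P (i+1) - P i) := by ring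
          rw [hrm, div_self hl.ne', one_mul] at e3
          exact e3.symm
        have e2 : |∫ y in x i t..x (i+1) t, (f (i+1) - φ y t)| ≤
            (K * (x (i+1) t - x i t)) * |x (i+1) t - x i t| := by
          rw [← Real.norm_eq_abs]
          refine intervalIntegral.norm_integral_le_of_norm_le_const fun y hy => ?_
          refine (hφ.lip _ _ _ _).trans (mul_le_mul_of_nonneg_left ?_ hφ.K0)
          rw [Set.uIoc_of_le (hc.mono i hi).le] at hy
          rw [sub_self, abs_zero, add_zero, abs_of_nonneg (by linarith [hy.2])]
          linarith [hy.1]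
        rw [abs_of_pos hΔ] at e2
        rw [e1, abs_mul, abs_of_nonneg (div_nonneg hr0 hl.le)]
        calc r i * (r i / l * _) ≤ r i * (r i / l * ((K * (x (i+1) t - x i t)) * (x (i+1) t - x i t))) := by
              gcongr
          _ = K * (r i * (x (i+1) t - x i t))^2 / l := by ring
          _ = K * l := by rw [hrm]; field_simp
      have hm2 : r i * |f (i+1) - f i| ≤ K * l := by
        have := hφ.lip (x (i+1) t) (x i t) t t
        rw [sub_self, abs_zero, add_zero, abs_of_pos hΔ] at this
        calc r i * |f (i+1) - f i| ≤ r i * (K * (x (i+1) t - x i t)) := by gcongr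
          _ = K * (r i * (x (i+1) t - x i t)) := by ring
          _ = K * l := by rw [hrm]
      have hci := cell_ineq (vb := v (r (i+1))) (ea := e i) (eb := e (i+1)) h1 hk.1 hr0 h2 h3
        (hφ.nonneg (x i t) t) (hφ.nonneg (x (i+1) t) t) (hφ.bound (x i t) t) (hφ.bound (x (i+1) t) t)
        hm hm2
      have hv1 : K * l * |v (r (i+1)) - v (r i)| ≤ K * l * (Lv * |r (i+1) - r i|) :=
        mul_le_mul_of_nonneg_left (hvl _ _) (mul_nonneg hφ.K0 hl.le)
      have eD : D i = (|r i - k| - k) * (Pt (i+1) - Pt i) +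
        (σ i * (-(r i * ((r i / l) * (P (i+1) - P i)) * ((v (r (i+1)) + e (i+1)) - (v (r i) + e i)))) +
        (|r i - k| - k) * (f (i+1) * (v (r (i+1)) + e (i+1)) - f i * (v (r i) + e i))) := by
        simp only [hD, hue]; ring
      rw [eD, h4]
      linarith
    have hsum := Finset.sum_le_sum key
    have hsum2 : ∑ i ∈ Finset.range N, D i ≤
        ∑ i ∈ Finset.range N,
          ((|r i - k| - k) * (Pt (i+1) - Pt i) + (Qf v k (r i) - k * v k) * (f (i+1) - f i)) +
        ∑ i ∈ Finset.range N, (K * l * (Lv * |r (i+1) - r i| + |e (i+1)| + 2 * |e i|)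
        + 2 * k * Φ * (|e (i+1)| + |e i|)
        + (k * f (i+1) * (|w (i+1)| - w (i+1)) - k * f i * (|w i| - w i))) :=
      hsum.trans Finset.sum_add_distrib.le
    have herr : ∑ i ∈ Finset.range N, (K * l * (Lv * |r (i+1) - r i| + |e (i+1)| + 2 * |e i|)
        + 2 * k * Φ * (|e (i+1)| + |e i|)
        + (k * f (i+1) * (|w (i+1)| - w (i+1)) - k * f i * (|w i| - w i))) ≤
        entErr R C ω l Lv Φ K := by
      have hE := hx.err t ht
      have hE0 : ∑ i ∈ Finset.range N, |e i| ≤ ω := by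
        refine le_trans ?_ hE
        rw [Finset.sum_range_succ]
        have : 0 ≤ |u N t - v (rr N l (fun j => x j t) N)| := abs_nonneg _
        linarith
      have hE1 : ∑ i ∈ Finset.range N, |e (i+1)| ≤ ω := by
        refine le_trans ?_ hE
        rw [Finset.sum_range_succ']
        have : 0 ≤ |u 0 t - v (rr N l (fun j => x j t) 0)| := abs_nonneg _
        linarith
      have htv : ∑ i ∈ Finset.range N, |r (i+1) - r i| ≤ C := hc.tv
      rw [Finset.sum_add_distrib, Finset.sum_range_sub (fun i => k * f i * (|w i| - w i)),
        Finset.sum_add_distrib, ← Finset.mul_sum, ← Finset.mul_sum, Finset.sum_add_distrib,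
        Finset.sum_add_distrib, Finset.sum_add_distrib, ← Finset.mul_sum, ← Finset.mul_sum]
      have hwN : |w N| - w N = 0 := by
        have : r N = 0 := by simp [hr, rr]
        have : 0 ≤ w N := by simp only [hw, this]; linarith [hva hk.1]
        rw [abs_of_nonneg this, sub_self]
      have hw0 : 0 ≤ k * f 0 * (|w 0| - w 0) :=
        mul_nonneg (mul_nonneg hk.1 (hφ.nonneg _ _)) (sub_nonneg.2 (le_abs_self _))
      rw [hwN, mul_zero]
      have hΦ : 0 ≤ Φ := (hφ.nonneg 0 0).trans (hφ.bound 0 0)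
      have hω : 0 ≤ ω := (Finset.sum_nonneg fun i _ => abs_nonneg _).trans hE0
      have p1 : K * l * (Lv * ∑ i ∈ Finset.range N, |r (i+1) - r i| + ∑ i ∈ Finset.range N, |e (i+1)|
          + 2 * ∑ i ∈ Finset.range N, |e i|) ≤ K * l * (Lv * C + 3 * ω) := by
        refine mul_le_mul_of_nonneg_left ?_ (mul_nonneg hφ.K0 hl.le)
        have := mul_le_mul_of_nonneg_left htv hLv
        linarith
      have p2 : 2 * k * Φ * (∑ i ∈ Finset.range N, |e (i+1)| + ∑ i ∈ Finset.range N, |e i|) ≤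
          4 * R * Φ * ω := by
        have hk1 := hk.1
        calc 2 * k * Φ * (∑ i ∈ Finset.range N, |e (i+1)| + ∑ i ∈ Finset.range N, |e i|)
            ≤ 2 * R * Φ * (ω + ω) := by
              have hk2 := hk.2
              have : 0 ≤ R := hk1.trans hk2
              gcongr
          _ = _ := by ring
      unfold entErr
      linarith
    have hgf : gf φ v a b k l N x t = k * (∫ y in a..b, pt φ y t) + ∑ i ∈ Finset.range N,
          ((|r i - k| - k) * (Pt (i+1) - Pt i) + (Qf v k (r i) - k * v k) * (f (i+1) - f i)) := rfl
    rw [hgf]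
    linarith

theorem traj_entropy (hT : 0 < T) (hva : Antitone v) (hvl : ∀ p q, |v p - v q| ≤ Lv * |p - q|) (hLv : 0 ≤ Lv)
    (hvc : Continuous v)
    (hφ : Test φ T a b Φ K) (hx : Traj v R T C A B ω l N x u) (hk : k ∈ Set.Icc 0 R) :
    0 ≤ (∫ t in (0:ℝ)..T, ∫ y, (|dens N l (fun j => x j t) y - k| * pt φ y t +
      Qf v k (dens N l (fun j => x j t) y) * px φ y t)) +
      (∫ y, |dens N l (fun j => x j 0) y - k| * φ y 0) + entErr R C ω l Lv Φ K * T := by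
  have h0 : (0:ℝ) ∈ Set.Icc 0 T := ⟨le_rfl, hT.le⟩
  have hTT : T ∈ Set.Icc 0 T := ⟨hT.le, le_rfl⟩
  rw [Jf_eq hφ hx hk.1 h0]
  have e1 : ∫ t in (0:ℝ)..T, ∫ y, (|dens N l (fun j => x j t) y - k| * pt φ y t +
      Qf v k (dens N l (fun j => x j t) y) * px φ y t) = ∫ t in (0:ℝ)..T, gf φ v a b k l N x t := by
    refine intervalIntegral.integral_congr fun t ht => ?_
    rw [Set.uIcc_of_le hT.le] at ht
    exact gf_eq hva hφ hx hk.1 ht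
  rw [e1]
  set g : ℝ → ℝ := fun t => gf φ v a b k l N x (max 0 (min T t)) with hg
  have hgc : Continuous g := (gf_contOn hvc hφ hx).comp_continuous (by fun_prop)
    fun t => ⟨le_max_left _ _, max_le hT.le (min_le_left _ _)⟩
  have hge : ∀ t ∈ Set.Icc 0 T, g t = gf φ v a b k l N x t := by
    intro t ht; simp only [hg]; rw [min_eq_right ht.2, max_eq_right ht.1]
  have e2 : ∫ t in (0:ℝ)..T, gf φ v a b k l N x t = ∫ t in (0:ℝ)..T, g t := by
    refine intervalIntegral.integral_congr fun t ht => ?_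
    rw [Set.uIcc_of_le hT.le] at ht
    exact (hge t ht).symm
  rw [e2]
  have hJ : ∀ t ∈ Set.Ico 0 T, ∃ J', HasDerivWithinAt (Jf φ a b k l N x) J' (Set.Ici t) t ∧
      J' ≤ gf φ v a b k l N x t + entErr R C ω l Lv Φ K := fun t ht => Jf_der hva hvl hLv hφ hx hk ht
  have hgd : ∀ t, HasDerivAt (fun s => ∫ z in (0:ℝ)..s, g z) (g t) t := fun t =>
    intervalIntegral.integral_hasDerivAt_right (hgc.intervalIntegrable _ _)
      (hgc.stronglyMeasurableAtFilter _ _) hgc.continuousAt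
  set err := entErr R C ω l Lv Φ K
  choose! J' hJ1 hJ2 using hJ
  have hBd : ∀ t, HasDerivAt (fun s => Jf φ a b k l N x 0 + (∫ z in (0:ℝ)..s, g z) + err * s)
      (g t + err) t := by
    intro t
    have := ((hgd t).const_add (Jf φ a b k l N x 0)).add ((hasDerivAt_id t).const_mul err)
    rw [mul_one] at this
    exact this
  have := image_le_of_deriv_right_le_deriv_boundary (Jf_contOn hφ hx) hJ1
    (B := fun s => Jf φ a b k l N x 0 + (∫ z in (0:ℝ)..s, g z) + err * s) (B' := fun t => g t + err)
    (by simp) (fun t _ => (hBd t).continuousAt.continuousWithinAt)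
    (fun t _ => (hBd t).hasDerivWithinAt)
    (fun t ht => by rw [hge t (Set.Ico_subset_Icc_self ht)]; exact hJ2 t ht) hTT
  have hJT : Jf φ a b k l N x T = 0 := by
    rw [← Jf_eq hφ hx hk.1 hTT]
    simp [hφ.fin _ T le_rfl]
  rw [hJT] at this
  linarith

end

lemma clamp_lip (R p q : ℝ) : |max 0 (min R p) - max 0 (min R q)| ≤ |p - q| := by
  have h1 := abs_max_sub_max_le_max 0 (min R p) 0 (min R q)
  have h2 := abs_min_sub_min_le_max R p R q
  simp only [sub_self, abs_zero] at h1 h2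
  rw [max_eq_right (abs_nonneg _)] at h2
  rw [max_eq_right (abs_nonneg (min R p - min R q))] at h1
  exact h1.trans h2

lemma v_global {v : ℝ → ℝ} {R Lv : ℝ} (hR : 0 < R) (hv : ContDiffOn ℝ 1 v (Set.Icc 0 R))
    (hv' : ∀ ρ' ∈ Set.Icc (0 : ℝ) R, derivWithin v (Set.Icc 0 R) ρ' < 0)
    (hvleft : ∀ ρ' < (0 : ℝ), v ρ' = v 0)
    (hvright : ∀ ρ', R < ρ' → v ρ' = v R)
    (hLv : ∀ a ∈ Set.Icc (0 : ℝ) R, ∀ b ∈ Set.Icc (0 : ℝ) R, |v a - v b| ≤ Lv * |a - b|) :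
    Antitone v ∧ (∀ p q, |v p - v q| ≤ Lv * |p - q|) ∧ 0 ≤ Lv ∧ (∃ V, 0 ≤ V ∧ ∀ p, |v p| ≤ V) ∧
      Continuous v := by
  have hclamp : ∀ p, v p = v (max 0 (min R p)) := by
    intro p
    rcases lt_or_ge p 0 with h | h
    · rw [hvleft p h, min_eq_right (by linarith), max_eq_left h.le]
    · rcases lt_or_ge R p with h' | h'
      · rw [hvright p h', min_eq_left h'.le, max_eq_right hR.le]
      · rw [min_eq_right h', max_eq_right h]
  have hmem : ∀ p, max 0 (min R p) ∈ Set.Icc 0 R := fun p =>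
    ⟨le_max_left _ _, max_le hR.le (min_le_left _ _)⟩
  have hanti : StrictAntiOn v (Set.Icc 0 R) := by
    apply strictAntiOn_of_deriv_neg (convex_Icc 0 R) hv.continuousOn
    intro p hp
    have h1 := hv' p (interior_subset hp)
    rwa [derivWithin_of_mem_nhds (mem_interior_iff_mem_nhds.1 hp)] at h1
  have hLv0 : 0 ≤ Lv := by
    have h := hLv 0 ⟨le_rfl, hR.le⟩ R ⟨hR.le, le_rfl⟩
    have h2 : 0 ≤ Lv * |0 - R| := (abs_nonneg _).trans h
    rw [zero_sub, abs_neg, abs_of_pos hR] at h2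
    exact nonneg_of_mul_nonneg_left h2 hR
  have hlip : ∀ p q, |v p - v q| ≤ Lv * |p - q| := by
    intro p q
    rw [hclamp p, hclamp q]
    refine (hLv _ (hmem p) _ (hmem q)).trans (mul_le_mul_of_nonneg_left ?_ hLv0)
    exact clamp_lip R p q
  refine ⟨?_, hlip, hLv0, ⟨max |v 0| |v R|, by positivity, ?_⟩, ?_⟩
  · intro p q hpq
    rw [hclamp p, hclamp q]
    exact hanti.antitoneOn (hmem p) (hmem q) (max_le_max le_rfl (min_le_min le_rfl hpq))
  · intro p
    rw [hclamp p]
    have h1 := hanti.antitoneOn ⟨le_rfl, hR.le⟩ (hmem p) (hmem p).1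
    have h2 := hanti.antitoneOn (hmem p) ⟨hR.le, le_rfl⟩ (hmem p).2
    rw [abs_le]
    constructor
    · have := le_max_right |v 0| |v R|
      linarith [neg_abs_le (v R)]
    · have := le_max_left |v 0| |v R|
      linarith [le_abs_self (v 0)]
  · have : LipschitzWith (Real.toNNReal Lv) v := LipschitzWith.of_dist_le_mul fun p q => by
      rw [Real.dist_eq, Real.dist_eq, Real.coe_toNNReal _ hLv0]; exact hlip p q
    exact this.continuous

lemma scheme_inc {v : ℝ → ℝ} {V θ l τ : ℝ} {N M : ℕ} {x : ℕ → ℕ → ℝ} (hV : ∀ p, |v p| ≤ V) (hτ : 0 < τ)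
    (hθ : θ ∈ Set.Icc (0:ℝ) 1) (hs : IsScheme N M l τ θ v x) {i m : ℕ} (hi : i ≤ N) (hm : m < M) :
    |x i (m+1) - x i m| ≤ τ * V := by
  rcases hi.lt_or_eq with h | rfl
  · rw [hs.2.2 m hm i h, add_sub_cancel_left, abs_mul, abs_of_pos hτ]
    refine mul_le_mul_of_nonneg_left ?_ hτ.le
    refine (abs_add_le _ _).trans ?_
    rw [abs_mul, abs_mul, abs_of_nonneg hθ.1, abs_of_nonneg (sub_nonneg.2 hθ.2)]
    nlinarith [mul_le_mul_of_nonneg_left (hV (Rd N l x i m)) hθ.1,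
      mul_le_mul_of_nonneg_left (hV (Rd N l x i (m+1))) (sub_nonneg.2 hθ.2)]
  · rw [hs.2.1 m hm, add_sub_cancel_left, abs_mul, abs_of_pos hτ]
    exact mul_le_mul_of_nonneg_left (hV 0) hτ.le

lemma cfg_close {R C A B L l l' η : ℝ} {N N' : ℕ} {X Y : ℕ → ℝ} {P : ℕ} (hP : 0 < P) (hAB : A < B)
    (hR : 0 ≤ R) (hX : Cfg R C A B l N X) (hY : Cfg R C A B l' N' Y) (hη0 : 0 ≤ η)
    (hlN : l * N = L) (hlN' : l' * N' = L)
    (h1 : ∀ i ≤ N, ∀ j ≤ N', X i ≤ Y j → l * i ≤ l' * j + η)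
    (h2 : ∀ j ≤ N', ∀ i ≤ N, Y j ≤ X i → l' * j ≤ l * i + η) :
    ∫ y, |dens N l X y - dens N' l' Y y| ≤ P * (2 * (η + l + l')) + (B - A) / P * (2 * C + 2 * C) := by
  refine l1_close hP hAB (dens_integrable _ _ _) (dens_integrable _ _ _)
    (fun x y h => hX.dens_var h) (fun x y h => hY.dens_var h) hX.wvar_mem hY.wvar_mem
    (fun y hy => hX.dens_out hy) (fun y hy => hY.dens_out hy) ?_
  intro b hb
  have e1 := mass_cmp hX hY (hX.massFn hR hlN) (hY.massFn hR hlN') hη0 hlN hlN' h1 b hb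
  have e2 := mass_cmp hY hX (hY.massFn hR hlN') (hX.massFn hR hlN) hη0 hlN' hlN h2 b hb
  rw [abs_le]
  constructor <;> linarith

lemma cfg_gap {R C A B l d : ℝ} {N : ℕ} {X Y : ℕ → ℝ} (hR : 0 < R) 
    (hX : Cfg R C A B l N X) (hd : ∀ i ≤ N, |X i - Y i| ≤ d) :
    ∀ i ≤ N, ∀ j ≤ N, X i ≤ Y j → l * i ≤ l * j + R * d := by
  intro i hi j hj hij
  have hd0 : 0 ≤ d := (abs_nonneg _).trans (hd 0 (Nat.zero_le _))
  rcases le_total i j with h | h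
  · have : (i:ℝ) ≤ j := by exact_mod_cast h
    have := mul_le_mul_of_nonneg_left this hX.hl.le
    have := mul_nonneg hR.le hd0
    linarith
  · have hg : ∀ n, j + n ≤ N → l * n ≤ R * (X (j + n) - X j) := by
      intro n
      induction n with
      | zero => intro _; simp
      | succ n ih =>
        intro hn
        have h1 := ih (by omega)
        have h2 := hX.rr_mul (i := j + n) (by omega)
        have h3 := hX.bd (j+n) (by omega)
        have h4 := hX.mono (j+n) (by omega)
        have h5 := mul_le_mul_of_nonneg_right h3 (sub_nonneg.2 h4.le)
        rw [h2] at h5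
        push_cast
        rw [← add_assoc]
        linarith
    have h1 := hg (i - j) (by omega)
    rw [Nat.add_sub_cancel' h, Nat.cast_sub h] at h1
    have h2 := (abs_le.1 (hd j hj)).1
    have h3 : X i - X j ≤ d := by linarith
    have := mul_le_mul_of_nonneg_left h3 hR.le
    linarith

lemma time_close {R C A B L l d : ℝ} {N : ℕ} {X Y : ℕ → ℝ} {P : ℕ} (hP : 0 < P) (hAB : A < B)
    (hR : 0 < R) (hX : Cfg R C A B l N X) (hY : Cfg R C A B l N Y) (hlN : l * N = L)
    (hd : ∀ i ≤ N, |X i - Y i| ≤ d) :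
    ∫ y, |dens N l X y - dens N l Y y| ≤ P * (2 * (R * d + l + l)) + (B - A) / P * (2 * C + 2 * C) := by
  have hd0 : 0 ≤ d := (abs_nonneg _).trans (hd 0 (Nat.zero_le _))
  exact cfg_close hP hAB hR.le hX hY (mul_nonneg hR.le hd0) hlN hlN (cfg_gap hR hX hd)
    (cfg_gap hR hY (fun i hi => by rw [abs_sub_comm]; exact hd i hi))

lemma exists_P {δ c : ℝ} (hδ : 0 < δ) : ∃ P : ℕ, 0 < P ∧ c / P < δ := by
  have h : Tendsto (fun P : ℕ => c / (P:ℝ)) atTop (nhds 0) := tendsto_const_div_atTop_nhds_zero_nat c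
  have h1 := (h.eventually (gt_mem_nhds hδ)).and (eventually_gt_atTop 0)
  obtain ⟨P, h2, h3⟩ := h1.exists
  exact ⟨P, h3, h2⟩

lemma pair_close {v : ℝ → ℝ} {Lv R T L C A B δ : ℝ}
    (hva : Antitone v) (hvl : ∀ p q, |v p - v q| ≤ Lv * |p - q|) (hLv : 0 ≤ Lv) (hR : 0 < R)
    (hT : 0 < T) (hAB : A < B) (hδ : 0 < δ) :
    ∃ lam > 0, ∀ (l l' ω ω' : ℝ) (N N' : ℕ) (x a y b : ℕ → ℝ → ℝ),
      Traj v R T C A B ω l N x a → Traj v R T C A B ω' l' N' y b →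
      l * N = L → l' * N' = L → l ≤ lam → l' ≤ lam → ω ≤ lam → ω' ≤ lam →
      (∀ i ≤ N, ∀ j ≤ N', l * i - l' * j ≤ R * max (x i 0 - y j 0) 0) →
      (∀ i ≤ N', ∀ j ≤ N, l' * i - l * j ≤ R * max (y i 0 - x j 0) 0) →
      ∀ t ∈ Set.Icc 0 T,
        ∫ z, |dens N l (fun j => x j t) z - dens N' l' (fun j => y j t) z| ≤ δ := by
  obtain ⟨P, hP, hP1⟩ := exists_P (c := (B - A) * (2 * C + 2 * C)) (half_pos hδ)
  have hPr : (0:ℝ) < P := by exact_mod_cast hP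
  obtain ⟨ε, hε, hε1⟩ : ∃ ε > 0, P * (2 * (R^2*ε/2)) ≤ δ / 4 := by
    refine ⟨δ / (4 * P * R^2), by positivity, le_of_eq ?_⟩
    field_simp
  have hK : Tendsto (fun lam : ℝ => P * (2 * (((R + Real.sqrt (2*lam/ε)) *
      (Lv * (Real.sqrt (lam/ε) + Real.sqrt (2*lam/ε)) + lam + lam) + lam) * T + lam + lam)))
      (nhds 0) (nhds 0) := by
    have hc : Continuous (fun lam : ℝ => P * (2 * (((R + Real.sqrt (2*lam/ε)) *
      (Lv * (Real.sqrt (lam/ε) + Real.sqrt (2*lam/ε)) + lam + lam) + lam) * T + lam + lam))) := by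
      fun_prop
    have := hc.tendsto 0
    simpa using this
  have hq : (0:ℝ) < δ / 4 := by linarith
  have hev := (hK.eventually (gt_mem_nhds hq)).filter_mono (nhdsWithin_le_nhds (s := Set.Ioi 0))
  obtain ⟨lam, hlam, hlam0⟩ := (hev.and self_mem_nhdsWithin).exists
  have hlam0 : 0 < lam := hlam0
  refine ⟨lam, hlam0, ?_⟩
  intro l l' ω ω' N N' x a y b hx hy hlN hlN' hl hl' hω hω' hi1 hi2 t ht
  set κ := (R + Real.sqrt (2*lam/ε)) *
      (Lv * (Real.sqrt (lam/ε) + Real.sqrt (2*lam/ε)) + lam + lam) + lam with hκ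
  have hκ0 : 0 ≤ κ := by positivity
  have key : ∀ l l' ω ω' : ℝ, l ≤ lam → l' ≤ lam → ω ≤ lam → ω' ≤ lam →
    (R + Real.sqrt (2*l'/ε)) * (Lv * (Real.sqrt (l/ε) + Real.sqrt (2*l'/ε)) + ω + ω') < κ := by
    intro l l' ω ω' h1 h2 h3 h4
    have e1 : Real.sqrt (2*l'/ε) ≤ Real.sqrt (2*lam/ε) := Real.sqrt_le_sqrt (by gcongr)
    have e2 : Real.sqrt (l/ε) ≤ Real.sqrt (lam/ε) := Real.sqrt_le_sqrt (by gcongr)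
    have e3 : Lv * (Real.sqrt (l/ε) + Real.sqrt (2*l'/ε)) + ω + ω' ≤
      Lv * (Real.sqrt (lam/ε) + Real.sqrt (2*lam/ε)) + lam + lam := by gcongr
    have e4 : (0:ℝ) ≤ R + Real.sqrt (2*l'/ε) := by positivity
    have e5 : (0:ℝ) ≤ Lv * (Real.sqrt (lam/ε) + Real.sqrt (2*lam/ε)) + lam + lam := by positivity
    calc _ ≤ (R + Real.sqrt (2*l'/ε)) * (Lv * (Real.sqrt (lam/ε) + Real.sqrt (2*lam/ε)) + lam + lam) :=
          mul_le_mul_of_nonneg_left e3 e4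
      _ ≤ (R + Real.sqrt (2*lam/ε)) * (Lv * (Real.sqrt (lam/ε) + Real.sqrt (2*lam/ε)) + lam + lam) :=
          mul_le_mul_of_nonneg_right (by linarith) e5
      _ < κ := by linarith
  have hκT : κ * t ≤ κ * T := mul_le_mul_of_nonneg_left ht.2 hκ0
  have c1 : ∀ i ≤ N, ∀ j ≤ N', x i t ≤ y j t → l * i ≤ l' * j + (R^2*ε/2 + κ * T) := by
    intro i hi j hj hij
    have := hj_compare hva hvl hLv hR hε hx hy hlN hlN' hi1 (key l l' ω ω' hl hl' hω hω') t ht i hi j hj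
    rw [max_eq_right (by linarith)] at this
    simp at this
    linarith
  have c2 : ∀ i ≤ N', ∀ j ≤ N, y i t ≤ x j t → l' * i ≤ l * j + (R^2*ε/2 + κ * T) := by
    intro i hi j hj hij
    have := hj_compare hva hvl hLv hR hε hy hx hlN' hlN hi2 (key l' l ω' ω hl' hl hω' hω) t ht i hi j hj
    rw [max_eq_right (by linarith)] at this
    simp at this
    linarith
  have hfin := cfg_close hP hAB hR.le (hx.cfg ht) (hy.cfg ht) (by positivity) hlN hlN' c1 c2
  refine hfin.trans ?_
  have e : (B - A) / P * (2 * C + 2 * C) = (B - A) * (2 * C + 2 * C) / P := by ring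
  rw [e]
  have e2 : P * (2 * (R^2*ε/2 + κ * T + l + l')) ≤ P * (2 * (R^2*ε/2)) + P * (2 * (κ * T + lam + lam)) := by
    rw [← mul_add]
    refine mul_le_mul_of_nonneg_left ?_ hPr.le
    linarith
  linarith

/-- the discrete density at a time in the `m`-th time slab. -/
lemma disc_eq {N M : ℕ} {l τ : ℝ} (x : ℕ → ℕ → ℝ) {t : ℝ} (hτ : 0 < τ) (y : ℝ)
    (ht : t ∈ Set.Ico 0 (M * τ)) :
    discDens N M l τ x y t = dens N l (fun j => x j ⌊t / τ⌋₊) y := by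
  obtain ⟨h1, h2, h3⟩ := floor_lt hτ ht
  unfold discDens dens
  rw [Finset.sum_eq_single ⌊t / τ⌋₊]
  · refine Finset.sum_congr rfl fun i _ => ?_
    rw [Set.indicator_of_mem (s := Set.Ico ((⌊t / τ⌋₊:ℝ) * τ) (((⌊t / τ⌋₊:ℝ) + 1) * τ)), mul_one, Rd_eq_rr]
    exact ⟨(le_div_iff₀ hτ).1 h2, (div_lt_iff₀ hτ).1 h3⟩
  · intro m _ hm
    refine Finset.sum_eq_zero fun i _ => ?_
    rw [Set.indicator_of_notMem (s := Set.Ico ((m:ℝ) * τ) (((m:ℝ) + 1) * τ)), mul_zero]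
    rintro ⟨h4, h5⟩
    apply hm
    symm
    rw [Nat.floor_eq_iff (div_nonneg ht.1 hτ.le)]
    exact ⟨(le_div_iff₀ hτ).2 h4, (div_lt_iff₀ hτ).2 h5⟩
  · intro h; exact absurd (Finset.mem_range.2 h1) h

lemma disc_measurable (N M : ℕ) (l τ : ℝ) (x : ℕ → ℕ → ℝ) :
    Measurable (fun p : ℝ × ℝ => discDens N M l τ x p.2 p.1) := by
  unfold discDens
  refine Finset.measurable_sum _ fun m _ => Finset.measurable_sum _ fun i _ => ?_
  refine Measurable.mul (Measurable.const_mul ?_ _) ?_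
  · exact (measurable_const.indicator measurableSet_Ico).comp measurable_snd
  · exact (measurable_const.indicator measurableSet_Ico).comp measurable_fst

lemma l1_limit {Ω : Type*} [MeasurableSpace Ω] {μ : Measure Ω} {D : ℕ → Ω → ℝ}
    (hD : ∀ n, Integrable (D n) μ)
    (hc : ∀ ε > 0, ∃ n0, ∀ n ≥ n0, ∀ m ≥ n0, ∫ p, |D n p - D m p| ∂μ ≤ ε) :
    ∃ f : Ω → ℝ, Measurable f ∧ Integrable f μ ∧
      Tendsto (fun n => ∫ p, |D n p - f p| ∂μ) atTop (nhds 0) := by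
  have hdist : ∀ n m, dist ((hD n).toL1 (D n)) ((hD m).toL1 (D m)) = ∫ p, |D n p - D m p| ∂μ := by
    intro n m
    rw [dist_eq_norm, ← Integrable.toL1_sub, L1.norm_of_fun_eq_integral_norm]
    rfl
  have hcs : CauchySeq (fun n => (hD n).toL1 (D n)) := by
    rw [Metric.cauchySeq_iff]
    intro ε hε
    obtain ⟨n0, h⟩ := hc (ε/2) (by linarith)
    refine ⟨n0, fun m hm n hn => ?_⟩
    rw [hdist]
    linarith [h m hm n hn]
  obtain ⟨F, hF⟩ := cauchySeq_tendsto_of_complete hcs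
  refine ⟨F, (Lp.stronglyMeasurable F).measurable, L1.integrable_coeFn F, ?_⟩
  have h2 := (tendsto_iff_dist_tendsto_zero).1 hF
  refine h2.congr fun n => ?_
  rw [dist_eq_norm, L1.norm_eq_integral_norm]
  refine integral_congr_ae ?_
  filter_upwards [Lp.coeFn_sub ((hD n).toL1 (D n)) F, (hD n).coeFn_toL1] with p h3 h4
  rw [h3, Pi.sub_apply, h4]
  rfl

noncomputable def slab (T : ℝ) : Measure (ℝ × ℝ) := (volume.restrict (Set.Ioo 0 T)).prod volume

lemma slab_int {T A B Kb : ℝ} {g : ℝ × ℝ → ℝ} (hg : Measurable g) (hb : ∀ p, |g p| ≤ Kb)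
    (hs : ∀ p, p.2 ∉ Set.Icc A B → g p = 0) : Integrable g (slab T) := by
  have h1 : IntegrableOn g (Set.univ ×ˢ Set.Icc A B) (slab T) := by
    refine Measure.integrableOn_of_bounded (M := Kb) ?_ hg.aestronglyMeasurable ?_
    · unfold slab
      rw [Measure.prod_prod]
      simp [ENNReal.mul_eq_top]
    · exact Eventually.of_forall hb
  refine (integrableOn_iff_integrable_of_support_subset ?_).1 h1
  intro p hp
  by_contra hc
  apply hp
  apply hs
  intro h; apply hc; exact ⟨trivial, h⟩

lemma slab_fub {T : ℝ} (hT : 0 ≤ T) {g : ℝ × ℝ → ℝ} (hg : Integrable g (slab T)) :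
    ∫ t in (0:ℝ)..T, ∫ y, g (t, y) = ∫ p, g p ∂(slab T) := by
  unfold slab
  rw [integral_prod _ hg, intervalIntegral.integral_of_le hT, integral_Ioc_eq_integral_Ioo]

lemma slab_fub_int {T : ℝ} (hT : 0 ≤ T) {g : ℝ × ℝ → ℝ} (hg : Integrable g (slab T)) :
    IntervalIntegrable (fun t => ∫ y, g (t, y)) volume 0 T := by
  rw [intervalIntegrable_iff_integrableOn_Ioo_of_le hT]
  exact Integrable.integral_prod_left hg

lemma Qf_lip {v : ℝ → ℝ} {Lv V R k : ℝ} (hvl : ∀ p q, |v p - v q| ≤ Lv * |p - q|) (hLv : 0 ≤ Lv)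
    (hV : ∀ p, |v p| ≤ V) (hk : k ∈ Set.Icc 0 R) {r s : ℝ} (hr : r ∈ Set.Icc 0 R)
    (hs : s ∈ Set.Icc 0 R) : |Qf v k r - Qf v k s| ≤ (V + 2 * R * Lv) * |r - s| := by
  have e : Qf v k r - Qf v k s = (|r - k| - |s - k|) * v r + |s - k| * (v r - v s)
      - k * (|v r - v k| - |v s - v k|) := by unfold Qf; ring
  have h1 : |(|r - k| - |s - k|)| ≤ |r - s| := by
    have := abs_abs_sub_abs_le_abs_sub (r - k) (s - k)
    rwa [sub_sub_sub_cancel_right] at this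
  have h2 : |(|v r - v k| - |v s - v k|)| ≤ |v r - v s| := by
    have := abs_abs_sub_abs_le_abs_sub (v r - v k) (v s - v k)
    rwa [sub_sub_sub_cancel_right] at this
  have h3 : |s - k| ≤ R := by rw [abs_le]; constructor <;> linarith [hk.1, hk.2, hs.1, hs.2]
  have h4 := hvl r s
  have h0 := abs_nonneg (r - s)
  have hR : 0 ≤ R := hk.1.trans hk.2
  rw [e]
  refine (abs_sub _ _).trans ?_
  refine (add_le_add_left (abs_add_le _ _) _).trans ?_
  rw [abs_mul, abs_mul, abs_mul, abs_abs, abs_of_nonneg hk.1]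
  have a1 : |(|r - k| - |s - k|)| * |v r| ≤ |r - s| * V :=
    mul_le_mul h1 (hV r) (abs_nonneg _) h0
  have a2 : |s - k| * |v r - v s| ≤ R * (Lv * |r - s|) :=
    mul_le_mul h3 h4 (abs_nonneg _) hR
  have a3 : k * |(|v r - v k| - |v s - v k|)| ≤ R * (Lv * |r - s|) :=
    mul_le_mul hk.2 (h2.trans h4) (abs_nonneg _) hR
  linarith

lemma Qf_cont {v : ℝ → ℝ} (hvc : Continuous v) (k : ℝ) : Continuous (Qf v k) := by
  unfold Qf; fun_prop

section
variable {v : ℝ → ℝ} {φ : ℝ → ℝ → ℝ} {T a b Φ K Lv V R k : ℝ}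

lemma Qf_bd (hV : ∀ p, |v p| ≤ V) (hk : k ∈ Set.Icc 0 R) {r : ℝ} (hr : r ∈ Set.Icc 0 R) :
    |Qf v k r| ≤ R * V + R * (V + V) := by
  have hR : 0 ≤ R := hk.1.trans hk.2
  unfold Qf
  refine (abs_sub _ _).trans ?_
  rw [abs_mul, abs_mul, abs_abs, abs_abs, abs_of_nonneg hk.1]
  have h3 : |r - k| ≤ R := by rw [abs_le]; constructor <;> linarith [hk.1, hk.2, hr.1, hr.2]
  have h4 : |v r - v k| ≤ V + V := (abs_sub _ _).trans (add_le_add (hV _) (hV _))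
  exact add_le_add (mul_le_mul h3 (hV r) (abs_nonneg _) hR) (mul_le_mul hk.2 h4 (abs_nonneg _) hR)

lemma ent_pt_bd (hV : ∀ p, |v p| ≤ V) (hφ : Test φ T a b Φ K) (hk : k ∈ Set.Icc 0 R) {r : ℝ}
    (hr : r ∈ Set.Icc 0 R) (y t : ℝ) :
    |(|r - k| * pt φ y t + Qf v k r * px φ y t)| ≤ R * |pt φ y t| + (R * V + R * (V + V)) * |px φ y t| := by
  refine (abs_add_le _ _).trans ?_
  rw [abs_mul, abs_mul, abs_abs]
  have h3 : |r - k| ≤ R := by rw [abs_le]; constructor <;> linarith [hk.1, hk.2, hr.1, hr.2]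
  exact add_le_add (mul_le_mul_of_nonneg_right h3 (abs_nonneg _))
    (mul_le_mul_of_nonneg_right (Qf_bd hV hk hr) (abs_nonneg _))

lemma ent_int (hvc : Continuous v) (hV : ∀ p, |v p| ≤ V) (hφ : Test φ T a b Φ K) (hk : k ∈ Set.Icc 0 R)
    {g : ℝ → ℝ} (hg : Measurable g) (hgR : ∀ y, g y ∈ Set.Icc 0 R) (t : ℝ) :
    Integrable (fun y => |g y - k| * pt φ y t + Qf v k (g y) * px φ y t) := by
  have h1 := hφ.pt_cont1 t
  have h2 := hφ.px_cont1 t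
  refine Integrable.mono' (((hφ.pt_int t).abs.const_mul R).add
    ((hφ.px_int t).abs.const_mul (R * V + R * (V + V)))) ?_ ?_
  · apply Measurable.aestronglyMeasurable
    exact ((continuous_abs.measurable.comp (hg.sub_const k)).mul h1.measurable).add
      (((Qf_cont hvc k).measurable.comp hg).mul h2.measurable)
  · exact Eventually.of_forall fun y => ent_pt_bd hV hφ hk (hgR y) y t

lemma ent_close (hvc : Continuous v) (hvl : ∀ p q, |v p - v q| ≤ Lv * |p - q|) (hLv : 0 ≤ Lv)
    (hV : ∀ p, |v p| ≤ V) (hφ : Test φ T a b Φ K) (hk : k ∈ Set.Icc 0 R)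
    {g h : ℝ → ℝ} (hg : Measurable g) (hgR : ∀ y, g y ∈ Set.Icc 0 R)
    (hh : Measurable h) (hhR : ∀ y, h y ∈ Set.Icc 0 R) (hd : Integrable fun y => |g y - h y|) (t : ℝ) :
    |(∫ y, (|g y - k| * pt φ y t + Qf v k (g y) * px φ y t)) -
      ∫ y, (|h y - k| * pt φ y t + Qf v k (h y) * px φ y t)| ≤
      K * (1 + (V + 2 * R * Lv)) * ∫ y, |g y - h y| := by
  rw [← integral_sub (ent_int hvc hV hφ hk hg hgR t) (ent_int hvc hV hφ hk hh hhR t),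
    ← integral_const_mul]
  refine norm_integral_le_of_norm_le (G := ℝ) (hd.const_mul _) (Eventually.of_forall fun y => ?_)
  rw [Real.norm_eq_abs]
  have e : (|g y - k| * pt φ y t + Qf v k (g y) * px φ y t) -
      (|h y - k| * pt φ y t + Qf v k (h y) * px φ y t) =
      (|g y - k| - |h y - k|) * pt φ y t + (Qf v k (g y) - Qf v k (h y)) * px φ y t := by ring
  rw [e]
  refine (abs_add_le _ _).trans ?_
  rw [abs_mul, abs_mul]
  have h1 : |(|g y - k| - |h y - k|)| ≤ |g y - h y| := by
    have := abs_abs_sub_abs_le_abs_sub (g y - k) (h y - k)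
    rwa [sub_sub_sub_cancel_right] at this
  have h2 := Qf_lip hvl hLv hV hk (hgR y) (hhR y)
  have b1 := mul_le_mul h1 (hφ.pt_bd y t) (abs_nonneg _) (abs_nonneg _)
  have b2 := mul_le_mul h2 (hφ.px_bd y t) (abs_nonneg _) ((abs_nonneg _).trans h2)
  linarith

lemma init_close (hφ : Test φ T a b Φ K) (hk : 0 ≤ k) {g h : ℝ → ℝ} (hg : Measurable g) (hh : Measurable h)
    (hgi : Integrable g) (hhi : Integrable h) (s : ℝ) :
    |(∫ y, |g y - k| * φ y s) - ∫ y, |h y - k| * φ y s| ≤ Φ * ∫ y, |g y - h y| := by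
  have hΦ : 0 ≤ Φ := (hφ.nonneg 0 0).trans (hφ.bound 0 0)
  have hi : ∀ {g : ℝ → ℝ}, Measurable g → Integrable g → Integrable fun y => |g y - k| * φ y s := by
    intro g hg hgi
    refine Integrable.mono' ((hgi.abs.const_mul Φ).add ((hφ.int0 s).const_mul k)) ?_ ?_
    · apply Measurable.aestronglyMeasurable
      exact (continuous_abs.measurable.comp (hg.sub_const k)).mul (hφ.cont1 s).measurable
    · refine Eventually.of_forall fun y => ?_
      simp only [Real.norm_eq_abs, Pi.add_apply, abs_mul, abs_abs, abs_of_nonneg (hφ.nonneg y s)]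
      have h1 : |g y - k| ≤ |g y| + k := by
        have := abs_sub (g y) k
        rwa [abs_of_nonneg hk] at this
      have h2 := mul_le_mul_of_nonneg_right h1 (hφ.nonneg y s)
      have h3 := mul_le_mul_of_nonneg_left (hφ.bound y s) (abs_nonneg (g y))
      linarith
  rw [← integral_sub (hi hg hgi) (hi hh hhi), ← integral_const_mul]
  refine norm_integral_le_of_norm_le (G := ℝ) ((hgi.sub hhi).abs.const_mul _) (Eventually.of_forall fun y => ?_)
  rw [Real.norm_eq_abs, ← sub_mul, abs_mul, abs_of_nonneg (hφ.nonneg y s), mul_comm]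
  have h1 : |(|g y - k| - |h y - k|)| ≤ |g y - h y| := by
    have := abs_abs_sub_abs_le_abs_sub (g y - k) (h y - k)
    rwa [sub_sub_sub_cancel_right] at this
  exact mul_le_mul (hφ.bound y s) h1 (abs_nonneg _) hΦ

theorem entropy_limit {C A B : ℝ} {ρ : ℝ → ℝ → ℝ} {f : ℝ → ℝ} (hT : 0 < T) (hR : 0 < R) (hva : Antitone v)
    (hvc : Continuous v) (hvl : ∀ p q, |v p - v q| ≤ Lv * |p - q|) (hLv : 0 ≤ Lv)
    (hV : ∀ p, |v p| ≤ V) (hφ : Test φ T a b Φ K) (hk : k ∈ Set.Icc 0 R)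
    (hρ : Measurable (Function.uncurry ρ)) (hρR : ∀ y t, ρ y t ∈ Set.Icc 0 R)
    (hρs : ∀ y t, y ∉ Set.Icc A B → ρ y t = 0) (hf : Measurable f) (hfi : Integrable f)
    (hap : ∀ δ > 0, ∃ (N : ℕ) (l ω : ℝ) (x u : ℕ → ℝ → ℝ) (e : ℝ → ℝ),
      Traj v R T C A B ω l N x u ∧ ω ≤ δ ∧ l ≤ δ ∧ (∫ y, |dens N l (fun j => x j 0) y - f y|) ≤ δ ∧
      IntervalIntegrable e volume 0 T ∧ (∫ t in (0:ℝ)..T, e t) ≤ δ ∧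
      ∀ t ∈ Set.Ioo 0 T, ∫ y, |dens N l (fun j => x j t) y - ρ y t| ≤ e t) :
    0 ≤ (∫ t in (0:ℝ)..T, ∫ y, (|ρ y t - k| * pt φ y t + Qf v k (ρ y t) * px φ y t)) +
      ∫ y, |f y - k| * φ y 0 := by
  have hΦ : 0 ≤ Φ := (hφ.nonneg 0 0).trans (hφ.bound 0 0)
  have hV0 : 0 ≤ V := (abs_nonneg _).trans (hV 0)
  have hK0 := hφ.K0
  have hρ1 : ∀ t, Measurable fun y => ρ y t := fun t => hρ.comp (measurable_id.prodMk measurable_const)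
  set G : ℝ × ℝ → ℝ := fun p => |ρ p.2 p.1 - k| * pt φ p.2 p.1 + Qf v k (ρ p.2 p.1) * px φ p.2 p.1 with hG
  have hρ' : Measurable fun p : ℝ × ℝ => ρ p.2 p.1 := hρ.comp measurable_swap
  have hGm : Measurable G := by
    have h1 : Measurable fun p : ℝ × ℝ => pt φ p.2 p.1 := hφ.pt_cont.measurable.comp measurable_swap
    have h2 : Measurable fun p : ℝ × ℝ => px φ p.2 p.1 := hφ.px_cont.measurable.comp measurable_swap
    exact ((continuous_abs.measurable.comp (hρ'.sub_const k)).mul h1).add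
      (((Qf_cont hvc k).measurable.comp hρ').mul h2)
  have hGi : Integrable G (slab T) := by
    refine slab_int (A := a) (B := b) (Kb := R * K + (R * V + R * (V + V)) * K) hGm ?_ ?_
    · intro p
      refine (ent_pt_bd hV hφ hk (hρR p.2 p.1) p.2 p.1).trans ?_
      have h1 := hφ.pt_bd p.2 p.1
      have h2 := hφ.px_bd p.2 p.1
      gcongr
    · intro p hp
      simp only [hG]
      rw [hφ.pt_supp _ hp, hφ.px_supp _ hp]; ring
  have hGii := slab_fub_int hT.le hGi
  set S := (∫ t in (0:ℝ)..T, ∫ y, (|ρ y t - k| * pt φ y t + Qf v k (ρ y t) * px φ y t)) +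
      ∫ y, |f y - k| * φ y 0 with hS
  set Lp := K * (1 + (V + 2 * R * Lv)) with hLp
  have hLp0 : 0 ≤ Lp := by positivity
  have main : ∀ δ, 0 < δ → δ ≤ 1 → 0 ≤ S + δ * (Lp + Φ + (K * (Lv * |C| + 3) + 4 * R * Φ) * T) := by
    intro δ hδ hδ1
    obtain ⟨N, l, ω, x, u, e, hx, hω, hl, hi, he, heT, hxe⟩ := hap δ hδ
    have hω0 : 0 ≤ ω := (Finset.sum_nonneg fun i _ => abs_nonneg _).trans (hx.err 0 ⟨le_rfl, hT⟩)
    have hent := traj_entropy hT hva hvl hLv hvc hφ hx hk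
    have hin := init_close hφ hk.1 (dens_measurable N l fun j => x j 0) hf
      (dens_integrable N l fun j => x j 0) hfi 0
    have hin2 := mul_le_mul_of_nonneg_left hi hΦ
    have herr : entErr R C ω l Lv Φ K ≤ δ * (K * (Lv * |C| + 3) + 4 * R * Φ) := by
      unfold entErr
      have hC := le_abs_self C
      have h1 : K * l * (Lv * C + 3 * ω) ≤ K * l * (Lv * |C| + 3) := by
        have := hx.hl
        refine mul_le_mul_of_nonneg_left ?_ (by positivity)
        have := mul_le_mul_of_nonneg_left hC hLv
        linarith
      have h2 : K * l * (Lv * |C| + 3) ≤ K * δ * (Lv * |C| + 3) := by gcongr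
      have h3 : 4 * R * Φ * ω ≤ 4 * R * Φ * δ := by gcongr
      linarith
    have herr2 := mul_le_mul_of_nonneg_right herr hT.le
    have hgi : IntervalIntegrable (fun t => ∫ y, (|dens N l (fun j => x j t) y - k| * pt φ y t +
      Qf v k (dens N l (fun j => x j t) y) * px φ y t)) volume 0 T := by
      have h1 : IntervalIntegrable (gf φ v a b k l N x) volume 0 T := by
        apply ContinuousOn.intervalIntegrable
        rw [Set.uIcc_of_le hT.le]
        exact gf_contOn hvc hφ hx
      refine h1.congr ?_
      intro t ht
      rw [Set.uIoc_of_le hT.le] at ht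
      exact (gf_eq hva hφ hx hk.1 ⟨ht.1.le, ht.2⟩).symm
    have hdiff : (∫ t in (0:ℝ)..T, ∫ y, (|dens N l (fun j => x j t) y - k| * pt φ y t +
      Qf v k (dens N l (fun j => x j t) y) * px φ y t)) ≤
      ∫ t in (0:ℝ)..T, ((∫ y, G (t, y)) + Lp * e t) := by
      refine intervalIntegral.integral_mono_on_of_le_Ioo hT.le hgi (hGii.add (he.const_mul _)) ?_
      intro t ht
      have hc := hx.cfg (t := t) ⟨ht.1.le, ht.2.le⟩
      have hρi : Integrable fun y => ρ y t := by
        have h1 : IntegrableOn (fun y => ρ y t) (Set.Icc A B) := by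
          refine Measure.integrableOn_of_bounded (M := R) (by simp) (hρ1 t).aestronglyMeasurable ?_
          refine Eventually.of_forall fun y => ?_
          rw [Real.norm_eq_abs, abs_of_nonneg (hρR y t).1]
          exact (hρR y t).2
        refine (integrableOn_iff_integrable_of_support_subset ?_).1 h1
        intro y hy
        by_contra hc
        exact hy (hρs y t hc)
      have h1 := ent_close hvc hvl hLv hV hφ hk (dens_measurable N l fun j => x j t) (hc.dens_mem hR.le)
        (hρ1 t) (fun y => hρR y t) ((dens_integrable N l fun j => x j t).sub hρi).abs t
      have h2 := mul_le_mul_of_nonneg_left (hxe t ht) hLp0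
      have h3 := (le_abs_self _).trans h1
      simp only [hG]
      linarith
    rw [intervalIntegral.integral_add hGii (he.const_mul _), intervalIntegral.integral_const_mul] at hdiff
    have h5 := mul_le_mul_of_nonneg_left heT hLp0
    have h6 := (le_abs_self _).trans hin
    simp only [hG] at hdiff
    rw [hS]
    linarith
  set Z := Lp + Φ + (K * (Lv * |C| + 3) + 4 * R * Φ) * T with hZ
  have hZ0 : 0 ≤ Z := by positivity
  by_contra hneg
  push Not at hneg
  have h1 : 0 < min 1 (-S / (2 * (Z + 1))) := lt_min one_pos (div_pos (by linarith) (by linarith))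
  have h2 := main _ h1 (min_le_left _ _)
  have h3 : min 1 (-S / (2 * (Z + 1))) * Z ≤ -S / (2 * (Z + 1)) * (Z + 1) :=
    mul_le_mul (min_le_right _ _) (by linarith) hZ0 (div_nonneg (by linarith) (by linarith))
  have h4 : -S / (2 * (Z + 1)) * (Z + 1) = -S / 2 := by field_simp
  linarith
end

lemma disc_zero {N M : ℕ} {l τ : ℝ} (x : ℕ → ℕ → ℝ) {t : ℝ} (hτ : 0 < τ) (y : ℝ)
    (ht : t ∉ Set.Ico 0 (M * τ)) : discDens N M l τ x y t = 0 := by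
  unfold discDens
  refine Finset.sum_eq_zero fun m hm => Finset.sum_eq_zero fun i _ => ?_
  rw [Set.indicator_of_notMem (s := Set.Ico ((m:ℝ) * τ) (((m:ℝ) + 1) * τ)), mul_zero]
  rintro ⟨h4, h5⟩
  apply ht
  have hm : (m:ℝ) + 1 ≤ M := by exact_mod_cast Finset.mem_range.1 hm
  exact ⟨le_trans (by positivity) h4, h5.trans_le (mul_le_mul_of_nonneg_right hm hτ.le)⟩

lemma tri_int {f g h : ℝ → ℝ} (hf : Integrable f) (hg : Integrable g) (hh : Integrable h) :
    ∫ y, |f y - h y| ≤ (∫ y, |f y - g y|) + ∫ y, |g y - h y| := by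
  have h1 : Integrable fun y => |f y - g y| := (hf.sub hg).abs
  have h2 : Integrable fun y => |g y - h y| := (hg.sub hh).abs
  have h3 : Integrable fun y => |f y - h y| := (hf.sub hh).abs
  rw [← integral_add h1 h2]
  exact integral_mono h3 (h1.add h2) fun y => abs_sub_le _ _ _

section
variable {v : ℝ → ℝ} {R T C A B ω l τ L V : ℝ} {N M : ℕ} {x : ℕ → ℕ → ℝ} {u : ℕ → ℝ → ℝ}

lemma disc_cfg (hx : Traj v R T C A B ω l N (xi M τ x) u) (hτ : 0 < τ) (hMT : M * τ = T)
    {t : ℝ} (ht : t ∈ Set.Ico 0 T) : Cfg R C A B l N (fun j => x j ⌊t / τ⌋₊) := by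
  rw [← hMT] at ht
  obtain ⟨h1, h2, h3⟩ := floor_lt hτ ht
  have h4 := hx.cfg (t := (⌊t / τ⌋₊:ℝ) * τ) ⟨by positivity, by
    rw [← hMT]
    refine mul_le_mul_of_nonneg_right ?_ hτ.le
    exact_mod_cast h1.le⟩
  simpa only [xi_node hτ h1] using h4

lemma disc_mem (hx : Traj v R T C A B ω l N (xi M τ x) u) (hR : 0 ≤ R) (hτ : 0 < τ) (hMT : M * τ = T)
    (y t : ℝ) : discDens N M l τ x y t ∈ Set.Icc 0 R := by
  by_cases ht : t ∈ Set.Ico 0 T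
  · rw [disc_eq x hτ y (by rwa [hMT])]
    exact (disc_cfg hx hτ hMT ht).dens_mem hR y
  · rw [disc_zero x hτ y (by rwa [hMT])]
    exact ⟨le_rfl, hR⟩

lemma disc_out (hx : Traj v R T C A B ω l N (xi M τ x) u) (hτ : 0 < τ) (hMT : M * τ = T)
    (y t : ℝ) (hy : y ∉ Set.Icc A B) : discDens N M l τ x y t = 0 := by
  by_cases ht : t ∈ Set.Ico 0 T
  · rw [disc_eq x hτ y (by rwa [hMT])]
    exact (disc_cfg hx hτ hMT ht).dens_out fun h => hy ⟨h.1.le, h.2.le⟩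
  · rw [disc_zero x hτ y (by rwa [hMT])]

lemma disc_int (hτ : 0 < τ) (hMT : M * τ = T) {t : ℝ} (ht : t ∈ Set.Ico 0 T) :
    Integrable fun y => discDens N M l τ x y t := by
  have : (fun y => discDens N M l τ x y t) = dens N l (fun j => x j ⌊t / τ⌋₊) := by
    funext y
    exact disc_eq x hτ y (by rwa [hMT])
  rw [this]
  exact dens_integrable _ _ _

lemma disc_close (hx : Traj v R T C A B ω l N (xi M τ x) u) (hR : 0 < R) (hAB : A < B)
    (hτ : 0 < τ) (hMT : M * τ = T)
    (hlN : l * N = L) (hinc : ∀ i ≤ N, ∀ m < M, |x i (m+1) - x i m| ≤ τ * V) {P : ℕ} (hP : 0 < P)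
    {t : ℝ} (ht : t ∈ Set.Ico 0 T) :
    ∫ y, |dens N l (fun j => xi M τ x j t) y - discDens N M l τ x y t| ≤
      P * (2 * (R * (τ * V) + l + l)) + (B - A) / P * (2 * C + 2 * C) := by
  have e : ∀ y, discDens N M l τ x y t = dens N l (fun j => x j ⌊t / τ⌋₊) y := fun y =>
    disc_eq x hτ y (by rwa [hMT])
  simp only [e]
  refine time_close hP hAB hR (hx.cfg ⟨ht.1, ht.2.le⟩) (disc_cfg hx hτ hMT ht) hlN ?_
  intro i hi
  rw [← hMT] at ht
  obtain ⟨h1, h2, h3⟩ := floor_lt hτ ht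
  rw [xi_eq h1 h2 h3.le, add_sub_cancel_left, abs_mul, abs_of_nonneg (by linarith)]
  have h4 := hinc i hi _ h1
  have h5 : t / τ - ⌊t / τ⌋₊ ≤ 1 := by linarith
  exact (mul_le_of_le_one_left (abs_nonneg _) h5).trans h4
end

theorem conv_core {v : ℝ → ℝ} {R T C A B L V Lv Kf : ℝ} {N M : ℕ → ℕ} {l τ ω : ℕ → ℝ}
    {x : ℕ → ℕ → ℕ → ℝ} {u : ℕ → ℕ → ℝ → ℝ} {ρb : ℝ → ℝ}
    (hR : 0 < R) (hT : 0 < T) (hAB : A < B) (hva : Antitone v)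
    (hvc : Continuous v) (hvl : ∀ p q, |v p - v q| ≤ Lv * |p - q|) (hLv : 0 ≤ Lv)
    (hV : ∀ p, |v p| ≤ V) (hfm : Measurable ρb) (hfi : Integrable ρb)
    (hx : ∀ n, Traj v R T C A B (ω n) (l n) (N n) (xi (M n) (τ n) (x n)) (u n))
    (hτ : ∀ n, 0 < τ n) (hMT : ∀ n, M n * τ n = T) (hlN : ∀ n, l n * N n = L)
    (hτ0 : Tendsto τ atTop (nhds 0)) (hl0 : Tendsto l atTop (nhds 0)) (hω0 : Tendsto ω atTop (nhds 0))
    (hinc : ∀ n, ∀ i ≤ N n, ∀ m < M n, |x n i (m+1) - x n i m| ≤ τ n * V)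
    (hcmp : ∀ n n', ∀ i ≤ N n, ∀ j ≤ N n', l n * i - l n' * j ≤ R * max (x n i 0 - x n' j 0) 0)
    (hclose : ∀ n (P : ℕ), 0 < P → ∫ y, |dens (N n) (l n) (fun j => x n j 0) y - ρb y| ≤
      P * (2 * (2 * l n)) + (B - A) / P * Kf) :
    ∃ ρ : ℝ → ℝ → ℝ,
      Measurable (Function.uncurry ρ) ∧
      (∀ y t, y ∉ Set.Icc A B → ρ y t = 0) ∧ (∀ y t, ρ y t ∈ Set.Icc 0 R) ∧
      (∀ k ∈ Set.Icc (0 : ℝ) R, ∀ φ a b Φ K, Test φ T a b Φ K →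
        0 ≤ (∫ t in (0 : ℝ)..T, ∫ y, (|ρ y t - k| * pt φ y t + Qf v k (ρ y t) * px φ y t)) +
            (∫ y : ℝ, |ρb y - k| * φ y 0)) ∧
      Tendsto (fun n => ∫ t in (0 : ℝ)..T, ∫ y : ℝ,
          |discDens (N n) (M n) (l n) (τ n) (x n) y t - ρ y t|) atTop (nhds 0) := by
  set D : ℕ → ℝ × ℝ → ℝ := fun n p => discDens (N n) (M n) (l n) (τ n) (x n) p.2 p.1 with hD
  have hDm : ∀ n, Measurable (D n) := fun n => disc_measurable _ _ _ _ _
  have hDR : ∀ n p, D n p ∈ Set.Icc 0 R := fun n p => disc_mem (hx n) hR.le (hτ n) (hMT n) _ _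
  have hDs : ∀ n p, p.2 ∉ Set.Icc A B → D n p = 0 := fun n p hp =>
    disc_out (hx n) (hτ n) (hMT n) _ _ hp
  have hDi : ∀ n, Integrable (D n) (slab T) := fun n => by
    refine slab_int (A := A) (B := B) (Kb := R) (hDm n) (fun p => ?_) (hDs n)
    rw [abs_of_nonneg (hDR n p).1]; exact (hDR n p).2
  -- closeness of interpolated and discrete densities
  have hdd : ∀ δ > 0, ∃ n0, ∀ n ≥ n0, ∀ t ∈ Set.Ico 0 T,
      ∫ y, |dens (N n) (l n) (fun j => xi (M n) (τ n) (x n) j t) y - D n (t, y)| ≤ δ := by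
    intro δ hδ
    obtain ⟨P, hP, hP1⟩ := exists_P (c := (B - A) * (2 * C + 2 * C)) (half_pos hδ)
    have h1 : Tendsto (fun n => P * (2 * (R * (τ n * V) + l n + l n))) atTop (nhds 0) := by
      have := (((hτ0.mul_const V).const_mul R).add hl0 |>.add hl0 |>.const_mul 2).const_mul (P:ℝ)
      simpa using this
    obtain ⟨n0, hn0⟩ := eventually_atTop.1 (h1.eventually (gt_mem_nhds (half_pos hδ)))
    refine ⟨n0, fun n hn t ht => ?_⟩
    refine (disc_close (hx n) hR hAB (hτ n) (hMT n) (hlN n) (hinc n) hP ht).trans ?_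
    have e : (B - A) / P * (2 * C + 2 * C) = (B - A) * (2 * C + 2 * C) / P := by ring
    rw [e]
    linarith [hn0 n hn]
  -- uniform Cauchy property
  have hcau : ∀ δ > 0, ∃ n0, ∀ n ≥ n0, ∀ m ≥ n0, ∀ t ∈ Set.Ico 0 T,
      ∫ y, |D n (t, y) - D m (t, y)| ≤ δ := by
    intro δ hδ
    have hδ3 : 0 < δ / 3 := by linarith
    obtain ⟨n1, h1⟩ := hdd (δ/3) hδ3
    obtain ⟨lam, hlam, hpc⟩ := pair_close (L := L) (C := C) hva hvl hLv hR hT hAB hδ3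
    obtain ⟨n2, h2⟩ := eventually_atTop.1 (hl0.eventually (gt_mem_nhds hlam))
    obtain ⟨n3, h3⟩ := eventually_atTop.1 (hω0.eventually (gt_mem_nhds hlam))
    refine ⟨max n1 (max n2 n3), fun n hn m hm t ht => ?_⟩
    simp only [ge_iff_le, max_le_iff] at hn hm
    have hin := disc_int (N := N n) (l := l n) (x := x n) (hτ n) (hMT n) ht
    have him := disc_int (N := N m) (l := l m) (x := x m) (hτ m) (hMT m) ht
    have hen := dens_integrable (N n) (l n) (fun j => xi (M n) (τ n) (x n) j t)
    have hem := dens_integrable (N m) (l m) (fun j => xi (M m) (τ m) (x m) j t)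
    have t1 := tri_int hin hen him
    have t2 := tri_int hen hem him
    have c1 := h1 n hn.1 t ht
    have c2 := h1 m hm.1 t ht
    have c3 := hpc _ _ _ _ _ _ _ _ _ _ (hx n) (hx m) (hlN n) (hlN m) (h2 n hn.2.1).le (h2 m hm.2.1).le
      (h3 n hn.2.2).le (h3 m hm.2.2).le
      (by simp only [xi_zero]; exact hcmp n m) (by simp only [xi_zero]; exact hcmp m n) t ⟨ht.1, ht.2.le⟩
    have c1' : ∫ y, |discDens (N n) (M n) (l n) (τ n) (x n) y t -
        dens (N n) (l n) (fun j => xi (M n) (τ n) (x n) j t) y| ≤ δ / 3 := by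
      simpa only [abs_sub_comm] using c1
    simp only [hD] at c2 ⊢
    linarith
  obtain ⟨f, hf, hfint, hlim⟩ := l1_limit hDi (by
    intro ε hε
    obtain ⟨n0, h⟩ := hcau (ε / T) (by positivity)
    refine ⟨n0, fun n hn m hm => ?_⟩
    have hi : Integrable (fun p => |D n p - D m p|) (slab T) := ((hDi n).sub (hDi m)).abs
    rw [← slab_fub hT.le hi]
    have h2 : ∫ t in (0:ℝ)..T, ∫ y, |D n (t, y) - D m (t, y)| ≤ ∫ t in (0:ℝ)..T, ε / T :=
      intervalIntegral.integral_mono_on_of_le_Ioo hT.le (slab_fub_int hT.le hi) (by simp)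
        fun t ht => h n hn m hm t ⟨ht.1.le, ht.2⟩
    refine h2.trans (le_of_eq ?_)
    rw [intervalIntegral.integral_const, smul_eq_mul, sub_zero]
    field_simp)
  classical
  set ρ : ℝ → ℝ → ℝ := fun y t => if y ∈ Set.Icc A B then max 0 (min R (f (t, y))) else 0 with hρdef
  have hρm : Measurable (Function.uncurry ρ) := by
    refine Measurable.ite (measurable_fst measurableSet_Icc) ?_ measurable_const
    exact measurable_const.max (measurable_const.min (hf.comp measurable_swap))
  have hρs : ∀ y t, y ∉ Set.Icc A B → ρ y t = 0 := fun y t hy => by simp only [hρdef]; rw [if_neg hy]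
  have hρR : ∀ y t, ρ y t ∈ Set.Icc 0 R := by
    intro y t
    simp only [hρdef]
    split_ifs
    · exact ⟨le_max_left _ _, max_le hR.le (min_le_left _ _)⟩
    · exact ⟨le_rfl, hR.le⟩
  have hpt : ∀ n p, |D n p - ρ p.2 p.1| ≤ |D n p - f p| := by
    intro n p
    by_cases hp : p.2 ∈ Set.Icc A B
    · simp only [hρdef]
      rw [if_pos hp]
      have h1 := clamp_lip R (D n p) (f p)
      rwa [min_eq_right (hDR n p).2, max_eq_right (hDR n p).1] at h1
    · rw [hρs _ _ hp, hDs n p hp]; simp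
  have hρ' : Measurable fun p : ℝ × ℝ => ρ p.2 p.1 := hρm.comp measurable_swap
  have hρi : Integrable (fun p : ℝ × ℝ => ρ p.2 p.1) (slab T) := by
    refine slab_int (A := A) (B := B) (Kb := R) hρ' (fun p => ?_) (fun p hp => hρs _ _ hp)
    rw [abs_of_nonneg (hρR p.2 p.1).1]; exact (hρR p.2 p.1).2
  have hdi : ∀ n, Integrable (fun p : ℝ × ℝ => |D n p - ρ p.2 p.1|) (slab T) := fun n =>
    ((hDi n).sub hρi).abs
  have hconv : Tendsto (fun n => ∫ t in (0 : ℝ)..T, ∫ y : ℝ, |D n (t, y) - ρ y t|) atTop (nhds 0) := by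
    have e : ∀ n, ∫ t in (0 : ℝ)..T, ∫ y : ℝ, |D n (t, y) - ρ y t| =
        ∫ p, |D n p - ρ p.2 p.1| ∂(slab T) := fun n => slab_fub hT.le (hdi n)
    simp only [e]
    refine squeeze_zero (fun n => integral_nonneg fun p => abs_nonneg _) (fun n => ?_) hlim
    exact integral_mono (hdi n) ((hDi n).sub hfint).abs (hpt n)
  refine ⟨ρ, hρm, hρs, hρR, ?_, hconv⟩
  intro k hk φ a b Φ K hφ
  refine entropy_limit (C := C) hT hR hva hvc hvl hLv hV hφ hk hρm hρR hρs hfm hfi ?_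
  intro δ hδ
  have hδ2 := half_pos hδ
  obtain ⟨n1, h1⟩ := hdd (δ / 2 / T) (by positivity)
  obtain ⟨n2, h2⟩ := eventually_atTop.1 (hl0.eventually (gt_mem_nhds hδ))
  obtain ⟨n3, h3⟩ := eventually_atTop.1 (hω0.eventually (gt_mem_nhds hδ))
  obtain ⟨n4, h4⟩ := eventually_atTop.1 (hconv.eventually (gt_mem_nhds hδ2))
  obtain ⟨P, hP, hP1⟩ := exists_P (c := (B - A) * Kf) hδ2
  have hl1 : Tendsto (fun n => P * (2 * (2 * l n))) atTop (nhds 0) := by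
    have := ((hl0.const_mul 2).const_mul 2).const_mul (P:ℝ)
    simpa using this
  obtain ⟨n5, h5⟩ := eventually_atTop.1 (hl1.eventually (gt_mem_nhds hδ2))
  obtain ⟨n, hn1, hn2, hn3, hn4, hn5⟩ : ∃ n, n1 ≤ n ∧ n2 ≤ n ∧ n3 ≤ n ∧ n4 ≤ n ∧ n5 ≤ n :=
    ⟨n1 + n2 + n3 + n4 + n5, by omega, by omega, by omega, by omega, by omega⟩
  have hii := slab_fub_int hT.le (hdi n)
  refine ⟨N n, l n, ω n, xi (M n) (τ n) (x n), u n,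
    fun t => δ / 2 / T + ∫ y, |D n (t, y) - ρ y t|, hx n, (h3 n hn3).le, (h2 n hn2).le, ?_, ?_, ?_, ?_⟩
  · simp only [xi_zero]
    refine (hclose n P hP).trans ?_
    have e : (B - A) / P * Kf = (B - A) * Kf / P := by ring
    rw [e]
    linarith [h5 n hn5]
  · exact (intervalIntegrable_const).add hii
  · rw [intervalIntegral.integral_add intervalIntegrable_const hii, intervalIntegral.integral_const,
      smul_eq_mul, sub_zero]
    have e : T * (δ / 2 / T) = δ / 2 := by field_simp
    rw [e]
    linarith [h4 n hn4]
  · intro t ht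
    have ht' : t ∈ Set.Ico 0 T := ⟨ht.1.le, ht.2⟩
    have hin := disc_int (N := N n) (l := l n) (x := x n) (hτ n) (hMT n) ht'
    have hen := dens_integrable (N n) (l n) (fun j => xi (M n) (τ n) (x n) j t)
    have hρt : Integrable fun y => ρ y t := by
      have h1 : IntegrableOn (fun y => ρ y t) (Set.Icc A B) := by
        refine Measure.integrableOn_of_bounded (M := R) (by simp)
          (hρm.comp (measurable_id.prodMk measurable_const)).aestronglyMeasurable ?_
        refine Eventually.of_forall fun y => ?_
        rw [Real.norm_eq_abs, abs_of_nonneg (hρR y t).1]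
        exact (hρR y t).2
      refine (integrableOn_iff_integrable_of_support_subset ?_).1 h1
      intro y hy
      by_contra hc
      exact hy (hρs y t hc)
    have t1 := tri_int hen hin hρt
    have c1 := h1 n hn1 t ht'
    simp only [hD] at c1 ⊢
    linarith

/-- if moreover `N_n/M_n → 0`, then the whole sequence of discrete
densities converges strongly in `L¹(ℝ × [0,T])` to an entropy solution of
`∂_t ρ + ∂_x(ρ v(ρ)) = 0`, `ρ(·,0) = ρb`. -/
theorem convergence_to_entropy_solution
    (R T L θ Lv : ℝ) (v : ℝ → ℝ) (ρb : ℝ → ℝ)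
    (Nn Mn : ℕ → ℕ) (x : ℕ → ℕ → ℕ → ℝ)
    (hR : 0 < R) (hT : 0 < T) (hLpos : 0 < L)
    (hθ : θ ∈ Set.Icc (0 : ℝ) 1)
    (hv : ContDiffOn ℝ 1 v (Set.Icc 0 R))
    (hv' : ∀ ρ' ∈ Set.Icc (0 : ℝ) R, derivWithin v (Set.Icc 0 R) ρ' < 0)
    (hvleft : ∀ ρ' < (0 : ℝ), v ρ' = v 0)
    (hvright : ∀ ρ', R < ρ' → v ρ' = v R)
    (hLv : ∀ a ∈ Set.Icc (0 : ℝ) R, ∀ b ∈ Set.Icc (0 : ℝ) R, |v a - v b| ≤ Lv * |a - b|)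
    (hBV : BoundedVariationOn ρb Set.univ)
    (hsupp : HasCompactSupport ρb)
    (hbound : ∀ᵐ z ∂(volume : Measure ℝ), ρb z ∈ Set.Icc 0 R)
    (hLdef : (∫ z, ρb z) = L)
    (hNpos : ∀ n, 0 < Nn n) (hMpos : ∀ n, 0 < Mn n)
    (hNtop : Tendsto Nn atTop atTop) (hMtop : Tendsto Mn atTop atTop)
    (hCFL : ∀ n, θ * (Nn n) * T * Lv * R ^ 2 < L * (Mn n))
    (hratio : Tendsto (fun n => (Nn n : ℝ) / (Mn n : ℝ)) atTop (nhds 0))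
    (hscheme : ∀ n, IsScheme (Nn n) (Mn n) (L / Nn n) (T / Mn n) θ v (x n))
    (hinit0 : ∀ n, x n 0 0 = sInf (tsupport ρb))
    (hinit : ∀ n, ∀ i < Nn n,
      IsLeast {z : ℝ | x n i 0 ≤ z ∧ L / Nn n ≤ ∫ s in (x n i 0)..z, ρb s} (x n (i + 1) 0))
    (hbnd : ∀ n, ∀ m ≤ Mn n, ∀ i < Nn n,
      0 < Rd (Nn n) (L / Nn n) (x n) i m ∧ Rd (Nn n) (L / Nn n) (x n) i m ≤ R) :
    ∃ ρ : ℝ → ℝ → ℝ,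
      Measurable (Function.uncurry ρ) ∧
      (∃ A B : ℝ, ∀ t ∈ Set.Icc (0 : ℝ) T, ∀ y : ℝ, (y < A ∨ B < y) → ρ y t = 0) ∧
      (∀ t ∈ Set.Icc (0 : ℝ) T, ∀ᵐ y ∂(volume : Measure ℝ), ρ y t ∈ Set.Icc 0 R) ∧
      (∀ k ∈ Set.Icc (0 : ℝ) R, ∀ φ : ℝ → ℝ → ℝ,
        ContDiff ℝ 1 (Function.uncurry φ) →
        HasCompactSupport (Function.uncurry φ) →
        (∀ y : ℝ, ∀ t : ℝ, T ≤ t → φ y t = 0) →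
        (∀ y t : ℝ, 0 ≤ φ y t) →
        0 ≤ (∫ t in (0 : ℝ)..T, ∫ y : ℝ,
              (|ρ y t - k| * deriv (fun s => φ y s) t +
                Real.sign (ρ y t - k) * (ρ y t * v (ρ y t) - k * v k) *
                  deriv (fun z => φ z t) y)) +
            (∫ y : ℝ, |ρb y - k| * φ y 0)) ∧
      Tendsto
        (fun n => ∫ t in (0 : ℝ)..T, ∫ y : ℝ,
          |discDens (Nn n) (Mn n) (L / Nn n) (T / Mn n) (x n) y t - ρ y t|)
        atTop (nhds 0) := by
  obtain ⟨hva, hvl, hLv0, ⟨V, hV0, hV⟩, hvc⟩ := v_global hR hv hv' hvleft hvright hLv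
  set A0 := sInf (tsupport ρb) with hA0
  set B0 := sSup (tsupport ρb) with hB0
  have hne : (tsupport ρb).Nonempty := by
    by_contra hc
    rw [Set.not_nonempty_iff_eq_empty, tsupport_eq_empty_iff] at hc
    rw [hc] at hLdef
    simp at hLdef
    linarith
  have hAB0 : A0 ≤ B0 := by
    obtain ⟨z, hz⟩ := hne
    exact (csInf_le hsupp.isCompact.bddBelow hz).trans (le_csSup hsupp.isCompact.bddAbove hz)
  have hI : InitData ρb R L A0 B0 :=
    ⟨hBV, bv_integrable hBV hsupp hbound, hbound, fun y hy => out_zero hsupp hy, hLdef⟩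
  have hNr : ∀ n, (0:ℝ) < Nn n := fun n => by exact_mod_cast hNpos n
  have hMr : ∀ n, (0:ℝ) < Mn n := fun n => by exact_mod_cast hMpos n
  have hl : ∀ n, 0 < L / Nn n := fun n => div_pos hLpos (hNr n)
  have hτ : ∀ n, 0 < T / Mn n := fun n => div_pos hT (hMr n)
  have hlN : ∀ n, L / Nn n * Nn n = L := fun n => div_mul_cancel₀ _ (hNr n).ne'
  have hMT : ∀ n, (Mn n : ℝ) * (T / Mn n) = T := fun n => mul_div_cancel₀ _ (hMr n).ne'
  have hl0 : Tendsto (fun n => L / (Nn n : ℝ)) atTop (nhds 0) :=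
    (tendsto_const_div_atTop_nhds_zero_nat L).comp hNtop
  have hτ0 : Tendsto (fun n => T / (Mn n : ℝ)) atTop (nhds 0) :=
    (tendsto_const_div_atTop_nhds_zero_nat T).comp hMtop
  have hμeq : ∀ n, Lv * R^2 * (T / Mn n) / (L / Nn n) = Lv * R^2 * T / L * ((Nn n : ℝ) / Mn n) := by
    intro n
    have h1 := (hNr n).ne'
    have h2 := (hMr n).ne'
    field_simp
  have hμ0 : Tendsto (fun n => Lv * R^2 * (T / Mn n) / (L / Nn n)) atTop (nhds 0) := by
    simp only [hμeq]
    simpa using hratio.const_mul (Lv * R^2 * T / L)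
  obtain ⟨Mμ, hMμ⟩ := hμ0.bddAbove_range
  have hMμ' : ∀ n, Lv * R^2 * (T / Mn n) / (L / Nn n) ≤ Mμ := fun n => hMμ ⟨n, rfl⟩
  have hCFL' : ∀ n, θ * (Lv * R^2 * (T / Mn n) / (L / Nn n)) ≤ 1 := by
    intro n
    rw [hμeq]
    have h1 := hCFL n
    have h2 := hNr n
    have h3 := hMr n
    have e : θ * (Lv * R^2 * T / L * ((Nn n : ℝ) / Mn n)) = θ * (Nn n) * T * Lv * R ^ 2 / (L * Mn n) := by
      field_simp
    rw [e, div_le_one (by positivity)]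
    exact h1.le
  set K := totv ρb + R with hK
  have hmass : ∀ n, ∀ i ≤ Nn n, x n i 0 ∈ Set.Icc A0 B0 := fun n i hi =>
    (hI.mass (X := fun j => x n j 0) hAB0 (hl n) (hlN n) (hinit0 n) (hinit n)
      (show A0 - 1 < A0 by linarith) i hi).1
  have htv : ∀ n, ∑ i ∈ Finset.range (Nn n), |Rd (Nn n) (L / Nn n) (x n) (i+1) 0 -
      Rd (Nn n) (L / Nn n) (x n) i 0| ≤ K := fun n =>
    hI.tv (X := fun j => x n j 0) hAB0 (hl n) (hlN n) (hinit0 n) (hNpos n) (hinit n)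
      (fun i hi => (hscheme n).1 0 (Nat.zero_le _) i hi) (fun i hi => hbnd n 0 (Nat.zero_le _) i hi)
  have htraj := fun n => traj_of_scheme hva hvl hLv0 hV hR (hτ n) (hl n) (hNpos n) (hMpos n) (hMT n) hθ
    (hscheme n) (hbnd n) (hCFL' n) (htv n) (hMμ' n) (hmass n)
  have hω0 : Tendsto (fun n => Lv * (Lv * R^2 * (T / Mn n) / (L / Nn n) * K)) atTop (nhds 0) := by
    simpa using (hμ0.mul_const K).const_mul Lv
  have hVT : 0 ≤ V * T := by positivity
  obtain ⟨ρ, h1, h2, h3, h4, h5⟩ := conv_core (Kf := 2 * (K * (1 + 2 * Mμ)) + totv ρb) (ρb := ρb) hR hT (by linarith) hva hvc hvl hLv0 hV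
    (bv_measurable hBV) hI.int htraj hτ hMT hlN hτ0 hl0 hω0
    (fun n i hi m hm => scheme_inc hV (hτ n) hθ (hscheme n) hi hm)
    (fun n n' => hI.cmp (X := fun j => x n j 0) (Y := fun j => x n' j 0) hAB0 hR.le (hl n) (hl n')
      (hlN n) (hinit0 n) (hlN n') (hinit0 n') (hinit n) (hinit n'))
    (fun n P hP => by
      have hc := (htraj n).cfg (t := 0) ⟨le_rfl, hT.le⟩
      simp only [xi_zero] at hc
      exact hI.close hAB0 hR.le hc (hlN n) (hinit0 n) (hinit n) (by linarith) (by linarith) hP)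
  refine ⟨ρ, h1, ⟨A0 - V * T - 1, B0 + V * T + 1, ?_⟩, fun t _ => Eventually.of_forall fun y => h3 y t, ?_, h5⟩
  · intro t _ y hy
    refine h2 y t fun hc => ?_
    rcases hy with hy | hy
    · exact absurd hc.1 (not_le.2 hy)
    · exact absurd hc.2 (not_le.2 hy)
  · intro k hk φ e1 e2 e3 e4
    obtain ⟨a, b, Φ, K', hφ⟩ := test_exists e1 e2 e3 e4
    have h := h4 k hk φ a b Φ K' hφ
    simp only [Qf_sign hva]
    exact h
end

section
/- Let μ, η : ℝ → [0,∞) be compactly supported probability densities (∫_ℝ μ = ∫_ℝ η = 1) of bounded variation, and let F_μ(x) = ∫_{−∞}^x μ(y) dy and F_η(x) = ∫_{−∞}^x η(y) dy be their cumulative distribution functions. Then ∫_ℝ |μ(x) − η(x)| dx ≤ 2 ( TV(μ) + TV(η) )^{1/2} ( ∫_ℝ |F_μ(x) − F_η(x)| dx )^{1/2}, where TV denotes the total variation of a BV function on ℝ. (Since ∫_ℝ |F_μ − F_η| equals the 1-Wasserstein distance d₁(μ, η) in one dimension, this is the interpolation inequality ‖μ − η‖_{L¹} ≤ 2 (TV(μ)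 + TV(η))^{1/2} d₁(μ, η)^{1/2}.) -/
open MeasureTheory

lemma aux_opt (x V W : ℝ) (hV : 0 ≤ V) (hW : 0 ≤ W)
    (H : ∀ h : ℝ, 0 < h → x ≤ V * h + W / h) : x ≤ 2 * √V * √W := by
  have h1 : ∀ e : ℝ, 0 < e → x ≤ 2 * √V * √W + e * (√V + √W) := by
    intro e he
    have hv := Real.sqrt_nonneg V
    have hw := Real.sqrt_nonneg W
    have h2 := H ((√W + e) / (√V + e)) (by positivity)
    have h3 : V * ((√W + e) / (√V + e)) ≤ √V * (√W + e) := by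
      rw [← mul_div_assoc, div_le_iff₀ (by positivity)]
      nth_rewrite 1 [← Real.mul_self_sqrt hV]
      have : 0 ≤ √V * (√W + e) * e := by positivity
      nlinarith
    have h4 : W / ((√W + e) / (√V + e)) ≤ √W * (√V + e) := by
      rw [div_div_eq_mul_div, div_le_iff₀ (by positivity)]
      nth_rewrite 1 [← Real.mul_self_sqrt hW]
      have : 0 ≤ √W * (√V + e) * e := by positivity
      nlinarith
    nlinarith
  have h2 : Filter.Tendsto (fun e : ℝ => 2 * √V * √W + e * (√V + √W)) (nhdsWithin 0 (Set.Ioi 0))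
      (nhds (2 * √V * √W)) := by
    have : Continuous (fun e : ℝ => 2 * √V * √W + e * (√V + √W)) := by fun_prop
    have := (this.tendsto 0).mono_left (nhdsWithin_le_nhds (s := Set.Ioi 0))
    simpa using this
  refine ge_of_tendsto h2 ?_
  filter_upwards [self_mem_nhdsWithin] with e he using h1 e he

lemma aux_v (f : ℝ → ℝ) (hf : BoundedVariationOn f Set.univ) :
    ∃ v : ℝ → ℝ, (∀ x, 0 ≤ v x) ∧ (∀ x, v x ≤ (eVariationOn f Set.univ).toReal) ∧
      ∀ x y, x ≤ y → |f x - f y| ≤ v y - v x := by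
  have hfin : ∀ s, eVariationOn f s ≠ ⊤ := fun s => hf.mono (Set.subset_univ s)
  refine ⟨fun x => (eVariationOn f (Set.Iic x)).toReal, fun x => ENNReal.toReal_nonneg,
    fun x => ENNReal.toReal_mono hf (eVariationOn.mono f (Set.subset_univ _)), ?_⟩
  intro x y hxy
  have h1 := eVariationOn.add_le_union f (s := Set.Iic x) (t := Set.Icc x y)
    (fun a ha b hb => le_trans ha hb.1)
  have h2 : Set.Iic x ∪ Set.Icc x y = Set.Iic y := Set.Iic_union_Icc_eq_Iic hxy
  rw [h2] at h1
  have h3 := eVariationOn.edist_le f (s := Set.Icc x y) (x := x) (y := y) ⟨le_rfl, hxy⟩ ⟨hxy, le_rfl⟩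
  have h4 := ENNReal.toReal_mono (hfin _) ((add_le_add_right h3 (eVariationOn f (Set.Iic x))).trans h1)
  rw [ENNReal.toReal_add (hfin _) (edist_ne_top _ _), edist_dist, ENNReal.toReal_ofReal dist_nonneg,
    Real.dist_eq] at h4
  simp only
  linarith

lemma aux_main (f v F : ℝ → ℝ) (V W : ℝ) (hv0 : ∀ x, 0 ≤ v x) (hvV : ∀ x, v x ≤ V)
    (hfv : ∀ x y, x ≤ y → |f x - f y| ≤ v y - v x)
    (hf : Integrable f) (hF : Integrable F) (hW : W = ∫ y, |F y|)
    (hFf : ∀ a b, a ≤ b → F b - F a = ∫ t in a..b, f t)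
    (h : ℝ) (hh : 0 < h) (a b : ℝ) (hab : a ≤ b) :
    ∫ t in a..b, |f t| ≤ V * h + W / h := by
  have hmono : Monotone v := fun x y hxy => by
    have := (abs_nonneg _).trans (hfv x y hxy); linarith
  have hvi : ∀ a b, IntervalIntegrable v volume a b := fun a b => hmono.intervalIntegrable
  have hfi : ∀ a b, IntervalIntegrable f volume a b := fun a b => hf.intervalIntegrable
  have pt : ∀ x, |f x| ≤ (v (x+h) - v (x-h)) / 2 + (|F (x+h)| + |F (x-h)|) / (2*h) := by
    intro x
    have e1 : |∫ t in (x-h)..x, (f x - f t)| ≤ (v x - v (x-h)) * |x - (x-h)| := by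
      rw [← Real.norm_eq_abs]
      apply intervalIntegral.norm_integral_le_of_norm_le_const
      intro t ht
      rw [Set.uIoc_of_le (by linarith)] at ht
      rw [Real.norm_eq_abs, abs_sub_comm]
      have := hfv t x ht.2
      have := hmono ht.1.le
      linarith
    have e2 : |∫ t in x..(x+h), (f x - f t)| ≤ (v (x+h) - v x) * |x + h - x| := by
      rw [← Real.norm_eq_abs]
      apply intervalIntegral.norm_integral_le_of_norm_le_const
      intro t ht
      rw [Set.uIoc_of_le (by linarith)] at ht
      rw [Real.norm_eq_abs]
      have := hfv x t ht.1.le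
      have := hmono ht.2
      linarith
    rw [intervalIntegral.integral_sub (by simp) (hfi _ _), intervalIntegral.integral_const,
      ← hFf _ _ (by linarith)] at e1 e2
    simp only [sub_sub_cancel, add_sub_cancel_left, abs_of_pos hh, smul_eq_mul] at e1 e2
    have e3 : 2 * h * |f x| ≤ h * (v (x+h) - v (x-h)) + (|F (x+h)| + |F (x-h)|) := by
      rw [← abs_of_pos (show 0 < 2 * h by linarith), ← abs_mul]
      rw [abs_le] at e1 e2 ⊢
      have := neg_abs_le (F (x+h)); have := le_abs_self (F (x+h))
      have := neg_abs_le (F (x-h)); have := le_abs_self (F (x-h))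
      constructor <;> linarith [e1.1, e1.2, e2.1, e2.2]
    have e4 : (v (x+h) - v (x-h)) / 2 + (|F (x+h)| + |F (x-h)|) / (2*h)
      = (h * (v (x+h) - v (x-h)) + (|F (x+h)| + |F (x-h)|)) / (2*h) := by field_simp
    rw [e4, le_div_iff₀ (by positivity)]
    linarith
  have vp : IntervalIntegrable (fun x => v (x+h)) volume a b :=
    Monotone.intervalIntegrable fun x y hxy => hmono (by linarith)
  have vm : IntervalIntegrable (fun x => v (x-h)) volume a b :=
    Monotone.intervalIntegrable fun x y hxy => hmono (by linarith)
  have Fpi : Integrable (fun x => |F (x+h)|) := (hF.comp_add_right h).abs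
  have Fmi : Integrable (fun x => |F (x-h)|) := (hF.comp_sub_right h).abs
  have Fp : ∫ x in a..b, |F (x+h)| ≤ W := by
    rw [intervalIntegral.integral_of_le hab, hW, ← integral_add_right_eq_self (fun x => |F x|) h]
    exact setIntegral_le_integral Fpi (Filter.Eventually.of_forall fun x => abs_nonneg _)
  have Fm : ∫ x in a..b, |F (x-h)| ≤ W := by
    rw [intervalIntegral.integral_of_le hab, hW, ← integral_sub_right_eq_self (fun x => |F x|) h]
    exact setIntegral_le_integral Fmi (Filter.Eventually.of_forall fun x => abs_nonneg _)
  have hvI : (∫ x in a..b, v (x+h)) - ∫ x in a..b, v (x-h) ≤ 2 * h * V := by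
    rw [intervalIntegral.integral_comp_add_right, intervalIntegral.integral_comp_sub_right]
    have s1 := intervalIntegral.integral_add_adjacent_intervals (hvi (a-h) (a+h)) (hvi (a+h) (b+h))
    have s2 := intervalIntegral.integral_add_adjacent_intervals (hvi (a-h) (b-h)) (hvi (b-h) (b+h))
    have s3 : 0 ≤ ∫ x in (a-h)..(a+h), v x :=
      intervalIntegral.integral_nonneg (by linarith) fun x _ => hv0 x
    have s4 : ∫ x in (b-h)..(b+h), v x ≤ ∫ x in (b-h)..(b+h), V :=
      intervalIntegral.integral_mono_on (by linarith) (hvi _ _) (by simp) fun x _ => hvV x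
    rw [intervalIntegral.integral_const, smul_eq_mul] at s4
    linarith
  have Fi := (Fpi.intervalIntegrable (a := a) (b := b)).add (Fmi.intervalIntegrable (a := a) (b := b))
  have key := intervalIntegral.integral_mono_on hab (hfi a b).abs
    (((vp.sub vm).div_const 2).add (Fi.div_const (2*h))) (fun x _ => pt x)
  rw [intervalIntegral.integral_add ((vp.sub vm).div_const 2) (Fi.div_const (2*h)),
    intervalIntegral.integral_div, intervalIntegral.integral_div,
    intervalIntegral.integral_sub vp vm,
    intervalIntegral.integral_add Fpi.intervalIntegrable Fmi.intervalIntegrable] at key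
  refine key.trans (add_le_add (by linarith) ?_)
  rw [div_le_div_iff₀ (by positivity) hh]
  nlinarith

/-- interpolation inequality between `L¹`, `BV` and the 1-Wasserstein
distance: for compactly supported BV probability densities `μ, η` on `ℝ`,
`‖μ - η‖_{L¹} ≤ 2 (TV(μ) + TV(η))^{1/2} (∫ |F_μ - F_η|)^{1/2}`, where `F_μ, F_η` are the
cumulative distribution functions (so that `∫ |F_μ - F_η| = d₁(μ, η)`). -/
theorem L1_BV_Wasserstein_interpolation
    (μ η : ℝ → ℝ)
    (hμpos : ∀ y : ℝ, 0 ≤ μ y) (hηpos : ∀ y : ℝ, 0 ≤ η y)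
    (hμsupp : HasCompactSupport μ) (hηsupp : HasCompactSupport η)
    (hμBV : BoundedVariationOn μ Set.univ) (hηBV : BoundedVariationOn η Set.univ)
    (hμmass : (∫ y, μ y) = 1) (hηmass : (∫ y, η y) = 1) :
    (∫ y : ℝ, |μ y - η y|) ≤
      2 * Real.sqrt ((eVariationOn μ Set.univ).toReal + (eVariationOn η Set.univ).toReal) *
        Real.sqrt (∫ y : ℝ, |(∫ s in Set.Iic y, μ s) - (∫ s in Set.Iic y, η s)|) := by
  have hμi : Integrable μ := by
    by_contra hc; rw [integral_undef hc] at hμmass; norm_num at hμmass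
  have hηi : Integrable η := by
    by_contra hc; rw [integral_undef hc] at hηmass; norm_num at hηmass
  obtain ⟨v, hv0, hvV, hvf⟩ := aux_v μ hμBV
  obtain ⟨w, hw0, hwV, hwf⟩ := aux_v η hηBV
  set f : ℝ → ℝ := fun y => μ y - η y with hf
  have hfi : Integrable f := hμi.sub hηi
  have hfs : HasCompactSupport f := hμsupp.sub hηsupp
  have hf0 : ∫ y, f y = 0 := by rw [integral_sub hμi hηi, hμmass, hηmass]; simp
  set F : ℝ → ℝ := fun y => (∫ s in Set.Iic y, μ s) - (∫ s in Set.Iic y, η s) with hFdef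
  have hFeq : ∀ y, F y = ∫ s in Set.Iic y, f s := fun y =>
    (integral_sub hμi.integrableOn hηi.integrableOn).symm
  have hFf : ∀ a b, a ≤ b → F b - F a = ∫ t in a..b, f t := by
    intro a b _
    rw [hFeq, hFeq, intervalIntegral.integral_Iic_sub_Iic hfi.integrableOn hfi.integrableOn]
  obtain ⟨R, hR0, hR⟩ : ∃ R : ℝ, 0 ≤ R ∧ ∀ x, x ∉ Set.Icc (-R) R → f x = 0 := by
    obtain ⟨R, hR⟩ := hfs.isBounded.subset_closedBall 0
    refine ⟨max R 0, le_max_right _ _, fun x hx => image_eq_zero_of_notMem_tsupport fun hx' => hx ?_⟩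
    have := hR hx'
    rw [Metric.mem_closedBall, dist_zero_right, Real.norm_eq_abs] at this
    have := abs_le.1 (this.trans (le_max_left R 0))
    exact this
  have hFout : ∀ x, x ∉ Set.Icc (-R) R → F x = 0 := by
    intro x hx
    rw [hFeq]
    by_cases hx1 : x < -R
    · apply setIntegral_eq_zero_of_forall_eq_zero
      intro t ht
      exact hR t fun h => by have := h.1; have := Set.mem_Iic.1 ht; linarith
    · have hx2 : R < x := by
        by_contra hc; exact hx ⟨not_lt.1 hx1, not_lt.1 hc⟩
      rw [← hf0]
      apply setIntegral_eq_integral_of_forall_compl_eq_zero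
      intro t ht
      exact hR t fun h => by have := h.2; have := not_le.1 (fun h3 => ht (Set.mem_Iic.2 h3)); linarith
  have hFc : Continuous F := by
    have : F = fun x => F 0 + ∫ t in (0:ℝ)..x, f t := by
      funext x
      have := intervalIntegral.integral_Iic_sub_Iic (μ := volume) (f := f) (a := 0) (b := x)
        hfi.integrableOn hfi.integrableOn
      rw [hFeq, hFeq, ← this]; ring
    rw [this]
    exact continuous_const.add (intervalIntegral.continuous_primitive (fun a b => hfi.intervalIntegrable) 0)
  have hFi : Integrable F :=
    hFc.integrable_of_hasCompactSupport (HasCompactSupport.intro isCompact_Icc hFout)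
  apply aux_opt _ _ _ (by positivity) (integral_nonneg fun _ => abs_nonneg _)
  intro h hh
  have := aux_main f (fun x => v x + w x) F _ _ (fun x => add_nonneg (hv0 x) (hw0 x))
    (fun x => add_le_add (hvV x) (hwV x)) (fun x y hxy => by
      have h1 := abs_le.1 (hvf x y hxy); have h2 := abs_le.1 (hwf x y hxy)
      rw [abs_le]; simp only [hf]
      constructor <;> linarith [h1.1, h1.2, h2.1, h2.2]) hfi hFi rfl hFf h hh (-R-1) R (by linarith)
  refine le_trans (le_of_eq ?_) this
  rw [intervalIntegral.integral_of_le (by linarith)]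
  symm
  apply setIntegral_eq_integral_of_forall_compl_eq_zero
  intro t ht
  rw [abs_eq_zero]
  exact hR t fun h => ht ⟨by linarith [h.1], h.2⟩
end
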